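/- Geodesic completeness: for every γ₀ ∈ 𝓜 and every v₀ ∈ H^s(𝕋,ℝⁿ) there exists a unique curve Γ ∈ C²([0,∞), 𝓜) (𝓜 regarded as an open subset of H^s(𝕋,ℝⁿ)) with Γ(0) = γ₀, Γ̇(0) = v₀, solving the geodesic equation Γ̈(t) + A_{Γ(t)}(Γ̇(t)) Γ̇(t) = 0 for all t ∈ [0,∞); i.e., the maximal solution of the geodesic initial value problem for G exists for all times. -/

import Mathlib

open MeasureTheory Real Filter Set
open scoped ENNReal Topology RealInnerProductSpace

noncomputable section

/-- Euclidean space `ℝⁿ`. -/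
abbrev En (n : ℕ) : Type := EuclideanSpace ℝ (Fin n)

/-- A fundamental domain for the circle `𝕋 = ℝ/ℤ`. -/
def I01 : Set ℝ := Set.Ico (0 : ℝ) 1

/-- The intrinsic distance on `𝕋 = ℝ/ℤ`, expressed for real representatives. -/
def dT (x y : ℝ) : ℝ := ⨅ k : ℤ, |x - y - (k : ℝ)|

/-- Supremum norm of a (periodic) function on the circle. -/
def supNorm {E : Type*} [NormedAddCommGroup E] (f : ℝ → E) : ℝ := ⨆ x : ℝ, ‖f x‖

/-- The squared Gagliardo seminorm `[v]_{H^σ}²` of a function on the circle, valued in `[0,∞]`. -/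
def gagliardoSqE {E : Type*} [NormedAddCommGroup E] (σ : ℝ) (v : ℝ → E) : ℝ≥0∞ :=
  ∫⁻ x in I01, ∫⁻ y in I01, ENNReal.ofReal (‖v y - v x‖ ^ 2 / dT x y ^ (2 * σ + 1))

/-- Membership in the Sobolev–Slobodeckij space `H^s(𝕋, ℝⁿ)`; for `s ∈ (3/2,2)` such
functions have a `C¹` representative, which we take as the defining data. -/
def InHs {n : ℕ} (s : ℝ) (u : ℝ → En n) : Prop :=
  Function.Periodic u 1 ∧ ContDiff ℝ 1 u ∧ gagliardoSqE (s - 1) (deriv u) < ⊤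

/-- The squared `H^s` norm `‖u‖²_{L²} + ‖u'‖²_{L²} + [u']²_{H^{s-1}}`. -/
def HsNormSq {n : ℕ} (s : ℝ) (u : ℝ → En n) : ℝ :=
  (∫ x in I01, ‖u x‖ ^ 2) + (∫ x in I01, ‖deriv u x‖ ^ 2) +
    (gagliardoSqE (s - 1) (deriv u)).toReal

/-- The `H^s` norm. -/
def HsNorm {n : ℕ} (s : ℝ) (u : ℝ → En n) : ℝ := Real.sqrt (HsNormSq s u)

/-- The `H^s` inner product. -/
def HsInner {n : ℕ} (s : ℝ) (u v : ℝ → En n) : ℝ :=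
  (∫ x in I01, ⟪u x, v x⟫) + (∫ x in I01, ⟪deriv u x, deriv v x⟫) +
    ∫ x in I01, ∫ y in I01,
      ⟪deriv u y - deriv u x, deriv v y - deriv v x⟫ / dT x y ^ (2 * (s - 1) + 1)

/-- The manifold `𝓜` of embedded closed curves of class `H^s`: injective (on the circle)
immersions. -/
def InM {n : ℕ} (s : ℝ) (γ : ℝ → En n) : Prop :=
  InHs s γ ∧ Set.InjOn γ I01 ∧ ∀ x, deriv γ x ≠ 0

/-- The length `L(γ)`. -/
def arcLen {n : ℕ} (γ : ℝ → En n) : ℝ := ∫ x in I01, ‖deriv γ x‖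

/-- The arc-length distance `d_γ(x,y)`: the length of the shorter of the two arcs of `γ`
between `x` and `y`. -/
def arcDist {n : ℕ} (γ : ℝ → En n) (x y : ℝ) : ℝ :=
  ⨅ k : ℤ, |∫ t in x..(y + (k : ℝ)), ‖deriv γ t‖|

/-- Derivative with respect to arc length, `D_γ u = u' / |γ'|`. -/
def Dg {n : ℕ} (γ u : ℝ → En n) (x : ℝ) : En n := ‖deriv γ x‖⁻¹ • deriv u x

/-- `𝒟_γ u (x)`, the pointwise linear map `w ↦ |γ'(x)|⁻² ⟪γ'(x), w⟫ u'(x)`. -/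
def DDg {n : ℕ} (γ u : ℝ → En n) (x : ℝ) (w : En n) : En n :=
  ((‖deriv γ x‖ ^ 2)⁻¹ * ⟪deriv γ x, w⟫) • deriv u x

/-- The operator `R^s_γ`. -/
def Rop {n : ℕ} (s : ℝ) (γ u : ℝ → En n) (x y : ℝ) : En n :=
  (‖γ y - γ x‖ ^ s)⁻¹ • (u y - u x - DDg γ u x (γ y - γ x))

/-- Density of the measure `μ_γ` with respect to `λ ⊗ λ` on `𝕋 × 𝕋`. -/
def muW {n : ℕ} (γ : ℝ → En n) (x y : ℝ) : ℝ :=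
  ‖deriv γ x‖ * ‖deriv γ y‖ / ‖γ y - γ x‖

/-- Density of the measure `ν_γ` with respect to `λ ⊗ λ` on `𝕋 × 𝕋`. -/
def nuW {n : ℕ} (γ : ℝ → En n) (x y : ℝ) : ℝ :=
  ‖deriv γ x‖ * ‖deriv γ y‖ / arcDist γ x y

/-- The tangent-point energy, valued in `[0,∞]`. -/
def EtpE {n : ℕ} (s : ℝ) (γ : ℝ → En n) : ℝ≥0∞ :=
  ∫⁻ x in I01, ∫⁻ y in I01, ENNReal.ofReal (‖Rop s γ γ x y‖ ^ 2 * muW γ x y)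

/-- The tangent-point energy, real-valued (finite on `𝓜`). -/
def Etp {n : ℕ} (s : ℝ) (γ : ℝ → En n) : ℝ := (EtpE s γ).toReal

/-- `‖R^s_γ u‖²_{L²(ν_γ)}`, valued in `[0,∞]`. -/
def RnuSqE {n : ℕ} (s : ℝ) (γ u : ℝ → En n) : ℝ≥0∞ :=
  ∫⁻ x in I01, ∫⁻ y in I01, ENNReal.ofReal (‖Rop s γ u x y‖ ^ 2 * nuW γ x y)

/-- `‖R^s_γ u‖²_{L²(ν_γ)}`, real-valued. -/
def RnuSq {n : ℕ} (s : ℝ) (γ u : ℝ → En n) : ℝ := (RnuSqE s γ u).toReal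

/-- The squared `γ`-dependent seminorm `[u]²_{H^s(γ)}`, valued in `[0,∞]`. -/
def gagGammaSqE {n : ℕ} (s : ℝ) (γ u : ℝ → En n) : ℝ≥0∞ :=
  ∫⁻ x in I01, ∫⁻ y in I01,
    ENNReal.ofReal (‖Dg γ u y - Dg γ u x‖ ^ 2 / arcDist γ x y ^ (2 * (s - 1)) * nuW γ x y)

/-- The squared `γ`-dependent seminorm `[u]²_{H^s(γ)}`, real-valued. -/
def gagGammaSq {n : ℕ} (s : ℝ) (γ u : ℝ → En n) : ℝ := (gagGammaSqE s γ u).toReal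

/-- The inner product `⟨u,v⟩_{L²(γ)}`. -/
def innerL2g {n : ℕ} (γ u v : ℝ → En n) : ℝ := ∫ x in I01, ⟪u x, v x⟫ * ‖deriv γ x‖

/-- The inner product `⟨u,v⟩_{H¹(γ)}`. -/
def innerH1g {n : ℕ} (γ u v : ℝ → En n) : ℝ :=
  ∫ x in I01, ⟪Dg γ u x, Dg γ v x⟫ * ‖deriv γ x‖

/-- The squared `γ`-dependent norm `‖u‖²_{H^s(γ)}`. -/
def HsGammaNormSq {n : ℕ} (s : ℝ) (γ u : ℝ → En n) : ℝ :=
  innerL2g γ u u + innerH1g γ u u + gagGammaSq s γ u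

/-- The `γ`-dependent norm `‖u‖_{H^s(γ)}`. -/
def HsGammaNorm {n : ℕ} (s : ℝ) (γ u : ℝ → En n) : ℝ := Real.sqrt (HsGammaNormSq s γ u)

/-- The bilinear form `B¹_γ`. -/
def B1 {n : ℕ} (s : ℝ) (γ u v : ℝ → En n) : ℝ :=
  ∫ x in I01, ∫ y in I01, ⟪Rop s γ u x y, Rop s γ v x y⟫ * muW γ x y

/-- The bilinear form `B²_γ`. -/
def B2 {n : ℕ} (s : ℝ) (γ u v : ℝ → En n) : ℝ :=
  ∫ x in I01, ∫ y in I01,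
    ‖Rop s γ γ x y‖ ^ 2 * (⟪u y - u x, v y - v x⟫ / ‖γ y - γ x‖ ^ 2) * muW γ x y

/-- The bilinear form `B³_γ`. -/
def B3 {n : ℕ} (s : ℝ) (γ u v : ℝ → En n) : ℝ :=
  ∫ x in I01, ∫ y in I01,
    ‖Rop s γ γ x y‖ ^ 2 * (⟪Dg γ u x, Dg γ v x⟫ + ⟪Dg γ u y, Dg γ v y⟫) * muW γ x y

/-- The Riemannian metric `G_γ(u,v)`. -/
def Gmet {n : ℕ} (s : ℝ) (γ u v : ℝ → En n) : ℝ :=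
  2 * B1 s γ u v + (2 * s + 1) * B2 s γ u v + B3 s γ u v + innerH1g γ u v + innerL2g γ u v

/-- The distortion `distor(γ) = sup_{x ≠ y} d_γ(x,y)/|γ(y) − γ(x)|`, valued in `[0,∞]`. -/
def distorE {n : ℕ} (γ : ℝ → En n) : ℝ≥0∞ :=
  ⨆ (x ∈ I01) (y ∈ I01) (_ : x ≠ y), ENNReal.ofReal (arcDist γ x y / ‖γ y - γ x‖)

/-- The distortion, real-valued. -/
def distor {n : ℕ} (γ : ℝ → En n) : ℝ := (distorE γ).toReal

/-- A `C¹` path `[0,1] → 𝓜 ⊂ H^s(𝕋,ℝⁿ)` (with respect to the `H^s` topology), recorded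
together with its velocity field `V`. -/
structure C1Path (s : ℝ) (n : ℕ) where
  Γ : ℝ → ℝ → En n
  V : ℝ → ℝ → En n
  mem : ∀ t ∈ Set.Icc (0 : ℝ) 1, InM s (Γ t)
  memV : ∀ t ∈ Set.Icc (0 : ℝ) 1, InHs s (V t)
  isDeriv : ∀ t ∈ Set.Icc (0 : ℝ) 1,
    Tendsto (fun h : ℝ => HsNorm s fun x => h⁻¹ • (Γ (t + h) x - Γ t x) - V t x)
      (𝓝[{h : ℝ | t + h ∈ Set.Icc (0 : ℝ) 1 ∧ h ≠ 0}] 0) (𝓝 0)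
  contV : ∀ t ∈ Set.Icc (0 : ℝ) 1,
    Tendsto (fun τ : ℝ => HsNorm s fun x => V τ x - V t x) (𝓝[Set.Icc (0 : ℝ) 1] t) (𝓝 0)

/-- Length of a path with respect to `G`. -/
def pathLen {s : ℝ} {n : ℕ} (P : C1Path s n) : ℝ :=
  ∫ t in (0 : ℝ)..1, Real.sqrt (Gmet s (P.Γ t) (P.V t) (P.V t))

/-- The path (Dirichlet) energy of a path with respect to `G`. -/
def pathEnergy {s : ℝ} {n : ℕ} (P : C1Path s n) : ℝ :=
  (1 / 2) * ∫ t in (0 : ℝ)..1, Gmet s (P.Γ t) (P.V t) (P.V t)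

/-- The geodesic distance induced by `G`, valued in `[0,∞]` (`∞` if there is no path). -/
def geodDist (s : ℝ) {n : ℕ} (γ₀ γ₁ : ℝ → En n) : ℝ≥0∞ :=
  ⨅ (P : C1Path s n) (_ : P.Γ 0 = γ₀ ∧ P.Γ 1 = γ₁), ENNReal.ofReal (pathLen P)

/-- `U ⊆ 𝓜` is bounded with respect to the geodesic distance `d_G`. -/
def GBounded (s : ℝ) {n : ℕ} (U : Set (ℝ → En n)) : Prop :=
  (∀ γ ∈ U, InM s γ) ∧
    ∃ γ₀, InM s γ₀ ∧ ∃ R : ℝ, ∀ γ ∈ U, geodDist s γ γ₀ ≤ ENNReal.ofReal R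

/-- Weak convergence in the Hilbert space `H^s(𝕋,ℝⁿ)`. -/
def WeakHsTendsto {n : ℕ} (s : ℝ) (γk : ℕ → ℝ → En n) (γ : ℝ → En n) : Prop :=
  ∀ v : ℝ → En n, InHs s v →
    Tendsto (fun k => HsInner s (γk k) v) atTop (𝓝 (HsInner s γ v))

/-- Directional derivative of `γ ↦ G_γ(u,v)` at `γ` in direction `w`. -/
def DGdir {n : ℕ} (s : ℝ) (γ w u v : ℝ → En n) : ℝ :=
  deriv (fun t : ℝ => Gmet s (fun x => γ x + t • w x) u v) 0

/-- `F'` is the derivative of the path `F` with respect to the `H^s` norm, on `S`. -/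
def IsHsDerivOn {n : ℕ} (s : ℝ) (F F' : ℝ → ℝ → En n) (S : Set ℝ) : Prop :=
  ∀ t ∈ S,
    Tendsto (fun h : ℝ => HsNorm s fun x => h⁻¹ • (F (t + h) x - F t x) - F' t x)
      (𝓝[{h : ℝ | t + h ∈ S ∧ h ≠ 0}] 0) (𝓝 0)

/-- The path `F` is continuous on `S` with respect to the `H^s` norm. -/
def HsContOn {n : ℕ} (s : ℝ) (F : ℝ → ℝ → En n) (S : Set ℝ) : Prop :=
  ∀ t ∈ S, Tendsto (fun τ : ℝ => HsNorm s fun x => F τ x - F t x) (𝓝[S] t) (𝓝 0)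

/-- A solution of the geodesic initial value problem on `[0,∞)`, recorded as a triple
(position `Γ`, velocity `V`, acceleration `W`); the geodesic equation
`Γ̈ + A_Γ(Γ̇)Γ̇ = 0` is expressed weakly via the Koszul formula for the
Christoffel operator `A`. -/
def GeodesicSol {n : ℕ} (s : ℝ) (γ₀ v₀ : ℝ → En n) (Γ V W : ℝ → ℝ → En n) : Prop :=
  (∀ t ∈ Set.Ici (0 : ℝ), InM s (Γ t) ∧ InHs s (V t) ∧ InHs s (W t)) ∧
  Γ 0 = γ₀ ∧ V 0 = v₀ ∧
  IsHsDerivOn s Γ V (Set.Ici 0) ∧ IsHsDerivOn s V W (Set.Ici 0) ∧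
  HsContOn s V (Set.Ici 0) ∧ HsContOn s W (Set.Ici 0) ∧
  ∀ t ∈ Set.Ici (0 : ℝ), ∀ w : ℝ → En n, InHs s w →
    Gmet s (Γ t) (W t) w + DGdir s (Γ t) (V t) (V t) w
      - (1 / 2) * DGdir s (Γ t) w (V t) (V t) = 0

section
set_option linter.all false
def IH : Set ℝ := Ico (-(1/2)) (1/2)
abbrev mu0 : Measure (ℝ × ℝ) := (volume.restrict I01).prod (volume.restrict IH)
def muS (s : ℝ) : Measure (ℝ × ℝ) :=
  mu0.withDensity (fun p => ENNReal.ofReal (|p.2| ^ (1 - 2 * s)))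
lemma measI01 : MeasurableSet I01 := measurableSet_Ico
lemma measIH : MeasurableSet IH := measurableSet_Ico
lemma dT_strip (x : ℝ) {h : ℝ} (hh : |h| ≤ 1/2) : dT x (x + h) = |h| := by
  unfold dT
  apply le_antisymm
  · refine (ciInf_le ⟨0, ?_⟩ (0 : ℤ)).trans ?_
    · rintro _ ⟨k, rfl⟩; positivity
    · simp
  · refine le_ciInf fun k => ?_
    have e : x - (x + h) - (k : ℝ) = -(h + k) := by ring
    rw [e, abs_neg]
    rcases eq_or_ne k 0 with rfl | hk
    · simp
    · have h1 : (1 : ℝ) ≤ |(k : ℝ)| := by exact_mod_cast Int.one_le_abs hk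
      have h2 : |(k : ℝ)| ≤ |h + k| + |h| := by
        have := abs_add_le (h + k) (-h); rw [abs_neg] at this; simpa using this
      linarith
lemma dT_add_one (x y : ℝ) : dT x (y + 1) = dT x y := by
  unfold dT
  refine (Equiv.addRight (1 : ℤ)).iInf_congr fun k => ?_
  simp; congr 1; ring
lemma dT_comm (x y : ℝ) : dT x y = dT y x := by
  unfold dT
  refine (Equiv.neg ℤ).iInf_congr fun k => ?_
  simp; rw [abs_sub_comm]; congr 1; ring
lemma ico_ae (a b : ℝ) : (volume.restrict (Ico a b)) = volume.restrict (Ioc a b) :=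
  Measure.restrict_congr_set Ico_ae_eq_Ioc
lemma lper_gen {g : ℝ → ℝ≥0∞} (hg : Function.Periodic g 1) (a b : ℝ) :
    ∫⁻ y in Ico a (a+1), g y = ∫⁻ y in Ico b (b+1), g y := by
  rw [ico_ae, ico_ae]
  refine (isAddFundamentalDomain_Ioc one_pos a).setLIntegral_eq
    (isAddFundamentalDomain_Ioc one_pos b) g ?_
  exact hg.map_vadd_zmultiples
lemma lper {g : ℝ → ℝ≥0∞} (hg : Function.Periodic g 1) (x : ℝ) :
    ∫⁻ y in I01, g y = ∫⁻ h in IH, g (x + h) := by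
  have h1 := lper_gen hg 0 (x - 1/2)
  rw [zero_add] at h1
  rw [I01, h1]
  have h2 := (measurePreserving_add_left (volume : Measure ℝ) x).setLIntegral_comp_emb
    (measurableEmbedding_addLeft x) g IH
  rw [h2, IH]
  congr 3
  simp; congr 1 <;> ring
lemma iper {g : ℝ → ℝ} (hg : Function.Periodic g 1) (x : ℝ) :
    ∫ y in I01, g y = ∫ h in IH, g (x + h) := by
  have h1 := hg.intervalIntegral_add_eq 0 (x - 1/2)
  rw [I01, IH, ico_ae, ico_ae, ← intervalIntegral.integral_of_le (by norm_num),
    ← intervalIntegral.integral_of_le (by norm_num), intervalIntegral.integral_comp_add_left]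
  simp only [zero_add] at h1
  rw [h1]; congr 1 <;> ring
lemma ae_ne_zero_mu0 : ∀ᵐ p ∂mu0, p ∈ I01 ×ˢ IH ∧ p.2 ≠ 0 := by
  have h1 : ∀ᵐ p ∂mu0, p ∈ I01 ×ˢ IH := by
    rw [mu0, Measure.prod_restrict]
    exact ae_restrict_mem (measI01.prod measIH)
  have h2 : ∀ᵐ p ∂mu0, p.2 ≠ 0 := by
    refine Measure.quasiMeasurePreserving_snd.ae (p := fun x : ℝ => x ≠ 0) ?_
    refine ae_restrict_of_ae ?_
    simp [ae_iff]
  filter_upwards [h1, h2] with p a b using ⟨a, b⟩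
lemma meas_dens (s : ℝ) : Measurable fun p : ℝ × ℝ => ENNReal.ofReal (|p.2| ^ (1 - 2 * s)) := by
  fun_prop
lemma lint_muS {s : ℝ} (f : ℝ × ℝ → ℝ≥0∞) (hf : Measurable f) :
    ∫⁻ p, f p ∂(muS s) = ∫⁻ p, ENNReal.ofReal (|p.2| ^ (1 - 2 * s)) * f p ∂mu0 := by
  rw [muS, lintegral_withDensity_eq_lintegral_mul _ (meas_dens s) hf]; rfl
lemma strip_lint0 (F : ℝ → ℝ → ℝ≥0∞) (hm : Measurable (Function.uncurry F))
    (hp : ∀ x, Function.Periodic (F x) 1) :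
    ∫⁻ x in I01, ∫⁻ y in I01, F x y = ∫⁻ p, F p.1 (p.1 + p.2) ∂mu0 := by
  rw [mu0, lintegral_prod]
  · exact lintegral_congr fun x => lper (hp x) x
  · exact (hm.comp (measurable_fst.prodMk (measurable_fst.add measurable_snd))).aemeasurable
lemma strip_lint {s : ℝ} (F : ℝ → ℝ → ℝ) (hm : Measurable (Function.uncurry F))
    (hp : ∀ x, Function.Periodic (F x) 1) (f : ℝ × ℝ → ℝ) (hf : Measurable f)
    (hF : ∀ x, ∀ h ∈ IH, h ≠ 0 → F x (x + h) = |h| ^ (1 - 2 * s) * f (x, h)) :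
    ∫⁻ x in I01, ∫⁻ y in I01, ENNReal.ofReal (F x y) = ∫⁻ p, ENNReal.ofReal (f p) ∂(muS s) := by
  rw [strip_lint0 (fun x y => ENNReal.ofReal (F x y)) (by exact hm.ennreal_ofReal)
    (fun x y => by simp [hp x y]), lint_muS _ hf.ennreal_ofReal]
  refine lintegral_congr_ae ?_
  filter_upwards [ae_ne_zero_mu0] with p hp
  rw [hF _ _ hp.1.2 hp.2, ENNReal.ofReal_mul (by positivity)]
lemma strip_int {s : ℝ} (F : ℝ → ℝ → ℝ) (hp : ∀ x, Function.Periodic (F x) 1)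
    (f : ℝ × ℝ → ℝ) (hf : Integrable f (muS s))
    (hF : ∀ x, ∀ h ∈ IH, h ≠ 0 → F x (x + h) = |h| ^ (1 - 2 * s) * f (x, h)) :
    ∫ x in I01, ∫ y in I01, F x y = ∫ p, f p ∂(muS s) := by
  have e1 : ∀ p : ℝ × ℝ, (ENNReal.ofReal (|p.2| ^ (1 - 2 * s))).toReal = |p.2| ^ (1 - 2 * s) :=
    fun p => ENNReal.toReal_ofReal (by positivity)
  have hi : Integrable (fun p : ℝ × ℝ => |p.2| ^ (1 - 2 * s) * f p) mu0 := by
    have := (integrable_withDensity_iff_integrable_smul' (meas_dens s)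
      (ae_of_all _ fun p => ENNReal.ofReal_lt_top)).1 hf
    simpa only [e1, smul_eq_mul] using this
  rw [muS, integral_withDensity_eq_integral_toReal_smul (meas_dens s)
    (ae_of_all _ fun p => ENNReal.ofReal_lt_top)]
  simp only [e1, smul_eq_mul]
  rw [mu0, integral_prod _ hi]
  refine integral_congr_ae (ae_of_all _ fun x => ?_)
  simp only
  rw [iper (hp x) x]
  refine integral_congr_ae ?_
  have h2 : ∀ᵐ h ∂(volume : Measure ℝ), h ≠ 0 := by simp [ae_iff]
  filter_upwards [ae_restrict_mem measIH, ae_restrict_of_ae h2] with h a b using hF x h a b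
section
variable {s : ℝ} {n : ℕ}
def dif (u : ℝ → En n) (p : ℝ × ℝ) : En n := deriv u (p.1 + p.2) - deriv u p.1
lemma measurable_dT : Measurable (fun p : ℝ × ℝ => dT p.1 p.2) := by
  unfold dT
  refine Measurable.iInf fun k => ?_
  fun_prop
lemma cont_dif {u : ℝ → En n} (hu : ContDiff ℝ 1 u) : Continuous (dif u) := by
  have := hu.continuous_deriv le_rfl
  unfold dif; fun_prop
lemma per_deriv {u : ℝ → En n} (hp : Function.Periodic u 1) : Function.Periodic (deriv u) 1 := by
  intro x
  have : (fun y => u (y + 1)) = u := funext hp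
  rw [← deriv_comp_add_const, this]
lemma gag_eq {u : ℝ → En n} (hp : Function.Periodic u 1) (hu : ContDiff ℝ 1 u) :
    gagliardoSqE (s - 1) (deriv u) = ∫⁻ p, ENNReal.ofReal (‖dif u p‖ ^ 2) ∂(muS s) := by
  have hc := hu.continuous_deriv le_rfl
  unfold gagliardoSqE
  refine strip_lint (fun x y => ‖deriv u y - deriv u x‖ ^ 2 / dT x y ^ (2 * (s - 1) + 1)) ?_ ?_
    (fun p => ‖dif u p‖ ^ 2) ?_ ?_
  · have := measurable_dT
    refine Measurable.div (Continuous.measurable ?_) (this.pow_const _)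
    fun_prop
  · intro x y
    simp only [dT_add_one, per_deriv hp y]
  · exact ((cont_dif hu).norm.pow 2).measurable
  · intro x h hh _
    have h2 : |h| ≤ 1/2 := abs_le.2 ⟨hh.1, hh.2.le⟩
    simp only [dT_strip x h2, dif]
    rw [div_eq_mul_inv, ← Real.rpow_neg (abs_nonneg h), mul_comm]
    congr 2; ring
lemma memLp_iff_lint {f : ℝ × ℝ → En n} (hf : Continuous f) :
    MemLp f 2 (muS s) ↔ ∫⁻ p, ENNReal.ofReal (‖f p‖ ^ 2) ∂(muS s) < ⊤ := by
  rw [memLp_two_iff_integrable_sq_norm hf.aestronglyMeasurable, Integrable]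
  have : AEStronglyMeasurable (fun x => ‖f x‖ ^ 2) (muS s) := by
    exact (hf.norm.pow 2).aestronglyMeasurable
  rw [and_iff_right this, hasFiniteIntegral_iff_ofReal (ae_of_all _ fun p => by positivity)]
lemma inHs_iff {u : ℝ → En n} : InHs s u ↔
    Function.Periodic u 1 ∧ ContDiff ℝ 1 u ∧ MemLp (dif u) 2 (muS s) := by
  constructor
  · rintro ⟨a, b, c⟩
    exact ⟨a, b, (memLp_iff_lint (cont_dif b)).2 (gag_eq a b ▸ c)⟩
  · rintro ⟨a, b, c⟩
    exact ⟨a, b, (gag_eq a b).symm ▸ (memLp_iff_lint (cont_dif b)).1 c⟩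
lemma dif_add {u v : ℝ → En n} (hu : ContDiff ℝ 1 u) (hv : ContDiff ℝ 1 v) :
    dif (u + v) = dif u + dif v := by
  have h1 := hu.differentiable one_ne_zero
  have h2 := hv.differentiable one_ne_zero
  ext1 p
  simp only [dif, Pi.add_apply, deriv_add (h1 _) (h2 _)]; abel
lemma dif_smul (c : ℝ) {u : ℝ → En n} (hu : ContDiff ℝ 1 u) :
    dif (c • u) = c • dif u := by
  have h1 := hu.differentiable one_ne_zero
  ext1 p
  simp only [dif, Pi.smul_apply, deriv_const_smul c (h1 _), smul_sub]
variable (s n) in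
def HsSub : Submodule ℝ (ℝ → En n) where
  carrier := {u | InHs s u}
  add_mem' := by
    intro u v hu hv
    simp only [mem_ofPred_eq, inHs_iff] at *
    refine ⟨hu.1.add hv.1, hu.2.1.add hv.2.1, ?_⟩
    rw [dif_add hu.2.1 hv.2.1]; exact hu.2.2.add hv.2.2
  zero_mem' := by
    simp only [mem_ofPred_eq, inHs_iff]
    refine ⟨fun x => rfl, contDiff_const, ?_⟩
    have : dif (0 : ℝ → En n) = 0 := by ext1 p; simp [dif]
    rw [this]; exact MemLp.zero
  smul_mem' := by
    intro c u hu
    simp only [mem_ofPred_eq, inHs_iff] at *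
    refine ⟨fun x => by simp [hu.1 x], hu.2.1.const_smul c, ?_⟩
    rw [dif_smul c hu.2.1]; exact hu.2.2.const_smul c
variable (s n) in
def Hs : Type := ↥(HsSub s n)
instance : AddCommGroup (Hs s n) := inferInstanceAs (AddCommGroup ↥(HsSub s n))
instance : Module ℝ (Hs s n) := inferInstanceAs (Module ℝ ↥(HsSub s n))
namespace Hs
def fn (f : Hs s n) : ℝ → En n := Subtype.val (p := fun u => u ∈ HsSub s n) f
def dv (f : Hs s n) : ℝ → En n := deriv f.fn
def mk (u : ℝ → En n) (hu : InHs s u) : Hs s n := (⟨u, hu⟩ : ↥(HsSub s n))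
lemma ext' {f g : Hs s n} (h : f.fn = g.fn) : f = g := Subtype.ext h
lemma mem (f : Hs s n) : InHs s f.fn := Subtype.property (p := fun u => u ∈ HsSub s n) f
lemma per (f : Hs s n) : Function.Periodic f.fn 1 := f.mem.1
lemma cd (f : Hs s n) : ContDiff ℝ 1 f.fn := f.mem.2.1
lemma cont (f : Hs s n) : Continuous f.fn := f.cd.continuous
lemma contd (f : Hs s n) : Continuous f.dv := f.cd.continuous_deriv le_rfl
lemma diff (f : Hs s n) : Differentiable ℝ f.fn := f.cd.differentiable one_ne_zero
lemma hasd (f : Hs s n) (x : ℝ) : HasDerivAt f.fn (f.dv x) x := (f.diff x).hasDerivAt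
lemma perd (f : Hs s n) : Function.Periodic f.dv 1 := per_deriv f.per
lemma mLp (f : Hs s n) : MemLp (dif f.fn) 2 (muS s) := (inHs_iff.1 f.mem).2.2
lemma fn_add (f g : Hs s n) : (f + g).fn = f.fn + g.fn := rfl
lemma fn_smul (c : ℝ) (f : Hs s n) : (c • f).fn = c • f.fn := rfl
lemma dv_add (f g : Hs s n) : (f + g).dv = f.dv + g.dv := by
  ext1 x; exact deriv_add (f.diff x) (g.diff x)
lemma dv_smul (c : ℝ) (f : Hs s n) : (c • f).dv = c • f.dv := by
  ext1 x; exact deriv_const_smul c (f.diff x)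
lemma intg {g : ℝ → ℝ} (hg : Continuous g) : Integrable g (volume.restrict I01) :=
  (hg.integrableOn_Icc (a := 0) (b := 1)).mono_set Ico_subset_Icc_self
lemma dif_eq (f : Hs s n) (p : ℝ × ℝ) : dif f.fn p = f.dv (p.1 + p.2) - f.dv p.1 := rfl
def inn (f g : Hs s n) : ℝ := (∫ x in I01, ⟪f.fn x, g.fn x⟫) + (∫ x in I01, ⟪f.dv x, g.dv x⟫) +
    ∫ p, ⟪dif f.fn p, dif g.fn p⟫ ∂(muS s)
lemma intd (f g : Hs s n) : Integrable (fun p => ⟪dif f.fn p, dif g.fn p⟫) (muS s) := by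
  rw [← memLp_one_iff_integrable]
  exact (innerSL ℝ (E := En n)).memLp_of_bilin 1 (p := 2) (q := 2) f.mLp g.mLp
lemma intd2 (f : Hs s n) : Integrable (fun p => ‖dif f.fn p‖ ^ 2) (muS s) := by
  simpa using f.intd f
lemma inn_self (f : Hs s n) : inn f f = HsNormSq s f.fn := by
  unfold inn HsNormSq
  simp only [real_inner_self_eq_norm_sq]
  congr 1
  rw [gag_eq f.per f.cd, ← ofReal_integral_eq_lintegral_ofReal f.intd2
    (ae_of_all _ fun p => by positivity), ENNReal.toReal_ofReal]
  exact integral_nonneg fun p => by positivity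
lemma inn_add (f g k : Hs s n) : inn (f + g) k = inn f k + inn g k := by
  have h1 : dif (f + g).fn = dif f.fn + dif g.fn := dif_add f.cd g.cd
  have c1 := f.cont; have c2 := g.cont; have c3 := k.cont
  have d1 := f.contd; have d2 := g.contd; have d3 := k.contd
  unfold inn
  rw [h1]
  simp only [fn_add, dv_add, Pi.add_apply, inner_add_left]
  rw [integral_add (f.intd k) (g.intd k), integral_add (intg (by fun_prop)) (intg (by fun_prop)),
    integral_add (intg (by fun_prop)) (intg (by fun_prop))]
  ring
lemma inn_smul (c : ℝ) (f k : Hs s n) : inn (c • f) k = c * inn f k := by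
  have h1 : dif (c • f).fn = c • dif f.fn := dif_smul c f.cd
  unfold inn
  rw [h1]
  simp only [fn_smul, dv_smul, Pi.smul_apply, inner_smul_left, integral_const_mul]
  simp; ring
lemma zero_of {g : ℝ → ℝ} (hg : Continuous g) (h0 : ∀ x, 0 ≤ g x) (hp : Function.Periodic g 1)
    (hi : ∫ x in I01, g x = 0) : g = 0 := by
  have h1 : ∫ x in (0:ℝ)..1, g x = 0 := by
    rw [intervalIntegral.integral_of_le zero_le_one, ← ico_ae]; exact hi
  ext x
  by_contra hx
  have h2 : 0 < ∫ y in x..(x+1), g y := by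
    refine intervalIntegral.integral_pos (by linarith) hg.continuousOn (fun y _ => h0 y)
      ⟨x, ⟨le_rfl, by linarith⟩, lt_of_le_of_ne (h0 x) (Ne.symm hx)⟩
  have h3 := hp.intervalIntegral_add_eq x 0
  rw [h3, zero_add, h1] at h2
  exact lt_irrefl _ h2
@[reducible] def core : InnerProductSpace.Core ℝ (Hs s n) where
  inner := inn
  conj_inner_symm f g := by simp only [inn, real_inner_comm]; rfl
  re_inner_nonneg f := by
    change 0 ≤ inn f f
    unfold inn
    have := fun (g : ℝ → En n) => integral_nonneg (μ := volume.restrict I01) (f := fun x => ⟪g x, g x⟫)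
      fun x => real_inner_self_nonneg
    have h3 := integral_nonneg (μ := muS s) (f := fun p => ⟪dif f.fn p, dif f.fn p⟫)
      fun x => real_inner_self_nonneg
    linarith [this f.fn, this f.dv]
  add_left := inn_add
  smul_left f g c := inn_smul c f g
  definite f hf := by
    unfold inn at hf
    have := fun (g : ℝ → En n) => integral_nonneg (μ := volume.restrict I01) (f := fun x => ⟪g x, g x⟫)
      fun x => real_inner_self_nonneg
    have h3 := integral_nonneg (μ := muS s) (f := fun p => ⟪dif f.fn p, dif f.fn p⟫)
      fun x => real_inner_self_nonneg
    have h0 : ∫ x in I01, ⟪f.fn x, f.fn x⟫ = 0 := by linarith [this f.fn, this f.dv]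
    have c := f.cont
    have h4 := zero_of (by fun_prop) (fun x => real_inner_self_nonneg) (fun x => by simp [f.per x]) h0
    refine ext' (funext fun x => ?_)
    exact inner_self_eq_zero.1 (congrFun h4 x)
instance : NormedAddCommGroup (Hs s n) := (core (s := s) (n := n)).toNormedAddCommGroup
instance : InnerProductSpace ℝ (Hs s n) := InnerProductSpace.ofCore (core (s := s) (n := n)).toCore
lemma nsq (f : Hs s n) : ‖f‖ ^ 2 = (∫ x in I01, ‖f.fn x‖ ^ 2) + (∫ x in I01, ‖f.dv x‖ ^ 2) +
    ∫ p, ‖dif f.fn p‖ ^ 2 ∂(muS s) := by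
  rw [← real_inner_self_eq_norm_sq]
  change inn f f = _
  simp only [inn, real_inner_self_eq_norm_sq]
lemma norm_eq (f : Hs s n) : ‖f‖ = HsNorm s f.fn := by
  rw [HsNorm, ← inn_self]
  have : ‖f‖ ^ 2 = inn f f := (real_inner_self_eq_norm_sq f).symm
  rw [← this, Real.sqrt_sq (norm_nonneg _)]
end Hs
end
section morrey
variable {n : ℕ}
def avg (w : ℝ → ℝ) (f : ℝ → En n) (a b : ℝ) : En n := (∫ x in a..b, w x)⁻¹ • ∫ x in a..b, w x • f x
lemma avg_dif {w : ℝ → ℝ} (hw : Continuous w) {f : ℝ → En n} (hf : Continuous f) {a b c d : ℝ}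
    (hab : a ≤ b) (hcd : c ≤ d)
    (hm : 0 < ∫ x in a..b, w x) (hm' : 0 < ∫ x in c..d, w x) (h0 : ∀ x, 0 < w x) :
    (∫ x in a..b, w x) * (∫ x in c..d, w x) * ‖avg w f a b - avg w f c d‖ ^ 2 ≤
      ∫ x in a..b, ∫ y in c..d, w x * w y * ‖f y - f x‖ ^ 2 := by
  set m := ∫ x in a..b, w x
  set m' := ∫ x in c..d, w x
  set S := ∫ x in a..b, w x • f x with hS
  set S' := ∫ x in c..d, w x • f x with hS'
  have i1 : ∀ {g : ℝ → ℝ} (_ : Continuous g) (a b : ℝ), IntervalIntegrable g volume a b :=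
    fun hg a b => hg.intervalIntegrable a b
  have iE : ∀ {g : ℝ → En n} (_ : Continuous g) (a b : ℝ), IntervalIntegrable g volume a b :=
    fun hg a b => hg.intervalIntegrable a b
  obtain ⟨v, hv⟩ : ∃ v, v = avg w f a b - avg w f c d := ⟨_, rfl⟩
  rw [← hv]
  have hin : ∀ x, ∫ y in c..d, w x * w y * (2 * ⟪f x - f y, v⟫ - ‖v‖ ^ 2) =
      w x * (2 * ⟪m' • f x - S', v⟫ - m' * ‖v‖ ^ 2) := by
    intro x
    have e : ∀ y, w x * w y * (2 * ⟪f x - f y, v⟫ - ‖v‖ ^ 2) =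
        w x * (w y * (2 * ⟪f x, v⟫ - ‖v‖^2) - 2 * ⟪v, w y • f y⟫) := by
      intro y; rw [inner_sub_left, inner_smul_right, real_inner_comm (f y) v]; ring
    simp only [e]
    rw [intervalIntegral.integral_const_mul, intervalIntegral.integral_sub (i1 (by fun_prop) _ _)
      (i1 (by fun_prop) _ _), intervalIntegral.integral_mul_const, intervalIntegral.integral_const_mul]
    have : ∫ y in c..d, ⟪v, w y • f y⟫ = ⟪v, S'⟫ :=
      ((innerSL ℝ v).intervalIntegral_comp_comm (iE (by fun_prop) c d))
    rw [this, inner_sub_left, inner_smul_left, real_inner_comm v S',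
      show (∫ x in c..d, w x) = m' from rfl]
    simp only [conj_trivial]; ring
  have hout : ∫ x in a..b, w x * (2 * ⟪m' • f x - S', v⟫ - m' * ‖v‖ ^ 2) = m * m' * ‖v‖ ^ 2 := by
    have e : ∀ x, w x * (2 * ⟪m' • f x - S', v⟫ - m' * ‖v‖ ^ 2) =
        2 * m' * ⟪v, w x • f x⟫ - w x * (2 * ⟪S', v⟫ + m' * ‖v‖ ^ 2) := by
      intro x; rw [inner_sub_left, inner_smul_left, inner_smul_right, real_inner_comm (f x) v]
      simp; ring
    simp only [e]
    rw [intervalIntegral.integral_sub (i1 (by fun_prop) _ _) (i1 (by fun_prop) _ _),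
      intervalIntegral.integral_const_mul, intervalIntegral.integral_mul_const]
    have : ∫ y in a..b, ⟪v, w y • f y⟫ = ⟪v, S⟫ :=
      ((innerSL ℝ v).intervalIntegral_comp_comm (iE (by fun_prop) a b))
    rw [this]
    have e2 : v = m⁻¹ • S - m'⁻¹ • S' := hv
    have e3 : ‖v‖ ^ 2 = m⁻¹ * ⟪v, S⟫ - m'⁻¹ * ⟪S', v⟫ := by
      rw [← real_inner_self_eq_norm_sq]
      nth_rewrite 2 [e2]
      rw [inner_sub_right, inner_smul_right, inner_smul_right, real_inner_comm v S']
    have e4 : m * m' * ‖v‖ ^ 2 = m' * ⟪v, S⟫ - m * ⟪S', v⟫ := by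
      rw [e3]; field_simp
    linarith
  rw [← hout]
  have cpar : ∀ (g : ℝ → ℝ → ℝ), Continuous (Function.uncurry g) →
      Continuous fun x => ∫ y in c..d, g x y := fun g hg =>
    intervalIntegral.continuous_parametric_intervalIntegral_of_continuous' hg _ _
  refine intervalIntegral.integral_mono_on hab (i1 (by fun_prop) _ _) (i1 (cpar _ (by fun_prop)) _ _) ?_
  intro x _
  rw [← hin]
  refine intervalIntegral.integral_mono_on hcd (i1 (by fun_prop) _ _) (i1 (by fun_prop) _ _) ?_
  intro y _
  refine mul_le_mul_of_nonneg_left ?_ (mul_pos (h0 x) (h0 y)).le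
  rw [norm_sub_rev (f y)]
  have := norm_sub_sq_real (f x - f y) v
  nlinarith [sq_nonneg (‖f x - f y - v‖)]
lemma avg_step {w : ℝ → ℝ} (hw : Continuous w) {f : ℝ → En n} (hf : Continuous f) {a b c d : ℝ}
    (hab : a ≤ b) (hcd : c ≤ d) (hac : a ≤ c) (hdb : d ≤ b)
    (hm : 0 < ∫ x in a..b, w x) (hm' : 0 < ∫ x in c..d, w x) (h0 : ∀ x, 0 < w x)
    {H : ℝ → ℝ → ℝ} {K L : ℝ} (hL : 0 ≤ L)
    (hH : ∀ x ∈ Icc a b, ∀ y ∈ Icc a b, w x * w y * ‖f y - f x‖ ^ 2 ≤ L * H x y)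
    (hKi : ∫⁻ x in Ioc a b, ∫⁻ y in Ioc a b, ENNReal.ofReal (H x y) ≤ ENNReal.ofReal K) (hK : 0 ≤ K) :
    (∫ x in a..b, w x) * (∫ x in c..d, w x) * ‖avg w f a b - avg w f c d‖ ^ 2 ≤ L * K := by
  refine (avg_dif hw hf hab hcd hm hm' h0).trans ?_
  have cpar : Continuous fun x => ∫ y in c..d, w x * w y * ‖f y - f x‖ ^ 2 :=
    intervalIntegral.continuous_parametric_intervalIntegral_of_continuous'
      (f := fun x y => w x * w y * ‖f y - f x‖ ^ 2) (by fun_prop) _ _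
  have nn : ∀ x y, 0 ≤ w x * w y * ‖f y - f x‖ ^ 2 := fun x y => by
    have := h0 x; have := h0 y; positivity
  rw [← ENNReal.ofReal_le_ofReal_iff (by positivity), intervalIntegral.integral_of_le hab,
    ofReal_integral_eq_lintegral_ofReal (cpar.integrableOn_Ioc)
      (ae_of_all _ fun x => intervalIntegral.integral_nonneg hcd fun y _ => nn x y),
    ENNReal.ofReal_mul hL]
  refine le_trans ?_ (mul_le_mul_right hKi _)
  rw [← lintegral_const_mul' _ _ ENNReal.ofReal_ne_top]
  refine setLIntegral_mono' measurableSet_Ioc fun x hx => ?_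
  rw [intervalIntegral.integral_of_le hcd, ofReal_integral_eq_lintegral_ofReal
    (Continuous.integrableOn_Ioc (by fun_prop)) (ae_of_all _ fun y => nn x y),
    ← lintegral_const_mul' _ _ ENNReal.ofReal_ne_top]
  refine (lintegral_mono_set (Ioc_subset_Ioc hac hdb)).trans ?_
  refine setLIntegral_mono' measurableSet_Ioc fun y hy => ?_
  rw [← ENNReal.ofReal_mul hL]
  exact ENNReal.ofReal_le_ofReal (hH x ⟨hx.1.le, hx.2⟩ y ⟨hy.1.le, hy.2⟩)
lemma avg_sub_le {w : ℝ → ℝ} (hw : Continuous w) {f : ℝ → En n} (hf : Continuous f) {a b : ℝ}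
    (hab : a ≤ b) (hm : 0 < ∫ x in a..b, w x) (h0 : ∀ x, 0 < w x) {v : En n} {ε : ℝ}
    (hε : ∀ x ∈ Icc a b, ‖f x - v‖ ≤ ε) : ‖avg w f a b - v‖ ≤ ε := by
  set m := ∫ x in a..b, w x with hmd
  have e1 : avg w f a b - v = m⁻¹ • ∫ x in a..b, w x • (f x - v) := by
    simp only [smul_sub]
    rw [intervalIntegral.integral_sub (Continuous.intervalIntegrable (by fun_prop) _ _)
      (Continuous.intervalIntegrable (by fun_prop) _ _), intervalIntegral.integral_smul_const,
      smul_sub, smul_smul, ← hmd, inv_mul_cancel₀ hm.ne', one_smul]; rfl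
  rw [e1, norm_smul, norm_inv, Real.norm_of_nonneg hm.le, inv_mul_le_iff₀ hm]
  refine (intervalIntegral.norm_integral_le_integral_norm hab).trans ?_
  rw [hmd, ← intervalIntegral.integral_mul_const]
  refine intervalIntegral.integral_mono_on hab (Continuous.intervalIntegrable (by fun_prop) _ _)
    (Continuous.intervalIntegrable (by fun_prop) _ _) fun x hx => ?_
  rw [norm_smul, Real.norm_of_nonneg (h0 x).le]
  exact mul_le_mul_of_nonneg_left (hε x hx) (h0 x).le
lemma wint_mono {w : ℝ → ℝ} (hw : Continuous w) (h0 : ∀ x, 0 < w x) {a b c d : ℝ} (hac : a ≤ c)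
    (hcd : c ≤ d) (hdb : d ≤ b) : ∫ x in c..d, w x ≤ ∫ x in a..b, w x :=
  intervalIntegral.integral_mono_interval hac hcd hdb (ae_of_all _ fun x => (h0 x).le)
    (hw.intervalIntegrable _ _)
lemma wint_pos {w : ℝ → ℝ} (hw : Continuous w) (h0 : ∀ x, 0 < w x) {a b : ℝ} (hab : a < b) :
    0 < ∫ x in a..b, w x :=
  intervalIntegral.intervalIntegral_pos_of_pos (hw.intervalIntegrable _ _) h0 hab
lemma morrey_seq {w : ℝ → ℝ} (hw : Continuous w) {f : ℝ → En n} (hf : Continuous f) {a b p c δ : ℝ}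
    (hc : 0 < c) (h0 : ∀ x, c ≤ w x) (hδ : 0 < δ)
    {H : ℝ → ℝ → ℝ} {K : ℝ} (hK : 0 ≤ K)
    (hH : ∀ x ∈ Icc a b, ∀ y ∈ Icc a b,
      w x * w y * ‖f y - f x‖ ^ 2 ≤ |∫ t in x..y, w t| ^ (2 * δ + 2) * H x y)
    (hHn : ∀ x y, 0 ≤ H x y)
    (hKi : ∫⁻ x in Ioc a b, ∫⁻ y in Ioc a b, ENNReal.ofReal (H x y) ≤ ENNReal.ofReal K)
    {A B : ℕ → ℝ} (hA : ∀ N, a ≤ A N) (hB : ∀ N, B N ≤ b) (hA' : ∀ N, A N ≤ A (N+1))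
    (hB' : ∀ N, B (N+1) ≤ B N) (hp : ∀ N, p ∈ Icc (A N) (B N)) {m : ℝ} (hm : 0 < m)
    (hmN : ∀ N, ∫ x in (A N)..(B N), w x = m / 2 ^ N) :
    ‖avg w f (A 0) (B 0) - f p‖ ≤ √2 / (1 - (1/2) ^ δ) * √K * m ^ δ := by
  have h0' : ∀ x, 0 < w x := fun x => hc.trans_le (h0 x)
  have hAB : ∀ N, A N ≤ B N := fun N => (hp N).1.trans (hp N).2
  have hmp : ∀ N, 0 < m / 2 ^ N := fun N => by positivity
  have hq : (1/2 : ℝ) ^ δ < 1 := Real.rpow_lt_one (by norm_num) (by norm_num) hδ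
  have hq0 : 0 < 1 - (1/2 : ℝ) ^ δ := by linarith
  set C := √2 / (1 - (1/2 : ℝ) ^ δ) with hC
  have hC0 : 0 ≤ C := by positivity
  have step : ∀ N, ‖avg w f (A N) (B N) - avg w f (A (N+1)) (B (N+1))‖ ≤
      C * √K * ((m / 2 ^ N) ^ δ - (m / 2 ^ (N+1)) ^ δ) := by
    intro N
    have sub1 : Icc (A N) (B N) ⊆ Icc a b := Icc_subset_Icc (hA N) (hB N)
    have sub2 : Ioc (A N) (B N) ⊆ Ioc a b := Ioc_subset_Ioc (hA N) (hB N)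
    have := avg_step hw hf (hAB N) (hAB (N+1)) (hA' N) (hB' N) (by rw [hmN]; exact hmp N)
      (by rw [hmN]; exact hmp _) h0' (H := H) (K := K) (L := (m / 2 ^ N) ^ (2 * δ + 2))
      (by positivity) ?_ ?_ hK
    · rw [hmN, hmN] at this
      have e1 : m / 2 ^ (N + 1) = (m / 2 ^ N) * (1/2) := by rw [pow_succ]; field_simp
      set r := m / 2 ^ N with hr
      have hr0 : 0 < r := hmp N
      rw [e1] at this ⊢
      rw [Real.mul_rpow hr0.le (by norm_num)]
      have e2 : C * √K * (r ^ δ - r ^ δ * (1/2) ^ δ) = √2 * √K * r ^ δ := by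
        rw [hC]; field_simp
      rw [e2]
      refine abs_le_of_sq_le_sq' ?_ (by positivity) |>.2
      rw [mul_pow, mul_pow, Real.sq_sqrt (by norm_num), Real.sq_sqrt hK]
      have e3 : r ^ (2 * δ + 2) = (r ^ δ) ^ 2 * r ^ 2 := by
        rw [Real.rpow_add hr0, mul_comm 2 δ, Real.rpow_mul hr0.le]; norm_cast
      rw [e3] at this
      have : r ^ 2 * (1/2 * ‖avg w f (A N) (B N) - avg w f (A (N+1)) (B (N+1))‖ ^ 2) ≤
        r ^ 2 * ((r ^ δ) ^ 2 * K) := by linarith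
      have := le_of_mul_le_mul_left this (by positivity)
      linarith
    · intro x hx y hy
      refine (hH x (sub1 hx) y (sub1 hy)).trans (mul_le_mul_of_nonneg_right ?_ (hHn x y))
      refine Real.rpow_le_rpow (abs_nonneg _) ?_ (by linarith)
      rw [← hmN N]
      rcases le_total x y with h | h
      · rw [abs_of_nonneg (intervalIntegral.integral_nonneg h fun t _ => (h0' t).le)]
        exact wint_mono hw h0' hx.1 h hy.2
      · rw [intervalIntegral.integral_symm, abs_neg,
          abs_of_nonneg (intervalIntegral.integral_nonneg h fun t _ => (h0' t).le)]
        exact wint_mono hw h0' hy.1 h hx.2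
    · refine le_trans ?_ hKi
      refine (lintegral_mono_set sub2).trans (lintegral_mono fun x => lintegral_mono_set sub2)
  have tel : ∀ N, ‖avg w f (A 0) (B 0) - avg w f (A N) (B N)‖ ≤
      C * √K * (m ^ δ - (m / 2 ^ N) ^ δ) := by
    intro N
    induction N with
    | zero => simp
    | succ N ih =>
      have := norm_sub_le_norm_sub_add_norm_sub (avg w f (A 0) (B 0)) (avg w f (A N) (B N))
        (avg w f (A (N+1)) (B (N+1)))
      linarith [step N]
  have lim : Tendsto (fun N => avg w f (A N) (B N)) atTop (𝓝 (f p)) := by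
    rw [Metric.tendsto_atTop]
    intro ε hε
    obtain ⟨d, hd, hd'⟩ := Metric.continuous_iff.1 hf p (ε/2) (by positivity)
    have t1 : Tendsto (fun N : ℕ => (m / c) * (1/2 : ℝ) ^ N) atTop (𝓝 ((m/c) * 0)) :=
      (tendsto_pow_atTop_nhds_zero_of_lt_one (by norm_num) (by norm_num)).const_mul _
    rw [mul_zero] at t1
    obtain ⟨N0, hN0⟩ := (eventually_atTop.1 (t1.eventually (gt_mem_nhds hd)))
    refine ⟨N0, fun N hN => ?_⟩
    have hlen : B N - A N ≤ (m / c) * (1/2 : ℝ) ^ N := by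
      have h1 : ∫ x in (A N)..(B N), c ≤ ∫ x in (A N)..(B N), w x :=
        intervalIntegral.integral_mono_on (hAB N) (continuous_const.intervalIntegrable _ _)
          (hw.intervalIntegrable _ _) fun x _ => h0 x
      rw [hmN, intervalIntegral.integral_const, smul_eq_mul] at h1
      rw [one_div, inv_pow, div_mul_eq_mul_div, le_div_iff₀ hc, ← div_eq_mul_inv]; exact h1
    have h2 := hN0 N hN
    refine lt_of_le_of_lt ?_ (half_lt_self hε)
    rw [dist_eq_norm]
    refine avg_sub_le hw hf (hAB N) (by rw [hmN]; exact hmp N) h0' fun x hx => ?_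
    rw [← dist_eq_norm]
    refine (hd' x ?_).le
    rw [Real.dist_eq, abs_lt]
    have := hp N
    constructor <;> linarith [hx.1, hx.2, this.1, this.2]
  have lim2 : Tendsto (fun N => ‖avg w f (A 0) (B 0) - avg w f (A N) (B N)‖) atTop
      (𝓝 ‖avg w f (A 0) (B 0) - f p‖) := (tendsto_const_nhds.sub lim).norm
  refine le_of_tendsto lim2 (Eventually.of_forall fun N => (tel N).trans ?_)
  refine mul_le_mul_of_nonneg_left ?_ (by positivity)
  have : 0 ≤ (m / 2 ^ N) ^ δ := by positivity
  linarith
lemma morrey {w : ℝ → ℝ} (hw : Continuous w) {f : ℝ → En n} (hf : Continuous f) {a b c δ : ℝ}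
    (hc : 0 < c) (h0 : ∀ x, c ≤ w x) (hδ : 0 < δ) (hab : a < b)
    {H : ℝ → ℝ → ℝ} {K : ℝ} (hK : 0 ≤ K)
    (hH : ∀ x ∈ Icc a b, ∀ y ∈ Icc a b,
      w x * w y * ‖f y - f x‖ ^ 2 ≤ |∫ t in x..y, w t| ^ (2 * δ + 2) * H x y)
    (hHn : ∀ x y, 0 ≤ H x y)
    (hKi : ∫⁻ x in Ioc a b, ∫⁻ y in Ioc a b, ENNReal.ofReal (H x y) ≤ ENNReal.ofReal K) :
    ‖avg w f a b - f a‖ ≤ √2 / (1 - (1/2) ^ δ) * √K * (∫ x in a..b, w x) ^ δ ∧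
    ‖avg w f a b - f b‖ ≤ √2 / (1 - (1/2) ^ δ) * √K * (∫ x in a..b, w x) ^ δ := by
  have h0' : ∀ x, 0 < w x := fun x => hc.trans_le (h0 x)
  set m := ∫ x in a..b, w x with hm
  have hm0 : 0 < m := wint_pos hw h0' hab
  have hle : ∀ N : ℕ, m / 2 ^ N ≤ m := fun N => div_le_self hm0.le (one_le_pow₀ (by norm_num))
  have hp0 : ∀ N : ℕ, 0 < m / 2 ^ N := fun N => by positivity
  have hlt : ∀ N : ℕ, m / 2 ^ (N+1) < m / 2 ^ N := fun N => by
    rw [pow_succ, ← div_div]; exact half_lt_self (hp0 N)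
  have c1 : Continuous fun t => ∫ x in a..t, w x :=
    intervalIntegral.continuous_primitive (fun a b => hw.intervalIntegrable a b) a
  have iv : ∀ N : ℕ, ∃ t ∈ Icc a b, ∫ x in a..t, w x = m / 2 ^ N := fun N => by
    have := intermediate_value_Icc hab.le c1.continuousOn
    exact this ⟨by simpa using (hp0 N).le, hle N⟩
  have iv2 : ∀ N : ℕ, ∃ t ∈ Icc a b, ∫ x in t..b, w x = m / 2 ^ N := fun N => by
    have := intermediate_value_Icc hab.le c1.continuousOn
    obtain ⟨t, ht, h2⟩ := this (show m - m / 2 ^ N ∈ _ from ⟨by simpa using hle N, by linarith [hp0 N]⟩)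
    refine ⟨t, ht, ?_⟩
    have := intervalIntegral.integral_add_adjacent_intervals (hw.intervalIntegrable (μ := volume) a t)
      (hw.intervalIntegrable t b)
    simp only at h2
    linarith
  choose B hB hBm using iv
  choose A hA hAm using iv2
  have B0 : B 0 = b := by
    by_contra h
    have h1 := wint_pos hw h0' (lt_of_le_of_ne (hB 0).2 h)
    have := intervalIntegral.integral_add_adjacent_intervals (hw.intervalIntegrable (μ := volume) a (B 0))
      (hw.intervalIntegrable (B 0) b)
    have h3 := hBm 0
    simp only [pow_zero, div_one] at h3; linarith
  have A0 : A 0 = a := by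
    by_contra h
    have h1 := wint_pos hw h0' (lt_of_le_of_ne (hA 0).1 (Ne.symm h))
    have := intervalIntegral.integral_add_adjacent_intervals (hw.intervalIntegrable (μ := volume) a (A 0))
      (hw.intervalIntegrable (A 0) b)
    have h3 := hAm 0
    simp only [pow_zero, div_one] at h3; linarith
  constructor
  · have := morrey_seq hw hf hc h0 hδ hK hH hHn hKi (A := fun _ => a) (B := B) (p := a) (fun _ => le_rfl)
      (fun N => (hB N).2) (fun _ => le_rfl) (fun N => ?_) (fun N => ⟨le_rfl, (hB N).1⟩) hm0 hBm
    · rwa [B0] at this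
    · by_contra h
      have := wint_mono hw h0' le_rfl (hB N).1 (not_le.1 h).le
      rw [hBm, hBm] at this
      linarith [hlt N]
  · have := morrey_seq hw hf hc h0 hδ hK hH hHn hKi (B := fun _ => b) (A := A) (p := b)
      (fun N => (hA N).1) (fun _ => le_rfl) (fun N => ?_)  (fun _ => le_rfl) (fun N => ⟨(hA N).2, le_rfl⟩) hm0 hAm
    · rwa [A0] at this
    · by_contra h
      have := wint_mono hw h0' (not_le.1 h).le (hA N).2 le_rfl
      rw [hAm, hAm] at this
      linarith [hlt N]
end morrey
lemma dbl_le {F : ℝ → ℝ → ℝ≥0∞} (h1 : ∀ x, Function.Periodic (F x) 1)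
    (h2 : ∀ y, Function.Periodic (fun x => F x y) 1) {a b : ℝ} (hab : b ≤ a + 1) :
    ∫⁻ x in Ioc a b, ∫⁻ y in Ioc a b, F x y ≤ ∫⁻ x in I01, ∫⁻ y in I01, F x y := by
  have key : ∀ {g : ℝ → ℝ≥0∞}, Function.Periodic g 1 → ∫⁻ y in Ioc a b, g y ≤ ∫⁻ y in I01, g y := by
    intro g hg
    refine (lintegral_mono_set (Ioc_subset_Ioc_right hab)).trans ?_
    rw [← ico_ae, lper_gen hg a 0, zero_add]; exact le_rfl
  refine (lintegral_mono fun x => key (h1 x)).trans ?_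
  exact key fun x => lintegral_congr fun y => h2 y x
section
variable {s : ℝ} {n : ℕ}
lemma avg_sq_le {w : ℝ → ℝ} (hw : Continuous w) {f : ℝ → En n} (hf : Continuous f) {a b : ℝ}
    (hab : a ≤ b) (hm : 0 < ∫ x in a..b, w x) (h0 : ∀ x, 0 < w x) :
    (∫ x in a..b, w x) * ‖avg w f a b‖ ^ 2 ≤ ∫ x in a..b, w x * ‖f x‖ ^ 2 := by
  set m := ∫ x in a..b, w x with hmd
  obtain ⟨v, hv⟩ : ∃ v, v = avg w f a b := ⟨_, rfl⟩
  rw [← hv]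
  have h1 : m * ‖v‖ ^ 2 = ∫ x in a..b, (2 * ⟪v, w x • f x⟫ - w x * ‖v‖ ^ 2) := by
    rw [intervalIntegral.integral_sub (Continuous.intervalIntegrable (by fun_prop) _ _)
      (Continuous.intervalIntegrable (by fun_prop) _ _), intervalIntegral.integral_const_mul,
      intervalIntegral.integral_mul_const]
    have : ∫ y in a..b, ⟪v, w y • f y⟫ = ⟪v, ∫ y in a..b, w y • f y⟫ :=
      ((innerSL ℝ v).intervalIntegral_comp_comm
        (Continuous.intervalIntegrable (u := fun y => w y • f y) (by fun_prop) a b))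
    rw [this]
    have e : ∫ y in a..b, w y • f y = m • v := by
      rw [hv, avg, smul_smul, mul_inv_cancel₀ hm.ne', one_smul]
    rw [e, inner_smul_right, real_inner_self_eq_norm_sq, ← hmd]; ring
  rw [h1]
  refine intervalIntegral.integral_mono_on hab (Continuous.intervalIntegrable (by fun_prop) _ _)
    (Continuous.intervalIntegrable (by fun_prop) _ _) fun x _ => ?_
  rw [inner_smul_right]
  have := norm_sub_sq_real v (f x)
  have h3 := mul_nonneg (h0 x).le (sq_nonneg ‖v - f x‖)
  rw [this] at h3
  linarith
lemma per_int {g : ℝ → ℝ} (hg : Function.Periodic g 1) (x : ℝ) :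
    ∫ t in x..(x+1), g t = ∫ t in I01, g t := by
  rw [hg.intervalIntegral_add_eq x 0, I01, ico_ae, zero_add, intervalIntegral.integral_of_le zero_le_one]
lemma per_int_le {g : ℝ → ℝ} (hc : Continuous g) (h0 : ∀ x, 0 ≤ g x) (hg : Function.Periodic g 1)
    {a b : ℝ} (hab : a ≤ b) (hb : b ≤ a + 1) :
    ∫ t in a..b, g t ≤ ∫ t in I01, g t := by
  rw [← per_int hg a]
  exact intervalIntegral.integral_mono_interval le_rfl hab hb (ae_of_all _ h0)
    (hc.intervalIntegrable _ _)
namespace Hs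
lemma l2_le (f : Hs s n) : ∫ x in I01, ‖f.fn x‖ ^ 2 ≤ ‖f‖ ^ 2 := by
  rw [nsq]
  have h1 : 0 ≤ ∫ x in I01, ‖f.dv x‖ ^ 2 := integral_nonneg fun _ => by positivity
  have h2 : 0 ≤ ∫ p, ‖dif f.fn p‖ ^ 2 ∂(muS s) := integral_nonneg fun _ => by positivity
  linarith
lemma l2d_le (f : Hs s n) : ∫ x in I01, ‖f.dv x‖ ^ 2 ≤ ‖f‖ ^ 2 := by
  rw [nsq]
  have h1 : 0 ≤ ∫ x in I01, ‖f.fn x‖ ^ 2 := integral_nonneg fun _ => by positivity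
  have h2 : 0 ≤ ∫ p, ‖dif f.fn p‖ ^ 2 ∂(muS s) := integral_nonneg fun _ => by positivity
  linarith
lemma dif_le (f : Hs s n) : ∫ p, ‖dif f.fn p‖ ^ 2 ∂(muS s) ≤ ‖f‖ ^ 2 := by
  rw [nsq]
  have h1 : 0 ≤ ∫ x in I01, ‖f.fn x‖ ^ 2 := integral_nonneg fun _ => by positivity
  have h2 : 0 ≤ ∫ x in I01, ‖f.dv x‖ ^ 2 := integral_nonneg fun _ => by positivity
  linarith
lemma gag_lint (f : Hs s n) : gagliardoSqE (s - 1) f.dv =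
    ENNReal.ofReal (∫ p, ‖dif f.fn p‖ ^ 2 ∂(muS s)) := by
  rw [ofReal_integral_eq_lintegral_ofReal f.intd2 (ae_of_all _ fun _ => by positivity)]
  exact gag_eq f.per f.cd
variable (s) in
def CM : ℝ := √2 / (1 - (1/2) ^ (s - 3/2))
variable (s) in
lemma CM_pos [hs : Fact (s ∈ Ioo (3/2:ℝ) 2)] : 0 < CM s := by
  have : (1/2 : ℝ) ^ (s - 3/2) < 1 := Real.rpow_lt_one (by norm_num) (by norm_num) (by linarith [hs.out.1])
  have : 0 < 1 - (1/2 : ℝ) ^ (s - 3/2) := by linarith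
  unfold CM; positivity
variable [hs : Fact (s ∈ Ioo (3/2:ℝ) 2)]
lemma dv_le (f : Hs s n) (x : ℝ) : ‖f.dv x‖ ≤ (CM s + 2) * ‖f‖ := by
  have h32 := hs.out.1
  have c := f.contd
  have hK : 0 ≤ ∫ p, ‖dif f.fn p‖ ^ 2 ∂(muS s) := integral_nonneg fun _ => by positivity
  have hmm : ∫ t in x..(x+1/2), (1:ℝ) = 1/2 := by simp
  have h1 := morrey (w := fun _ => 1) continuous_const f.contd (c := 1) one_pos
    (fun _ => le_rfl) (δ := s - 3/2) (by linarith) (a := x) (b := x + 1/2) (by linarith)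
    (H := fun x y => ‖f.dv y - f.dv x‖ ^ 2 / dT x y ^ (2 * (s - 1) + 1)) hK ?_ ?_ ?_
  · replace h1 := h1.1
    rw [hmm] at h1
    have h2 := avg_sq_le (w := fun _ => 1) continuous_const f.contd (a := x) (b := x + 1/2)
      (by linarith) (by rw [hmm]; norm_num) (fun _ => one_pos)
    rw [hmm] at h2
    have h3 := per_int_le (g := fun t => 1 * ‖f.dv t‖ ^ 2) (by fun_prop) (fun _ => by positivity)
      (fun t => by simp only [f.perd t]) (a := x) (b := x + 1/2) (by linarith) (by linarith)
    have h4 : ‖avg (fun _ => 1) f.dv x (x + 1/2)‖ ≤ 2 * ‖f‖ := by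
      refine abs_le_of_sq_le_sq' ?_ (by positivity) |>.2
      have := f.l2d_le
      simp only [one_mul] at h2 h3
      nlinarith [sq_nonneg ‖f‖]
    have h5 : √2 / (1 - (1/2) ^ (s - 3/2)) * √(∫ p, ‖dif f.fn p‖ ^ 2 ∂(muS s)) * (1/2) ^ (s - 3/2)
        ≤ CM s * ‖f‖ * 1 := by
      have := CM_pos s
      refine mul_le_mul (mul_le_mul_of_nonneg_left ?_ this.le) ?_ (by positivity) (by positivity)
      · exact Real.sqrt_le_iff.2 ⟨norm_nonneg _, f.dif_le⟩
      · exact Real.rpow_le_one (by norm_num) (by norm_num) (by linarith)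
    have h6 := norm_sub_norm_le (f.dv x) (avg (fun _ => 1) f.dv x (x + 1/2))
    rw [norm_sub_rev] at h6
    linarith
  · intro y hy z hz
    have e : ∫ t in y..z, (1:ℝ) = z - y := by simp
    have e2 : dT y z = |z - y| := by
      have := dT_strip y (h := z - y) (abs_le.2 ⟨by linarith [hy.1, hy.2, hz.1, hz.2], by linarith [hy.1, hy.2, hz.1, hz.2]⟩)
      simpa using this
    rw [e, e2]
    rcases eq_or_ne y z with rfl | hne
    · simp
    · have : 0 < |z - y| := abs_pos.2 (sub_ne_zero.2 hne.symm)
      rw [show 2 * (s - 3/2) + 2 = 2 * (s - 1) + 1 by ring]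
      have : 0 < |z - y| ^ (2 * (s - 1) + 1) := by positivity
      field_simp; exact le_rfl
  · intro y z
    have : 0 ≤ dT y z := Real.iInf_nonneg fun k => abs_nonneg _
    positivity
  · rw [← f.gag_lint]
    refine dbl_le (F := fun x y => ENNReal.ofReal (‖f.dv y - f.dv x‖ ^ 2 / dT x y ^ (2 * (s - 1) + 1)))
      (fun a b => ?_) (fun a b => ?_) (by linarith)
    · simp only [f.perd b, dT_add_one]
    · simp only [f.perd b, dT_comm _ a, dT_add_one]
lemma fn_lip (f : Hs s n) (x y : ℝ) : ‖f.fn y - f.fn x‖ ≤ (CM s + 2) * ‖f‖ * ‖y - x‖ :=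
  Convex.norm_image_sub_le_of_norm_deriv_le (fun x _ => f.diff x) (fun x _ => f.dv_le x) convex_univ
    (mem_univ x) (mem_univ y)
lemma fn_le (f : Hs s n) (x : ℝ) : ‖f.fn x‖ ≤ (CM s + 3) * ‖f‖ := by
  have c := f.cont
  have hmm : ∫ t in x..(x+1), (1:ℝ) = 1 := by simp
  have h2 := avg_sq_le (w := fun _ => 1) continuous_const f.cont (a := x) (b := x + 1)
      (by linarith) (by rw [hmm]; norm_num) (fun _ => one_pos)
  rw [hmm, per_int (g := fun t => 1 * ‖f.fn t‖ ^ 2) (fun t => by simp only [f.per t])] at h2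
  have h4 : ‖avg (fun _ => 1) f.fn x (x + 1)‖ ≤ ‖f‖ := by
    refine abs_le_of_sq_le_sq' ?_ (by positivity) |>.2
    have := f.l2_le
    simp only [one_mul] at h2
    linarith
  have h3 := avg_sub_le (w := fun _ => 1) continuous_const f.cont (a := x) (b := x + 1) (by linarith)
    (by rw [hmm]; norm_num) (fun _ => one_pos) (v := f.fn x) (ε := (CM s + 2) * ‖f‖) (fun y hy => by
      refine (f.fn_lip x y).trans (mul_le_of_le_one_right (by have := CM_pos s; positivity) ?_)
      rw [Real.norm_eq_abs, abs_le]; constructor <;> linarith [hy.1, hy.2])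
  have h6 := norm_sub_norm_le (f.fn x) (avg (fun _ => 1) f.fn x (x + 1))
  rw [norm_sub_rev] at h6
  linarith
end Hs
end
section
variable {s : ℝ} {n : ℕ}
abbrev BX (E : Type*) [NormedAddCommGroup E] := BoundedContinuousFunction (ℝ × ℝ) E
def bcfL (φ : Hs s n → ℝ × ℝ → En n) (hc : ∀ u, Continuous (φ u)) (ha : ∀ u v, φ (u + v) = φ u + φ v)
    (hm : ∀ (c : ℝ) u, φ (c • u) = c • φ u) (C : ℝ) (hC : 0 ≤ C) (hb : ∀ u p, ‖φ u p‖ ≤ C * ‖u‖) :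
    Hs s n →L[ℝ] BX (En n) :=
  LinearMap.mkContinuous
    { toFun := fun u => BoundedContinuousFunction.ofNormedAddCommGroup (φ u) (hc u) (C * ‖u‖) (hb u)
      map_add' := fun u v => by ext1 p; exact congrFun (ha u v) p
      map_smul' := fun c u => by ext1 p; exact congrFun (hm c u) p } C
    (fun u => (BoundedContinuousFunction.norm_le (by positivity)).2 (hb u))
lemma l2_norm_sq {μ : Measure (ℝ × ℝ)} {f : ℝ × ℝ → En n} (hf : MemLp f 2 μ) :
    ‖hf.toLp f‖ ^ 2 = ∫ p, ‖f p‖ ^ 2 ∂μ := by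
  rw [← real_inner_self_eq_norm_sq, MeasureTheory.L2.inner_def]
  refine integral_congr_ae ?_
  filter_upwards [hf.coeFn_toLp] with p hp
  rw [hp, real_inner_self_eq_norm_sq]
def lpL (φ : Hs s n → ℝ × ℝ → En n) (hM : ∀ u, MemLp (φ u) 2 (muS s)) (ha : ∀ u v, φ (u + v) = φ u + φ v)
    (hm : ∀ (c : ℝ) u, φ (c • u) = c • φ u) (hb : ∀ u, ∫ p, ‖φ u p‖ ^ 2 ∂(muS s) ≤ ‖u‖ ^ 2) :
    Hs s n →L[ℝ] Lp (En n) 2 (muS s) :=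
  LinearMap.mkContinuous
    { toFun := fun u => (hM u).toLp (φ u)
      map_add' := fun u v => by
        rw [← MemLp.toLp_add]; exact MemLp.toLp_congr _ _ (by rw [ha])
      map_smul' := fun c u => by
        rw [RingHom.id_apply, ← MemLp.toLp_const_smul]; exact MemLp.toLp_congr _ _ (by rw [hm]) } 1
    (fun u => by
      rw [one_mul]
      refine abs_le_of_sq_le_sq' ?_ (by positivity) |>.2
      exact (l2_norm_sq (hM u)).trans_le (hb u))
lemma lpL_coe (φ : Hs s n → ℝ × ℝ → En n) (hM ha hm hb) (u : Hs s n) :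
    lpL φ hM ha hm hb u =ᵐ[muS s] φ u := (hM u).coeFn_toLp
namespace Hs
def difL : Hs s n →L[ℝ] Lp (En n) 2 (muS s) :=
  lpL (fun u => dif u.fn) (fun u => u.mLp) (fun u v => dif_add u.cd v.cd) (fun c u => dif_smul c u.cd)
    (fun u => u.dif_le)
lemma difL_coe (u : Hs s n) : difL u =ᵐ[muS s] dif u.fn := lpL_coe _ _ _ _ _ u
lemma difL_norm (u : Hs s n) : ‖difL u‖ ^ 2 = ∫ p, ‖dif u.fn p‖ ^ 2 ∂(muS s) := l2_norm_sq u.mLp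
variable [hs : Fact (s ∈ Ioo (3/2:ℝ) 2)]
def e0 : Hs s n →L[ℝ] BX (En n) :=
  bcfL (fun u p => u.dv p.1) (fun u => u.contd.comp continuous_fst) (fun u v => by rw [dv_add]; rfl)
    (fun c u => by rw [dv_smul]; rfl) (CM s + 2) (by have := CM_pos s; positivity) (fun u p => u.dv_le _)
def e1 : Hs s n →L[ℝ] BX (En n) :=
  bcfL (fun u p => u.dv (p.1 + p.2)) (fun u => u.contd.comp (by fun_prop)) (fun u v => by rw [dv_add]; rfl)
    (fun c u => by rw [dv_smul]; rfl) (CM s + 2) (by have := CM_pos s; positivity) (fun u p => u.dv_le _)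
def vl : Hs s n →L[ℝ] BX (En n) :=
  bcfL (fun u p => u.fn p.1) (fun u => u.cont.comp continuous_fst) (fun u v => rfl)
    (fun c u => rfl) (CM s + 3) (by have := CM_pos s; positivity) (fun u p => u.fn_le _)
lemma e0_apply (u : Hs s n) (p : ℝ × ℝ) : e0 u p = u.dv p.1 := rfl
lemma e1_apply (u : Hs s n) (p : ℝ × ℝ) : e1 u p = u.dv (p.1 + p.2) := rfl
lemma vl_apply (u : Hs s n) (p : ℝ × ℝ) : vl u p = u.fn p.1 := rfl
attribute [irreducible] vl e0 e1 difL
lemma n2_le (f : Hs s n) : ‖f‖ ^ 2 ≤ ‖vl f‖ ^ 2 + ‖e0 f‖ ^ 2 + ‖difL f‖ ^ 2 := by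
  have aux : ∀ (q : ℝ → En n) (C : ℝ), Continuous q → (∀ x, ‖q x‖ ≤ C) → ∫ x in I01, ‖q x‖ ^ 2 ≤ C ^ 2 := by
    intro q C hq hC
    have : ∫ x in I01, ‖q x‖ ^ 2 ≤ ∫ x in I01, C ^ 2 :=
      integral_mono (intg (by fun_prop)) (intg (by fun_prop)) fun x => pow_le_pow_left₀ (norm_nonneg _) (hC x) 2
    refine this.trans (le_of_eq ?_)
    simp [I01]
  rw [nsq]
  refine add_le_add (add_le_add (aux _ _ f.cont fun x => ?_) (aux _ _ f.contd fun x => ?_)) ?_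
  · rw [← vl_apply f (x, 0)]; exact (vl f).norm_coe_le_norm (x, 0)
  · have := e0_apply f (x, 0)
    rw [← this]; exact (e0 f).norm_coe_le_norm (x, 0)
  · exact (difL_norm f).ge
instance : CompleteSpace (Hs s n) := by
  refine Metric.complete_of_cauchySeq_tendsto fun u hu => ?_
  obtain ⟨g, hg⟩ := cauchySeq_tendsto_of_complete ((vl (s := s) (n := n)).uniformContinuous.comp_cauchySeq hu)
  obtain ⟨k, hk⟩ := cauchySeq_tendsto_of_complete ((e0 (s := s) (n := n)).uniformContinuous.comp_cauchySeq hu)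
  obtain ⟨l, hl⟩ := cauchySeq_tendsto_of_complete ((difL (s := s) (n := n)).uniformContinuous.comp_cauchySeq hu)
  have hg1 := BoundedContinuousFunction.tendsto_iff_tendstoUniformly.1 hg
  have hk1 := BoundedContinuousFunction.tendsto_iff_tendstoUniformly.1 hk
  have gp : ∀ x, Tendsto (fun m => (u m).fn x) atTop (𝓝 (g (x, 0))) := fun x => by
    simpa only [Function.comp_def, vl_apply] using hg1.tendsto_at (x, 0)
  have kp : ∀ x, Tendsto (fun m => (u m).dv x) atTop (𝓝 (k (x, 0))) := fun x => by
    simpa only [Function.comp_def, e0_apply] using hk1.tendsto_at (x, 0)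
  have hd : ∀ x, HasDerivAt (fun x => g (x, 0)) (k (x, 0)) x := by
    refine hasDerivAt_of_tendstoUniformly (f := fun m => (u m).fn) (f' := fun m => (u m).dv) (l := atTop) ?_
      (Eventually.of_forall fun m x => (u m).hasd x) gp
    have := hk1.comp (fun x : ℝ => (x, (0:ℝ)))
    simpa only [Function.comp_def, e0_apply] using this
  set G : ℝ → En n := fun x => g (x, 0) with hG
  have dG : deriv G = fun x => k (x, 0) := funext fun x => (hd x).deriv
  have hper : Function.Periodic G 1 := fun x =>
    tendsto_nhds_unique (gp (x+1)) (by simpa only [(u _).per x] using gp x)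
  have hcd : ContDiff ℝ 1 G := by
    rw [contDiff_one_iff_deriv]
    exact ⟨fun x => (hd x).differentiableAt, by rw [dG]; fun_prop⟩
  have hae : l =ᵐ[muS s] dif G := by
    have hm : TendstoInMeasure (muS s) (fun m => difL (u m)) atTop l :=
      tendstoInMeasure_of_tendsto_Lp hl
    obtain ⟨ns, hns, hae⟩ := hm.exists_seq_tendsto_ae
    have hall : ∀ᵐ p ∂(muS s), ∀ m, difL (u m) p = dif (u m).fn p :=
      ae_all_iff.2 fun m => difL_coe (u m)
    filter_upwards [hae, hall] with p h1 h2
    simp only [h2] at h1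
    refine tendsto_nhds_unique h1 ?_
    have : Tendsto (fun m => dif (u m).fn p) atTop (𝓝 (dif G p)) := by
      simp only [dif, dG]; exact (kp _).sub (kp _)
    exact this.comp hns.tendsto_atTop
  have hin : InHs s G := inHs_iff.2 ⟨hper, hcd, (memLp_congr_ae hae).1 (Lp.memLp l)⟩
  refine ⟨Hs.mk G hin, ?_⟩
  set v := Hs.mk G hin with hv
  have hl' : l = difL v := Lp.ext (hae.trans (difL_coe v).symm)
  rw [tendsto_iff_norm_sub_tendsto_zero]
  have t1 : Tendsto (fun m => ‖vl (u m - v)‖ ^ 2 + ‖e0 (u m - v)‖ ^ 2 + ‖difL (u m - v)‖ ^ 2) atTop (𝓝 0) := by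
    have a1 : Tendsto (fun m => ‖vl (u m - v)‖) atTop (𝓝 0) := by
      simp only [map_sub]; rw [← tendsto_iff_norm_sub_tendsto_zero]
      have : vl v = g := by
        ext1 p
        have h := hg1.tendsto_at p
        simp only [Function.comp_def, vl_apply] at h
        rw [vl_apply]
        exact tendsto_nhds_unique (gp p.1) h
      rw [this]; exact hg
    have a2 : Tendsto (fun m => ‖e0 (u m - v)‖) atTop (𝓝 0) := by
      simp only [map_sub]; rw [← tendsto_iff_norm_sub_tendsto_zero]
      have : e0 v = k := by
        ext1 p
        have : e0 v p = k (p.1, 0) := (e0_apply v p).trans (congrFun dG p.1)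
        rw [this]
        have h := hk1.tendsto_at p
        simp only [Function.comp_def, e0_apply] at h
        exact tendsto_nhds_unique (kp p.1) h
      rw [this]; exact hk
    have a3 : Tendsto (fun m => ‖difL (u m - v)‖) atTop (𝓝 0) := by
      simp only [map_sub]; rw [← tendsto_iff_norm_sub_tendsto_zero, ← hl']; exact hl
    simpa using ((a1.pow 2).add (a2.pow 2)).add (a3.pow 2)
  have t2 : Tendsto (fun m => ‖u m - v‖ ^ 2) atTop (𝓝 0) :=
    squeeze_zero (fun m => by positivity) (fun m => n2_le _) t1
  have := t2.sqrt
  simpa using this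
end Hs
end
def cl (h : ℝ) : ℝ := max (-(1/2)) (min h (1/2))
lemma cl_cont : Continuous cl := by unfold cl; fun_prop
lemma cl_abs (h : ℝ) : |cl h| ≤ 1/2 := by
  unfold cl; rw [abs_le]; exact ⟨le_max_left _ _, max_le (by norm_num) (min_le_right _ _)⟩
lemma cl_eq {h : ℝ} (hh : |h| ≤ 1/2) : cl h = h := by
  rw [abs_le] at hh
  unfold cl; rw [min_eq_left hh.2, max_eq_right hh.1]
lemma IH_abs {h : ℝ} (hh : h ∈ IH) : |h| ≤ 1/2 := abs_le.2 ⟨hh.1, hh.2.le⟩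
lemma cl_IH {h : ℝ} (hh : h ∈ IH) : cl h = h := cl_eq (IH_abs hh)
lemma scale_lint {s : ℝ} (hs : 1 ≤ s) {q : ℝ → ℝ≥0∞} (hq : Measurable q) {θ : ℝ} (h0 : 0 < θ) (h1 : θ ≤ 1) :
    ∫⁻ h in IH, ENNReal.ofReal (|h| ^ (1 - 2 * s)) * q (θ * h) ≤
      ∫⁻ h in IH, ENNReal.ofReal (|h| ^ (1 - 2 * s)) * q h := by
  set g : ℝ → ℝ≥0∞ := IH.indicator fun h => ENNReal.ofReal (|h| ^ (1 - 2 * s)) * q h with hg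
  have gm : Measurable g := Measurable.indicator (by fun_prop) measIH
  have e1 : ∫⁻ h, g (θ * h) = ENNReal.ofReal θ⁻¹ * ∫⁻ h, g h := by
    have := Real.map_volume_mul_left h0.ne'
    rw [← lintegral_map gm (measurable_const_mul θ), this, lintegral_smul_measure, abs_of_pos (by positivity)]
    rfl
  rw [← lintegral_indicator measIH (fun h => ENNReal.ofReal (|h| ^ (1 - 2 * s)) * q h), ← hg]
  rw [← lintegral_indicator measIH]
  calc _ ≤ ∫⁻ h, ENNReal.ofReal θ * g (θ * h) := by
        refine lintegral_mono fun h => ?_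
        by_cases hh : h ∈ IH
        · have hh2 : θ * h ∈ IH := by
            have := hh.1; have := hh.2
            constructor
            · nlinarith
            · nlinarith
          simp only [hg, indicator_of_mem hh, indicator_of_mem hh2]
          rw [← mul_assoc]
          refine mul_le_mul_left ?_ _
          rw [← ENNReal.ofReal_mul h0.le]
          refine ENNReal.ofReal_le_ofReal ?_
          rw [abs_mul, abs_of_pos h0, Real.mul_rpow h0.le (abs_nonneg h), ← mul_assoc]
          refine le_mul_of_one_le_left (by positivity) ?_
          nth_rewrite 1 [← Real.rpow_one θ]
          rw [← Real.rpow_add h0]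
          exact Real.one_le_rpow_of_pos_of_le_one_of_nonpos h0 h1 (by linarith)
        · simp only [indicator_of_notMem hh]; exact zero_le
    _ = ∫⁻ h, g h := by
        rw [lintegral_const_mul' _ _ ENNReal.ofReal_ne_top, e1, ← mul_assoc, ← ENNReal.ofReal_mul h0.le,
          mul_inv_cancel₀ h0.ne', ENNReal.ofReal_one, one_mul]
    _ ≤ _ := le_rfl
section
variable {s : ℝ} {n : ℕ}
namespace Hs
def dlf (u : Hs s n) (p : ℝ × ℝ) : En n := ∫ θ in (0:ℝ)..1, u.dv (p.1 + θ * cl p.2)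
lemma dlf_cont (u : Hs s n) : Continuous u.dlf := by
  have := u.contd; have := cl_cont
  exact intervalIntegral.continuous_parametric_intervalIntegral_of_continuous'
    (f := fun (p : ℝ × ℝ) θ => u.dv (p.1 + θ * cl p.2)) (by fun_prop) _ _
lemma dlf_add (u v : Hs s n) : (u + v).dlf = u.dlf + v.dlf := by
  have := u.contd; have := v.contd
  ext1 p
  simp only [dlf, dv_add, Pi.add_apply]
  exact intervalIntegral.integral_add (Continuous.intervalIntegrable (by fun_prop) _ _)
    (Continuous.intervalIntegrable (by fun_prop) _ _)
lemma dlf_smul (c : ℝ) (u : Hs s n) : (c • u).dlf = c • u.dlf := by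
  ext1 p
  simp only [dlf, dv_smul, Pi.smul_apply]
  exact intervalIntegral.integral_smul _ _
lemma dlf_mul (u : Hs s n) (x : ℝ) {h : ℝ} (hh : |h| ≤ 1/2) :
    h • u.dlf (x, h) = u.fn (x + h) - u.fn x := by
  have c := u.contd
  simp only [dlf, cl_eq hh]
  rw [← intervalIntegral.integral_smul]
  have := intervalIntegral.integral_eq_sub_of_hasDerivAt (f := fun θ => u.fn (x + θ * h))
    (f' := fun θ => h • u.dv (x + θ * h)) (a := 0) (b := 1) (fun θ _ => ?_)
    (Continuous.intervalIntegrable (by fun_prop) _ _)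
  · simpa using this
  · have h1 : HasDerivAt (fun θ : ℝ => x + θ * h) h θ := by
      simpa using ((hasDerivAt_id θ).mul_const h).const_add x
    exact (u.hasd _).scomp θ h1
lemma dlf_zero (u : Hs s n) (x : ℝ) : u.dlf (x, 0) = u.dv x := by
  simp [dlf, cl_eq (h := 0) (by norm_num)]
def Df (u : Hs s n) (p : ℝ × ℝ) : En n := u.dlf p - u.dv p.1
lemma Df_cont (u : Hs s n) : Continuous u.Df := by
  have := u.dlf_cont; have := u.contd
  unfold Df; fun_prop
lemma Df_sq (u : Hs s n) (p : ℝ × ℝ) : ‖u.Df p‖ ^ 2 ≤ ∫ θ in (0:ℝ)..1, ‖dif u.fn (p.1, θ * cl p.2)‖ ^ 2 := by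
  have c := cont_dif u.cd
  have c' := u.contd
  have := avg_sq_le (w := fun _ => 1) continuous_const (f := fun θ => dif u.fn (p.1, θ * cl p.2))
    (by fun_prop) (a := 0) (b := 1) zero_le_one (by simp) (fun _ => one_pos)
  have e : avg (fun _ => 1) (fun θ => dif u.fn (p.1, θ * cl p.2)) 0 1 = u.Df p := by
    simp only [avg, dif_eq, one_smul, Df, dlf]
    rw [intervalIntegral.integral_sub (Continuous.intervalIntegrable (by fun_prop) _ _)
      (Continuous.intervalIntegrable (by fun_prop) _ _)]
    simp
  rw [e] at this
  simpa using this
variable [hs : Fact (s ∈ Ioo (3/2:ℝ) 2)]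
lemma hardy (u : Hs s n) : ∫⁻ p, ENNReal.ofReal (‖u.Df p‖ ^ 2) ∂(muS s) ≤
    ∫⁻ p, ENNReal.ofReal (‖dif u.fn p‖ ^ 2) ∂(muS s) := by
  have c := cont_dif u.cd
  have c2 := u.Df_cont
  have hs1 := hs.out.1
  rw [lint_muS _ (by fun_prop), lint_muS _ (by fun_prop), mu0, lintegral_prod _ (by fun_prop),
    lintegral_prod _ (by fun_prop)]
  refine lintegral_mono fun x => ?_
  have hq : Measurable fun h => ENNReal.ofReal (‖dif u.fn (x, h)‖ ^ 2) := by fun_prop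
  calc _ ≤ ∫⁻ h in IH, ∫⁻ θ in Ioc (0:ℝ) 1, ENNReal.ofReal (|h| ^ (1 - 2 * s)) *
        ENNReal.ofReal (‖dif u.fn (x, θ * h)‖ ^ 2) := by
        refine setLIntegral_mono' measIH fun h hh => ?_
        simp only
        rw [lintegral_const_mul' _ _ ENNReal.ofReal_ne_top]
        refine mul_le_mul_right ?_ _
        refine (ENNReal.ofReal_le_ofReal (u.Df_sq (x, h))).trans ?_
        simp only [cl_IH hh]
        rw [intervalIntegral.integral_of_le zero_le_one, ofReal_integral_eq_lintegral_ofReal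
          (Continuous.integrableOn_Ioc (by fun_prop)) (ae_of_all _ fun _ => by positivity)]
    _ = ∫⁻ θ in Ioc (0:ℝ) 1, ∫⁻ h in IH, ENNReal.ofReal (|h| ^ (1 - 2 * s)) *
        ENNReal.ofReal (‖dif u.fn (x, θ * h)‖ ^ 2) := lintegral_lintegral_swap (by fun_prop)
    _ ≤ ∫⁻ θ in Ioc (0:ℝ) 1, ∫⁻ h in IH, ENNReal.ofReal (|h| ^ (1 - 2 * s)) *
        ENNReal.ofReal (‖dif u.fn (x, h)‖ ^ 2) := by
        refine setLIntegral_mono' measurableSet_Ioc fun θ hθ => ?_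
        exact scale_lint (by linarith) hq hθ.1 hθ.2
    _ = _ := by simp
lemma Df_memLp (u : Hs s n) : MemLp u.Df 2 (muS s) :=
  (memLp_iff_lint u.Df_cont).2 (u.hardy.trans_lt ((memLp_iff_lint (cont_dif u.cd)).1 u.mLp))
lemma Df_le (u : Hs s n) : ∫ p, ‖u.Df p‖ ^ 2 ∂(muS s) ≤ ‖u‖ ^ 2 := by
  refine le_trans ?_ u.dif_le
  have c1 := u.Df_cont
  have c2 := cont_dif u.cd
  rw [integral_eq_lintegral_of_nonneg_ae (f := fun p => ‖u.Df p‖ ^ 2) (ae_of_all _ fun _ => by positivity)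
    (Continuous.aestronglyMeasurable (by fun_prop)),
    integral_eq_lintegral_of_nonneg_ae (f := fun p => ‖dif u.fn p‖ ^ 2) (ae_of_all _ fun _ => by positivity)
    (Continuous.aestronglyMeasurable (by fun_prop))]
  exact ENNReal.toReal_mono ((memLp_iff_lint (cont_dif u.cd)).1 u.mLp).ne u.hardy
def dl : Hs s n →L[ℝ] BX (En n) :=
  bcfL dlf dlf_cont dlf_add dlf_smul (CM s + 2) (by have := CM_pos s; positivity) (fun u p => by
    have := intervalIntegral.norm_integral_le_of_norm_le_const (a := 0) (b := 1)
      (f := fun θ => u.dv (p.1 + θ * cl p.2)) (fun θ _ => u.dv_le _)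
    change ‖∫ θ in (0:ℝ)..1, u.dv (p.1 + θ * cl p.2)‖ ≤ _
    simpa using this)
lemma dl_apply (u : Hs s n) (p : ℝ × ℝ) : dl u p = u.dlf p := rfl
def Dl : Hs s n →L[ℝ] Lp (En n) 2 (muS s) :=
  lpL Df Df_memLp (fun u v => by ext1 p; simp only [Df, dlf_add, dv_add, Pi.add_apply]; abel)
    (fun c u => by ext1 p; simp only [Df, dlf_smul, dv_smul, Pi.smul_apply, smul_sub]) Df_le
lemma Dl_coe (u : Hs s n) : Dl u =ᵐ[muS s] u.Df := lpL_coe _ _ _ _ _ u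
attribute [irreducible] dl Dl
end Hs
end
section
variable {E F G : Type*} [NormedAddCommGroup E] [NormedSpace ℝ E] [NormedAddCommGroup F] [NormedSpace ℝ F]
  [NormedAddCommGroup G] [NormedSpace ℝ G]
def bl (L : E →L[ℝ] F →L[ℝ] G) : BX E →L[ℝ] BX F →L[ℝ] BX G :=
  LinearMap.mkContinuous₂
    (LinearMap.mk₂ ℝ (fun f g => BoundedContinuousFunction.ofNormedAddCommGroup (fun p => L (f p) (g p))
        (by have := f.continuous; have := g.continuous; fun_prop) (‖L‖ * ‖f‖ * ‖g‖) (fun p =>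
          (L.le_opNorm₂ _ _).trans (by gcongr <;> exact BoundedContinuousFunction.norm_coe_le_norm _ _)))
      (fun f f' g => by ext1 p; simp) (fun c f g => by ext1 p; simp) (fun f g g' => by ext1 p; simp)
      (fun c f g => by ext1 p; simp)) ‖L‖
    (fun f g => (BoundedContinuousFunction.norm_le (by positivity)).2 fun p =>
          (L.le_opNorm₂ _ _).trans (by gcongr <;> exact BoundedContinuousFunction.norm_coe_le_norm _ _))
lemma bl_apply (L : E →L[ℝ] F →L[ℝ] G) (f : BX E) (g : BX F) (p : ℝ × ℝ) : bl L f g p = L (f p) (g p) := rfl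
attribute [irreducible] bl
variable (μ : Measure (ℝ × ℝ))
def toTop [SecondCountableTopologyEither (ℝ × ℝ) E] : BX E →L[ℝ] Lp E ∞ μ :=
  LinearMap.mkContinuous
    { toFun := fun f => (memLp_top_of_bound f.continuous.aestronglyMeasurable ‖f‖
        (ae_of_all _ f.norm_coe_le_norm)).toLp f
      map_add' := fun f g => by rw [← MemLp.toLp_add]; rfl
      map_smul' := fun c f => by rw [RingHom.id_apply, ← MemLp.toLp_const_smul]; rfl } 1
    (fun f => by
      rw [one_mul]
      refine (Lp.norm_toLp (f : ℝ × ℝ → E) (memLp_top_of_bound f.continuous.aestronglyMeasurable ‖f‖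
        (ae_of_all _ f.norm_coe_le_norm))).trans_le ?_
      refine ENNReal.toReal_le_of_le_ofReal (norm_nonneg _) ?_
      refine (eLpNorm_le_of_ae_bound (ae_of_all _ f.norm_coe_le_norm)).trans ?_
      simp)
lemma toTop_coe [SecondCountableTopologyEither (ℝ × ℝ) E] (f : BX E) : toTop μ f =ᵐ[μ] f :=
  MemLp.coeFn_toLp (memLp_top_of_bound f.continuous.aestronglyMeasurable ‖f‖
        (ae_of_all _ f.norm_coe_le_norm))
attribute [irreducible] toTop
def act [SecondCountableTopologyEither (ℝ × ℝ) E] (L : E →L[ℝ] F →L[ℝ] G) : BX E →L[ℝ] Lp F 2 μ →L[ℝ] Lp G 2 μ :=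
  (L.holderL μ ∞ 2 2).comp (toTop μ)
lemma act_coe [SecondCountableTopologyEither (ℝ × ℝ) E] (L : E →L[ℝ] F →L[ℝ] G) (f : BX E) (g : Lp F 2 μ) :
    act μ L f g =ᵐ[μ] fun p => L (f p) (g p) := by
  have h := L.coeFn_holder (r := 2) (toTop μ f) g
  filter_upwards [h, toTop_coe μ f] with p h1 h2
  rw [← h2]; exact h1
attribute [irreducible] act
end
section
def PosB (f : BX ℝ) : Prop := ∃ c > 0, ∀ p, c ≤ f p
lemma PosB.open : IsOpen {f : BX ℝ | PosB f} := by
  rw [Metric.isOpen_iff]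
  rintro f ⟨c, hc, hf⟩
  refine ⟨c/2, by positivity, fun g hg => ⟨c/2, by positivity, fun p => ?_⟩⟩
  have h1 := (BoundedContinuousFunction.dist_coe_le_dist (f := g) (g := f) p).trans_lt (Metric.mem_ball.1 hg)
  rw [Real.dist_eq, abs_lt] at h1
  linarith [hf p]
lemma expB (f : BX ℝ) (p : ℝ × ℝ) : (NormedSpace.exp f : BX ℝ) p = Real.exp (f p) := by
  let ev : BX ℝ →+* ℝ :=
    { toFun := fun f => f p, map_one' := rfl, map_mul' := fun _ _ => rfl, map_zero' := rfl, map_add' := fun _ _ => rfl }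
  have := NormedSpace.map_exp ev (BoundedContinuousFunction.evalCLM ℝ p).continuous f
  rw [Real.exp_eq_exp_ℝ]
  exact this
open Classical in
def lgB (f : BX ℝ) : BX ℝ :=
  if h : PosB f then BoundedContinuousFunction.ofNormedAddCommGroup (fun p => Real.log (f p))
    (by
      obtain ⟨c, hc, hf⟩ := h
      exact f.continuous.log fun p => (hc.trans_le (hf p)).ne') (max |Real.log h.choose| |Real.log ‖f‖|)
    (by
      intro p
      obtain ⟨hc, hf⟩ := h.choose_spec
      have h1 := Real.log_le_log hc (hf p)
      have h2 := Real.log_le_log (hc.trans_le (hf p)) ((le_abs_self _).trans (f.norm_coe_le_norm p))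
      rw [Real.norm_eq_abs]
      exact abs_le_max_abs_abs h1 h2) else 0
lemma lgB_apply {f : BX ℝ} (h : PosB f) (p : ℝ × ℝ) : lgB f p = Real.log (f p) := by
  rw [lgB, dif_pos h]; rfl
lemma exp_lgB {f : BX ℝ} (h : PosB f) : NormedSpace.exp (lgB f) = f := by
  ext1 p
  obtain ⟨c, hc, hf⟩ := id h
  rw [expB, lgB_apply h, Real.exp_log (hc.trans_le (hf p))]
lemma cd_exp (m : WithTop ℕ∞) : ContDiff ℝ m (NormedSpace.exp : BX ℝ → BX ℝ) :=
  contDiff_iff_contDiffAt.2 fun x => (NormedSpace.exp_analytic (𝕂 := ℝ) x).contDiffAt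
lemma cd_lgB (m : ℕ) {f : BX ℝ} (h : PosB f) : ContDiffAt ℝ (m + 1 : ℕ) lgB f := by
  set g := lgB f with hg
  have hex : NormedSpace.exp g = f := exp_lgB h
  let e : BX ℝ ≃L[ℝ] BX ℝ := ContinuousLinearEquiv.equivOfInverse
    (ContinuousLinearMap.mul ℝ (BX ℝ) (NormedSpace.exp g)) (ContinuousLinearMap.mul ℝ (BX ℝ) (NormedSpace.exp (-g)))
    (fun x => by ext1 p; simp [expB, ← mul_assoc, ← Real.exp_add])
    (fun x => by ext1 p; simp [expB, ← mul_assoc, ← Real.exp_add])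
  have hd : HasFDerivAt NormedSpace.exp (e : BX ℝ →L[ℝ] BX ℝ) g := by
    have := (hasStrictFDerivAt_exp (𝕂 := ℝ) (x := g)).hasFDerivAt
    have e2 : (e : BX ℝ →L[ℝ] BX ℝ) = NormedSpace.exp g • (1 : BX ℝ →L[ℝ] BX ℝ) := by
      ext x p; simp [e]
    rw [e2]; exact this
  have hc := (cd_exp (m + 1 : ℕ)).contDiffAt (x := g)
  have hne : ((m + 1 : ℕ) : WithTop ℕ∞) ≠ 0 := by exact_mod_cast Nat.succ_ne_zero m
  have h1 := hc.to_localInverse hd hne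
  rw [hex] at h1
  refine h1.congr_of_eventuallyEq ?_
  have h2 := (hc.hasStrictFDerivAt' hd hne).eventually_right_inverse
  rw [hex] at h2
  filter_upwards [h2, PosB.open.mem_nhds h] with k h3 h4
  ext1 p
  rw [lgB_apply h4, ← Real.log_exp (ContDiffAt.localInverse hc hd hne k p), ← expB]
  congr 2
  exact h3.symm
def rp (r : ℝ) (f : BX ℝ) : BX ℝ := NormedSpace.exp (r • lgB f)
lemma rp_apply (r : ℝ) {f : BX ℝ} (h : PosB f) (p : ℝ × ℝ) : rp r f p = f p ^ r := by
  obtain ⟨c, hc, hf⟩ := id h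
  rw [rp, expB, Real.rpow_def_of_pos (hc.trans_le (hf p)), ← lgB_apply h]
  simp [mul_comm]
lemma cd_rp (r : ℝ) (m : ℕ) {f : BX ℝ} (h : PosB f) : ContDiffAt ℝ (m + 1 : ℕ) (rp r) f :=
  (cd_exp _).contDiffAt.comp f ((cd_lgB m h).const_smul r)
end
section
variable {X E F G : Type*} [NormedAddCommGroup E] [NormedSpace ℝ E] [NormedAddCommGroup F] [NormedSpace ℝ F]
  [NormedAddCommGroup G] [NormedSpace ℝ G] [NormedAddCommGroup X] [NormedSpace ℝ X]
lemma cda_bil (L : E →L[ℝ] F →L[ℝ] G) {m : WithTop ℕ∞} {f : X → E} {g : X → F} {x : X} (hf : ContDiffAt ℝ m f x)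
    (hg : ContDiffAt ℝ m g x) : ContDiffAt ℝ m (fun x => L (f x) (g x)) x :=
  (L.contDiff.contDiffAt.comp x hf).clm_apply hg
lemma cd_bil (L : E →L[ℝ] F →L[ℝ] G) {m : WithTop ℕ∞} {f : X → E} {g : X → F} (hf : ContDiff ℝ m f)
    (hg : ContDiff ℝ m g) : ContDiff ℝ m (fun x => L (f x) (g x)) :=
  contDiff_iff_contDiffAt.2 fun x => cda_bil L hf.contDiffAt hg.contDiffAt
end
section
variable {s : ℝ} {n : ℕ}
abbrev ip : BX (En n) →L[ℝ] BX (En n) →L[ℝ] BX ℝ := bl (innerSL ℝ)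
lemma ip_apply (f g : BX (En n)) (p : ℝ × ℝ) : ip f g p = ⟪f p, g p⟫ := bl_apply _ _ _ _
lemma ip_self (f : BX (En n)) (p : ℝ × ℝ) : ip f f p = ‖f p‖ ^ 2 := by
  rw [ip_apply, real_inner_self_eq_norm_sq]
def I0 : BX ℝ →L[ℝ] ℝ :=
  LinearMap.mkContinuous
    { toFun := fun f => ∫ x in I01, f (x, 0)
      map_add' := fun f g => integral_add (Hs.intg (f.continuous.comp (by fun_prop))) (Hs.intg (g.continuous.comp (by fun_prop)))
      map_smul' := fun c f => integral_const_mul c _ } 1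
    (fun f => by
      have := norm_setIntegral_le_of_norm_le_const (μ := volume) (s := I01) (f := fun x => f (x, 0)) (C := ‖f‖)
        (by simp [I01]) (fun x _ => f.norm_coe_le_norm _)
      simpa [I01] using this)
lemma I0_apply (f : BX ℝ) : I0 f = ∫ x in I01, f (x, 0) := rfl
attribute [irreducible] I0
abbrev sc : BX ℝ →L[ℝ] Lp (En n) 2 (muS s) →L[ℝ] Lp (En n) 2 (muS s) := act (muS s) (ContinuousLinearMap.lsmul ℝ ℝ)
lemma sc_coe (f : BX ℝ) (g : Lp (En n) 2 (muS s)) : sc f g =ᵐ[muS s] fun p => f p • g p := act_coe _ _ _ _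
namespace Hs
variable [hs : Fact (s ∈ Ioo (3/2:ℝ) 2)]
def qd (γ : Hs s n) : BX ℝ := ip (dl γ) (dl γ)
def q0 (γ : Hs s n) : BX ℝ := ip (e0 γ) (e0 γ)
def q1 (γ : Hs s n) : BX ℝ := ip (e1 γ) (e1 γ)
lemma qd_apply (γ : Hs s n) (p : ℝ × ℝ) : qd γ p = ‖γ.dlf p‖ ^ 2 := by rw [qd, ip_self, dl_apply]
lemma q0_apply (γ : Hs s n) (p : ℝ × ℝ) : q0 γ p = ‖γ.dv p.1‖ ^ 2 := by rw [q0, ip_self, e0_apply]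
lemma q1_apply (γ : Hs s n) (p : ℝ × ℝ) : q1 γ p = ‖γ.dv (p.1 + p.2)‖ ^ 2 := by rw [q1, ip_self, e1_apply]
def IM (γ : Hs s n) : Prop := PosB (qd γ)
lemma cd_qd (m : WithTop ℕ∞) : ContDiff ℝ m (qd : Hs s n → BX ℝ) := cd_bil ip dl.contDiff dl.contDiff
lemma IM_open : IsOpen {γ : Hs s n | IM γ} := PosB.open.preimage (cd_qd 0).continuous
lemma IM.pd {γ : Hs s n} (h : IM γ) : PosB (qd γ) := h
lemma IM.p0 {γ : Hs s n} (h : IM γ) : PosB (q0 γ) := by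
  obtain ⟨c, hc, h⟩ := h
  refine ⟨c, hc, fun p => ?_⟩
  have := h (p.1, 0)
  rwa [qd_apply, dlf_zero, ← q0_apply γ p] at this
lemma IM.p1 {γ : Hs s n} (h : IM γ) : PosB (q1 γ) := by
  obtain ⟨c, hc, h⟩ := h
  refine ⟨c, hc, fun p => ?_⟩
  have := h (p.1 + p.2, 0)
  rwa [qd_apply, dlf_zero, ← q1_apply γ p] at this
lemma IM.dv0 {γ : Hs s n} (h : IM γ) (x : ℝ) : 0 < ‖γ.dv x‖ := by
  obtain ⟨c, hc, h⟩ := h.p0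
  have := h (x, 0)
  rw [q0_apply] at this
  by_contra hx
  have h0 : ‖γ.dv x‖ = 0 := le_antisymm (not_lt.1 hx) (norm_nonneg _)
  simp only [h0] at this
  norm_num at this; linarith
lemma IM.dl0 {γ : Hs s n} (h : IM γ) (p : ℝ × ℝ) : 0 < ‖γ.dlf p‖ := by
  obtain ⟨c, hc, h⟩ := h
  have := h p
  rw [qd_apply] at this
  by_contra hx
  have h0 : ‖γ.dlf p‖ = 0 := le_antisymm (not_lt.1 hx) (norm_nonneg _)
  simp only [h0] at this
  norm_num at this; linarith
def kk (γ : Hs s n) : BX ℝ := rp (-s - 1/2) (qd γ) * (rp (1/2) (q0 γ) * rp (1/2) (q1 γ))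
def aa (γ : Hs s n) : BX (En n) := bl (ContinuousLinearMap.lsmul ℝ ℝ) (rp (-1) (q0 γ)) (e0 γ)
def zz (γ : Hs s n) : Lp ℝ 2 (muS s) := act (muS s) (innerSL ℝ) (aa γ) (Dl γ)
def NN (γ u : Hs s n) : Lp (En n) 2 (muS s) :=
  Dl u - act (muS s) (ContinuousLinearMap.lsmul ℝ ℝ).flip (e0 u) (zz γ)
def WW (γ u v : Hs s n) : BX ℝ := kk γ * ((2 * s + 1) • (rp (-1) (qd γ) * ip (dl u) (dl v)) +
  (rp (-1) (q0 γ) * ip (e0 u) (e0 v) + rp (-1) (q1 γ) * ip (e1 u) (e1 v)))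
def FF (γ u v : Hs s n) : ℝ := 2 * ⟪sc (kk γ) (NN γ u), NN γ v⟫ + ⟪sc (WW γ u v) (NN γ γ), NN γ γ⟫
  + I0 (rp (-(1/2)) (q0 γ) * ip (e0 u) (e0 v)) + I0 (ip (vl u) (vl v) * rp (1/2) (q0 γ))
def nn (γ u : Hs s n) (p : ℝ × ℝ) : En n := u.Df p - ((‖γ.dv p.1‖ ^ 2)⁻¹ * ⟪γ.dv p.1, γ.Df p⟫) • u.dv p.1
lemma aa_apply {γ : Hs s n} (h : IM γ) (p : ℝ × ℝ) : aa γ p = (‖γ.dv p.1‖ ^ 2)⁻¹ • γ.dv p.1 := by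
  rw [aa, bl_apply, rp_apply _ h.p0, q0_apply, e0_apply, Real.rpow_neg_one]; rfl
lemma NN_coe {γ : Hs s n} (h : IM γ) (u : Hs s n) : NN γ u =ᵐ[muS s] nn γ u := by
  have h1 := act_coe (muS s) (innerSL ℝ) (aa γ) (Dl γ)
  have h2 := act_coe (muS s) (ContinuousLinearMap.lsmul ℝ ℝ).flip (e0 u) (zz γ)
  filter_upwards [Dl_coe u, Dl_coe γ, h1, h2, Lp.coeFn_sub (Dl u) (act (muS s) (ContinuousLinearMap.lsmul ℝ ℝ).flip (e0 u) (zz γ))] with p g1 g2 g3 g4 g5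
  rw [NN, g5, Pi.sub_apply, g1, g4]
  unfold zz
  rw [g3, g2, aa_apply h, e0_apply]
  simp only [nn, ContinuousLinearMap.flip_apply, ContinuousLinearMap.lsmul_apply]
  congr 2
  exact real_inner_smul_left (γ.dv p.1) (γ.Df p) _
lemma kk_apply {γ : Hs s n} (h : IM γ) (p : ℝ × ℝ) :
    kk γ p = ‖γ.dlf p‖ ^ (-2 * s - 1) * (‖γ.dv p.1‖ * ‖γ.dv (p.1 + p.2)‖) := by
  have e : ∀ t : ℝ, 0 ≤ t → (t ^ 2) ^ (1/2:ℝ) = t := fun t ht => by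
    rw [← Real.sqrt_eq_rpow, Real.sqrt_sq ht]
  rw [kk, BoundedContinuousFunction.mul_apply, BoundedContinuousFunction.mul_apply, rp_apply _ h, rp_apply _ h.p0,
    rp_apply _ h.p1, qd_apply, q0_apply, q1_apply, e _ (norm_nonneg _), e _ (norm_nonneg _), ← Real.rpow_natCast,
    ← Real.rpow_mul (norm_nonneg _)]
  congr 2
  push_cast; ring
lemma kk_pos {γ : Hs s n} (h : IM γ) (p : ℝ × ℝ) : 0 < kk γ p := by
  rw [kk_apply h]
  have := h.dv0 p.1; have := h.dv0 (p.1 + p.2); have := h.dl0 p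
  positivity
lemma NN_int {γ : Hs s n} (h : IM γ) (f : BX ℝ) (u v : Hs s n) :
    Integrable (fun p => f p * ⟪nn γ u p, nn γ v p⟫) (muS s) ∧
    ⟪sc f (NN γ u), NN γ v⟫ = ∫ p, f p * ⟪nn γ u p, nn γ v p⟫ ∂(muS s) := by
  have e : (fun p => ⟪sc f (NN γ u) p, NN γ v p⟫) =ᵐ[muS s] fun p => f p * ⟪nn γ u p, nn γ v p⟫ := by
    filter_upwards [sc_coe f (NN γ u), NN_coe h u, NN_coe h v] with p h1 h2 h3
    rw [h1, h2, h3, inner_smul_left]; rfl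
  exact ⟨(L2.integrable_inner (𝕜 := ℝ) (sc f (NN γ u)) (NN γ v)).congr e,
    (L2.inner_def _ _).trans (integral_congr_ae e)⟩
lemma num_eq (γ u : Hs s n) (hγ : IM γ) (x : ℝ) {h : ℝ} (hh : h ∈ IH) :
    u.fn (x + h) - u.fn x - DDg γ.fn u.fn x (γ.fn (x + h) - γ.fn x) = h • nn γ u (x, h) := by
  rw [← dlf_mul u x (IH_abs hh), ← dlf_mul γ x (IH_abs hh)]
  have h0 := hγ.dv0 x
  have e1 : (‖γ.dv x‖ ^ 2)⁻¹ * ⟪γ.dv x, γ.Df (x, h)⟫ = (‖γ.dv x‖ ^ 2)⁻¹ * ⟪γ.dv x, γ.dlf (x, h)⟫ - 1 := by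
    rw [Df, inner_sub_right, real_inner_self_eq_norm_sq]; field_simp
  rw [nn, e1]
  simp only [DDg, inner_smul_right, Df]
  change h • u.dlf (x, h) - ((‖γ.dv x‖ ^ 2)⁻¹ * (h * ⟪γ.dv x, γ.dlf (x,h)⟫)) • u.dv x = _
  module
lemma fn_dist (γ : Hs s n) (x : ℝ) {h : ℝ} (hh : h ∈ IH) :
    ‖γ.fn (x + h) - γ.fn x‖ = |h| * ‖γ.dlf (x, h)‖ := by
  rw [← dlf_mul γ x (IH_abs hh), norm_smul, Real.norm_eq_abs]
lemma wt {d a h : ℝ} (hd : 0 < d) (hh : h ≠ 0) :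
    (((|h| * d) ^ s)⁻¹ * h) ^ 2 * (a / (|h| * d)) = |h| ^ (1 - 2 * s) * (d ^ (-2 * s - 1) * a) := by
  have h0 : 0 < |h| := abs_pos.2 hh
  have e1 : ∀ t : ℝ, 0 < t → t ^ (1 - 2 * s) = ((t ^ s)⁻¹) ^ 2 * t := fun t ht => by
    rw [← Real.rpow_neg ht.le, ← Real.rpow_natCast, ← Real.rpow_mul ht.le]
    nth_rewrite 3 [← Real.rpow_one t]
    rw [← Real.rpow_add ht]; congr 1; push_cast; ring
  have e2 : ∀ t : ℝ, 0 < t → t ^ (-2 * s - 1) = ((t ^ s)⁻¹) ^ 2 * t⁻¹ := fun t ht => by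
    rw [← Real.rpow_neg ht.le, ← Real.rpow_natCast, ← Real.rpow_mul ht.le, ← Real.rpow_neg_one t,
      ← Real.rpow_add ht]; congr 1; push_cast; ring
  rw [Real.mul_rpow h0.le hd.le, e1 _ h0, e2 _ hd, mul_pow, ← sq_abs h]
  have := Real.rpow_pos_of_pos h0 s; have := Real.rpow_pos_of_pos hd s
  field_simp
lemma Rop_strip (γ : Hs s n) (hγ : IM γ) (u v : Hs s n) (x : ℝ) {h : ℝ} (hh : h ∈ IH) (h0 : h ≠ 0) :
    ⟪Rop s γ.fn u.fn x (x + h), Rop s γ.fn v.fn x (x + h)⟫ * muW γ.fn x (x + h) =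
      |h| ^ (1 - 2 * s) * (kk γ (x, h) * ⟪nn γ u (x, h), nn γ v (x, h)⟫) := by
  have := wt (s := s) (a := ‖γ.dv x‖ * ‖γ.dv (x + h)‖) (hγ.dl0 (x, h)) h0
  rw [kk_apply hγ, ← mul_assoc, ← this, Rop, Rop, num_eq γ u hγ x hh, num_eq γ v hγ x hh, muW, fn_dist γ x hh]
  simp only [inner_smul_left, inner_smul_right]
  change _ * (‖γ.dv x‖ * ‖γ.dv (x + h)‖ / (|h| * ‖γ.dlf (x, h)‖)) = _
  simp only [RCLike.conj_to_real]; ring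
lemma Rop_strip2 (γ : Hs s n) (hγ : IM γ) (u : Hs s n) (x : ℝ) {h : ℝ} (hh : h ∈ IH) (h0 : h ≠ 0) :
    ‖Rop s γ.fn u.fn x (x + h)‖ ^ 2 * muW γ.fn x (x + h) =
      |h| ^ (1 - 2 * s) * (kk γ (x, h) * ‖nn γ u (x, h)‖ ^ 2) := by
  have := Rop_strip γ hγ u u x hh h0
  simpa only [real_inner_self_eq_norm_sq] using this
lemma fper (u : Hs s n) (y : ℝ) : u.fn (y + 1) = u.fn y := u.per y
lemma dper (u : Hs s n) (y : ℝ) : deriv u.fn (y + 1) = deriv u.fn y := u.perd y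
lemma B1_eq (γ : Hs s n) (hγ : IM γ) (u v : Hs s n) :
    B1 s γ.fn u.fn v.fn = ⟪sc (kk γ) (NN γ u), NN γ v⟫ := by
  obtain ⟨hi, he⟩ := NN_int hγ (kk γ) u v
  rw [he, B1]
  refine strip_int (fun x y => ⟪Rop s γ.fn u.fn x y, Rop s γ.fn v.fn x y⟫ * muW γ.fn x y) (fun x y => ?_) _ hi
    (fun x h hh h0 => Rop_strip γ hγ u v x hh h0)
  simp only [Rop, muW, fper, dper]
lemma B2_eq (γ : Hs s n) (hγ : IM γ) (u v : Hs s n) :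
    B2 s γ.fn u.fn v.fn = ⟪sc (kk γ * (rp (-1) (qd γ) * ip (dl u) (dl v))) (NN γ γ), NN γ γ⟫ := by
  obtain ⟨hi, he⟩ := NN_int hγ (kk γ * (rp (-1) (qd γ) * ip (dl u) (dl v))) γ γ
  rw [he, B2]
  refine strip_int (fun x y => ‖Rop s γ.fn γ.fn x y‖ ^ 2 * (⟪u.fn y - u.fn x, v.fn y - v.fn x⟫ / ‖γ.fn y - γ.fn x‖ ^ 2) * muW γ.fn x y) (fun x y => ?_) _ hi
    (fun x h hh h0 => ?_)
  · simp only [Rop, muW, fper, dper]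
  · have h1 := Rop_strip2 γ hγ γ x hh h0
    simp only [BoundedContinuousFunction.mul_apply, rp_apply _ hγ.pd, ip_apply, dl_apply, qd_apply,
      real_inner_self_eq_norm_sq, Real.rpow_neg_one]
    rw [mul_right_comm, h1, fn_dist γ x hh, ← dlf_mul u x (IH_abs hh), ← dlf_mul v x (IH_abs hh)]
    simp only [inner_smul_left, inner_smul_right, RCLike.conj_to_real, mul_pow, sq_abs]
    have := hγ.dl0 (x, h)
    field_simp
lemma B3_eq (γ : Hs s n) (hγ : IM γ) (u v : Hs s n) :
    B3 s γ.fn u.fn v.fn = ⟪sc (kk γ * (rp (-1) (q0 γ) * ip (e0 u) (e0 v) + rp (-1) (q1 γ) * ip (e1 u) (e1 v))) (NN γ γ), NN γ γ⟫ := by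
  obtain ⟨hi, he⟩ := NN_int hγ (kk γ * (rp (-1) (q0 γ) * ip (e0 u) (e0 v) + rp (-1) (q1 γ) * ip (e1 u) (e1 v))) γ γ
  rw [he, B3]
  refine strip_int (fun x y => ‖Rop s γ.fn γ.fn x y‖ ^ 2 * (⟪Dg γ.fn u.fn x, Dg γ.fn v.fn x⟫ + ⟪Dg γ.fn u.fn y, Dg γ.fn v.fn y⟫) * muW γ.fn x y) (fun x y => ?_) _ hi
    (fun x h hh h0 => ?_)
  · simp only [Rop, muW, fper, dper, Dg]
  · have h1 := Rop_strip2 γ hγ γ x hh h0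
    simp only [BoundedContinuousFunction.mul_apply, BoundedContinuousFunction.add_apply, rp_apply _ hγ.p0, rp_apply _ hγ.p1, ip_apply, e0_apply, e1_apply, q0_apply, q1_apply,
      real_inner_self_eq_norm_sq, Real.rpow_neg_one]
    rw [mul_right_comm, h1]
    simp only [Dg, inner_smul_left, inner_smul_right, RCLike.conj_to_real, dv]
    ring
lemma inner_WW (γ : Hs s n) (hγ : IM γ) (u v : Hs s n) :
    (2 * s + 1) * B2 s γ.fn u.fn v.fn + B3 s γ.fn u.fn v.fn = ⟪sc (WW γ u v) (NN γ γ), NN γ γ⟫ := by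
  rw [B2_eq γ hγ, B3_eq γ hγ, WW, mul_add (kk γ) ((2 * s + 1) • _), map_add, ContinuousLinearMap.add_apply, inner_add_left, mul_smul_comm, map_smul,
    ContinuousLinearMap.smul_apply, inner_smul_left]
  rfl
lemma Gmet_eq (γ : Hs s n) (hγ : IM γ) (u v : Hs s n) : Gmet s γ.fn u.fn v.fn = FF γ u v := by
  have e : ∀ t : ℝ, 0 ≤ t → (t ^ 2) ^ (1/2:ℝ) = t := fun t ht => by
    rw [← Real.sqrt_eq_rpow, Real.sqrt_sq ht]
  have h1 : innerH1g γ.fn u.fn v.fn = I0 (rp (-(1/2)) (q0 γ) * ip (e0 u) (e0 v)) := by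
    rw [innerH1g, I0_apply]
    refine integral_congr_ae (ae_of_all _ fun x => ?_)
    have := hγ.dv0 x
    simp only [BoundedContinuousFunction.mul_apply, rp_apply _ hγ.p0, q0_apply, ip_apply, e0_apply, Dg,
      inner_smul_left, inner_smul_right, RCLike.conj_to_real, Real.rpow_neg (sq_nonneg ‖γ.dv x‖), e _ (norm_nonneg _)]
    change ‖γ.dv x‖⁻¹ * (‖γ.dv x‖⁻¹ * ⟪u.dv x, v.dv x⟫) * ‖γ.dv x‖ = _
    field_simp
  have h2 : innerL2g γ.fn u.fn v.fn = I0 (ip (vl u) (vl v) * rp (1/2) (q0 γ)) := by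
    rw [innerL2g, I0_apply]
    refine integral_congr_ae (ae_of_all _ fun x => ?_)
    simp only [BoundedContinuousFunction.mul_apply, rp_apply _ hγ.p0, q0_apply, ip_apply, vl_apply, e _ (norm_nonneg _)]
    rfl
  have h3 := inner_WW γ hγ u v
  rw [Gmet, FF, B1_eq γ hγ, h1, h2, ← h3]; ring
end Hs
end
set_option maxSynthPendingDepth 3
section
variable {X H Y : Type*} [NormedAddCommGroup X] [NormedSpace ℝ X] [NormedAddCommGroup H] [NormedSpace ℝ H]
  [NormedAddCommGroup Y] [NormedSpace ℝ Y]
def LLf (F : X → H → Y) (x : X) : H →L[ℝ] Y :=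
  (fderiv ℝ (fun q : X × H => F q.1 q.2) (x, 0)).comp (ContinuousLinearMap.inr ℝ X H)
lemma LLf_smooth (F : X → H → Y) (x : X) (m : ℕ)
    (hF : ContDiffAt ℝ (m + 1 : ℕ) (fun q : X × H => F q.1 q.2) (x, 0)) : ContDiffAt ℝ (m : ℕ) (LLf F) x := by
  have h1 := hF.fderiv_right (m := (m : ℕ)) (by exact_mod_cast le_rfl)
  have h2 : ContDiffAt ℝ (m : ℕ) (fun x : X => fderiv ℝ (fun q : X × H => F q.1 q.2) (x, 0)) x :=
    h1.comp x (f := fun x : X => (x, (0 : H))) (by fun_prop)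
  exact h2.clm_comp contDiffAt_const
lemma LLf_apply (F : X → H → Y) (x : X) (hF : DifferentiableAt ℝ (fun q : X × H => F q.1 q.2) (x, 0))
    (hh : ∀ (t : ℝ) u, F x (t • u) = t • F x u) (u : H) : LLf F x u = F x u := by
  have h0 : HasDerivAt (fun t : ℝ => (x, t • u)) ((0 : X), u) 0 := by
    have := (hasDerivAt_const (0:ℝ) x).prodMk ((hasDerivAt_id (0:ℝ)).smul_const u)
    simpa using this
  have hF' : HasFDerivAt (fun q : X × H => F q.1 q.2) (fderiv ℝ (fun q : X × H => F q.1 q.2) (x, 0)) (x, (0:ℝ) • u) := by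
    rw [zero_smul]; exact hF.hasFDerivAt
  have h1 := hF'.comp_hasDerivAt (0:ℝ) h0
  have h2 : HasDerivAt (fun t : ℝ => t • F x u) (F x u) 0 := by
    simpa using (hasDerivAt_id (0:ℝ)).smul_const (F x u)
  have h3 : HasDerivAt (fun t : ℝ => t • F x u) (fderiv ℝ (fun q : X × H => F q.1 q.2) (x, 0) (0, u)) 0 := by
    refine h1.congr_of_eventuallyEq (Eventually.of_forall fun t => ?_)
    exact (hh t u).symm
  exact h3.unique h2
lemma bilin_smooth (F : X → H → H → ℝ) (U : Set X) (hU : IsOpen U) (m : ℕ)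
    (hF : ∀ x ∈ U, ∀ u v, ContDiffAt ℝ (m + 1 + 1 : ℕ) (fun q : (X × H) × H => F q.1.1 q.1.2 q.2) ((x, u), v))
    (h1 : ∀ x ∈ U, ∀ (t : ℝ) u v, F x (t • u) v = t * F x u v)
    (h2 : ∀ x ∈ U, ∀ (t : ℝ) u v, F x u (t • v) = t * F x u v) :
    ∃ G : X → H →L[ℝ] H →L[ℝ] ℝ, (∀ x ∈ U, ContDiffAt ℝ m G x) ∧ ∀ x ∈ U, ∀ u v, G x u v = F x u v := by
  have a1 : ∀ x ∈ U, ∀ u v, LLf (fun (q : X × H) v => F q.1 q.2 v) (x, u) v = F x u v := fun x hx u v =>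
    LLf_apply (fun (q : X × H) v => F q.1 q.2 v) (x, u) ((hF x hx u 0).differentiableAt (by norm_num)) (fun t v => h2 x hx t u v) v
  have s1 : ∀ x ∈ U, ∀ u, ContDiffAt ℝ (m + 1 : ℕ) (LLf (fun (q : X × H) v => F q.1 q.2 v)) (x, u) :=
    fun x hx u => LLf_smooth (fun (q : X × H) v => F q.1 q.2 v) (x, u) (m + 1) (hF x hx u 0)
  refine ⟨LLf fun x u => LLf (fun (q : X × H) v => F q.1 q.2 v) (x, u), fun x hx =>
    LLf_smooth (fun x u => LLf (fun (q : X × H) v => F q.1 q.2 v) (x, u)) x m (s1 x hx 0), fun x hx u v => ?_⟩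
  rw [LLf_apply (fun x u => LLf (fun (q : X × H) v => F q.1 q.2 v) (x, u)) x ((s1 x hx 0).differentiableAt (by norm_num)) (fun t u => ?_) u, a1 x hx]
  ext v
  rw [a1 x hx, h1 x hx, smul_apply, a1 x hx]; rfl
end
section
variable {s : ℝ} {n : ℕ}
namespace Hs
variable [hs : Fact (s ∈ Ioo (3/2:ℝ) 2)]
lemma NN_add (γ u v : Hs s n) : NN γ (u + v) = NN γ u + NN γ v := by
  simp only [NN, map_add, add_apply]; abel
lemma NN_smul (c : ℝ) (γ u : Hs s n) : NN γ (c • u) = c • NN γ u := by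
  simp only [NN, map_smul, smul_apply, smul_sub]
lemma FF_comm {γ : Hs s n} (h : IM γ) (u v : Hs s n) : FF γ u v = FF γ v u := by
  have e : ∀ f g : BX (En n), ip f g = ip g f := fun f g => by ext1 p; rw [ip_apply, ip_apply, real_inner_comm]
  have h1 : ⟪sc (kk γ) (NN γ u), NN γ v⟫ = ⟪sc (kk γ) (NN γ v), NN γ u⟫ := by
    rw [(NN_int h _ _ _).2, (NN_int h _ _ _).2]; simp only [real_inner_comm]
  have h2 : WW γ u v = WW γ v u := by rw [WW, WW, e (dl u), e (e0 u), e (e1 u)]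
  rw [FF, FF, h1, h2, e (e0 u), e (vl u)]
lemma FF_smul (γ : Hs s n) (t : ℝ) (u v : Hs s n) : FF γ (t • u) v = t * FF γ u v := by
  have h2 : WW γ (t • u) v = t • WW γ u v := by
    rw [WW, WW]
    ext1 p
    simp only [map_smul, smul_apply, BoundedContinuousFunction.mul_apply, BoundedContinuousFunction.add_apply,
      BoundedContinuousFunction.smul_apply, smul_eq_mul]
    ring
  rw [FF, FF, h2, NN_smul, map_smul, map_smul, map_smul, map_smul]
  simp only [smul_apply, inner_smul_left, RCLike.conj_to_real, smul_mul_assoc, mul_smul_comm, map_smul, smul_eq_mul]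
  ring
section sm
variable {X : Type*} [NormedAddCommGroup X] [NormedSpace ℝ X] {m : ℕ} {f g k : X → Hs s n} {x : X}
lemma cda_rp (r : ℝ) {b : X → BX ℝ} (hb : ContDiffAt ℝ (m + 1 : ℕ) b x) (h : PosB (b x)) :
    ContDiffAt ℝ (m + 1 : ℕ) (fun x => rp r (b x)) x := (cd_rp r m h).comp x hb
lemma cda_mul {b c : X → BX ℝ} (hb : ContDiffAt ℝ (m + 1 : ℕ) b x) (hc : ContDiffAt ℝ (m + 1 : ℕ) c x) :
    ContDiffAt ℝ (m + 1 : ℕ) (fun x => b x * c x) x := cda_bil (ContinuousLinearMap.mul ℝ (BX ℝ)) hb hc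
lemma cda_cl {F : Type*} [NormedAddCommGroup F] [NormedSpace ℝ F] (L : Hs s n →L[ℝ] F)
    (hf : ContDiffAt ℝ (m + 1 : ℕ) f x) : ContDiffAt ℝ (m + 1 : ℕ) (fun x => L (f x)) x :=
  L.contDiff.contDiffAt.comp x hf
lemma cda_ip (L L' : Hs s n →L[ℝ] BX (En n)) (hf : ContDiffAt ℝ (m + 1 : ℕ) f x) (hg : ContDiffAt ℝ (m + 1 : ℕ) g x) :
    ContDiffAt ℝ (m + 1 : ℕ) (fun x => ip (L (f x)) (L' (g x))) x := cda_bil ip (cda_cl L hf) (cda_cl L' hg)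
lemma cda_kk (hf : ContDiffAt ℝ (m + 1 : ℕ) f x) (h : IM (f x)) : ContDiffAt ℝ (m + 1 : ℕ) (fun x => kk (f x)) x :=
  cda_mul (cda_rp _ (cda_ip _ _ hf hf) h) (cda_mul (cda_rp _ (cda_ip _ _ hf hf) h.p0) (cda_rp _ (cda_ip _ _ hf hf) h.p1))
lemma cda_zz (hf : ContDiffAt ℝ (m + 1 : ℕ) f x) (h : IM (f x)) : ContDiffAt ℝ (m + 1 : ℕ) (fun x => zz (f x)) x :=
  cda_bil (act (muS s) (innerSL ℝ)) (cda_bil (bl (ContinuousLinearMap.lsmul ℝ ℝ)) (cda_rp _ (cda_ip _ _ hf hf) h.p0)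
    (cda_cl e0 hf)) (cda_cl Dl hf)
lemma cda_NN (hf : ContDiffAt ℝ (m + 1 : ℕ) f x) (hg : ContDiffAt ℝ (m + 1 : ℕ) g x) (h : IM (f x)) :
    ContDiffAt ℝ (m + 1 : ℕ) (fun x => NN (f x) (g x)) x :=
  (cda_cl Dl hg).sub (cda_bil (act (muS s) (ContinuousLinearMap.lsmul ℝ ℝ).flip) (cda_cl e0 hg) (cda_zz hf h))
lemma cda_in {b : X → BX ℝ} {c : X → Lp (En n) 2 (muS s)} {d : X → Lp (En n) 2 (muS s)} (hb : ContDiffAt ℝ (m + 1 : ℕ) b x)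
    (hc : ContDiffAt ℝ (m + 1 : ℕ) c x) (hd : ContDiffAt ℝ (m + 1 : ℕ) d x) :
    ContDiffAt ℝ (m + 1 : ℕ) (fun x => ⟪sc (b x) (c x), d x⟫) x :=
  cda_bil (innerSL ℝ) (cda_bil sc hb hc) hd
lemma cda_FF (hf : ContDiffAt ℝ (m + 1 : ℕ) f x) (hg : ContDiffAt ℝ (m + 1 : ℕ) g x)
    (hk : ContDiffAt ℝ (m + 1 : ℕ) k x) (h : IM (f x)) :
    ContDiffAt ℝ (m + 1 : ℕ) (fun x => FF (f x) (g x) (k x)) x := by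
  have hW : ContDiffAt ℝ (m + 1 : ℕ) (fun x => WW (f x) (g x) (k x)) x :=
    cda_mul (cda_kk hf h) (((cda_mul (cda_rp _ (cda_ip _ _ hf hf) h) (cda_ip _ _ hg hk)).const_smul _).add
      ((cda_mul (cda_rp _ (cda_ip _ _ hf hf) h.p0) (cda_ip _ _ hg hk)).add
      (cda_mul (cda_rp _ (cda_ip _ _ hf hf) h.p1) (cda_ip _ _ hg hk))))
  have h1 := cda_in (cda_kk hf h) (cda_NN hf hg h) (cda_NN hf hk h)
  have h2 := cda_in hW (cda_NN hf hf h) (cda_NN hf hf h)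
  have h3 : ContDiffAt ℝ (m + 1 : ℕ) (fun x => I0 (rp (-(1/2)) (q0 (f x)) * ip (e0 (g x)) (e0 (k x)))) x :=
    I0.contDiff.contDiffAt.comp x (cda_mul (cda_rp _ (cda_ip _ _ hf hf) h.p0) (cda_ip _ _ hg hk))
  have h4 : ContDiffAt ℝ (m + 1 : ℕ) (fun x => I0 (ip (vl (g x)) (vl (k x)) * rp (1/2) (q0 (f x)))) x :=
    I0.contDiff.contDiffAt.comp x (cda_mul (cda_ip _ _ hg hk) (cda_rp _ (cda_ip _ _ hf hf) h.p0))
  exact (((contDiffAt_const.mul h1).add h2).add h3).add h4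
end sm
lemma exG : ∃ G : Hs s n → Hs s n →L[ℝ] Hs s n →L[ℝ] ℝ, (∀ γ ∈ {γ : Hs s n | IM γ}, ContDiffAt ℝ (2:ℕ) G γ) ∧
    ∀ γ ∈ {γ : Hs s n | IM γ}, ∀ u v, G γ u v = FF γ u v := by
  refine bilin_smooth FF {γ | IM γ} IM_open 2 (fun γ hγ u v => ?_) (fun γ _ t u v => FF_smul γ t u v)
    (fun γ hγ t u v => by rw [FF_comm hγ, FF_smul, FF_comm hγ])
  exact cda_FF (m := 3) (x := ((γ, u), v)) (f := fun q : (Hs s n × Hs s n) × Hs s n => q.1.1) (g := fun q => q.1.2) (k := fun q => q.2)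
    (contDiff_fst.comp contDiff_fst).contDiffAt (contDiff_snd.comp contDiff_fst).contDiffAt contDiff_snd.contDiffAt hγ
variable (s n) in
def GG : Hs s n → Hs s n →L[ℝ] Hs s n →L[ℝ] ℝ := Classical.choose (exG (s := s) (n := n))
lemma GG_cd {γ : Hs s n} (h : IM γ) : ContDiffAt ℝ (2:ℕ) (GG s n) γ := (Classical.choose_spec (exG (s := s) (n := n))).1 γ h
lemma GG_FF {γ : Hs s n} (h : IM γ) (u v : Hs s n) : GG s n γ u v = FF γ u v := (Classical.choose_spec (exG (s := s) (n := n))).2 γ h u v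
lemma GG_met {γ : Hs s n} (h : IM γ) (u v : Hs s n) : Gmet s γ.fn u.fn v.fn = GG s n γ u v := by rw [GG_FF h, Gmet_eq _ h]
lemma GG_comm {γ : Hs s n} (h : IM γ) (u v : Hs s n) : GG s n γ u v = GG s n γ v u := by rw [GG_FF h, FF_comm h, GG_FF h]
lemma GG_d {γ : Hs s n} (h : IM γ) : DifferentiableAt ℝ (GG s n) γ := (GG_cd h).differentiableAt (by norm_num)
lemma DGdir_eq {γ : Hs s n} (h : IM γ) (w u v : Hs s n) :
    DGdir s γ.fn w.fn u.fn v.fn = fderiv ℝ (GG s n) γ w u v := by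
  have h0 : HasDerivAt (fun t : ℝ => γ + t • w) w 0 := by
    simpa using ((hasDerivAt_id (0:ℝ)).smul_const w).const_add γ
  have hG : HasFDerivAt (GG s n) (fderiv ℝ (GG s n) γ) (γ + (0:ℝ) • w) := by
    rw [zero_smul, add_zero]; exact (GG_d h).hasFDerivAt
  have h1 := hG.comp_hasDerivAt (0:ℝ) h0
  have h2 : HasDerivAt (fun t : ℝ => GG s n (γ + t • w) u v) (fderiv ℝ (GG s n) γ w u v) 0 := by
    have := (h1.clm_apply (hasDerivAt_const (0:ℝ) u)).clm_apply (hasDerivAt_const (0:ℝ) v)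
    simpa using this
  have h3 : ∀ᶠ t : ℝ in 𝓝 0, IM (γ + t • w) := by
    refine h0.continuousAt.eventually (p := fun γ => IM γ) ?_
    simp only [zero_smul, add_zero]; exact IM_open.mem_nhds h
  refine HasDerivAt.deriv (h2.congr_of_eventuallyEq ?_)
  filter_upwards [h3] with t ht
  exact GG_met ht u v
end Hs
end
section
variable {s : ℝ} {n : ℕ}
namespace Hs
variable [hs : Fact (s ∈ Ioo (3/2:ℝ) 2)]
lemma dlf_cl (γ : Hs s n) (x h : ℝ) : γ.dlf (x, h) = γ.dlf (x, cl h) := by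
  simp only [dlf, cl_eq (cl_abs h)]
lemma fract_fn (γ : Hs s n) (x : ℝ) : γ.fn (Int.fract x) = γ.fn x := by
  have := γ.per.sub_int_mul_eq (x := x) ⌊x⌋
  rwa [mul_one] at this
lemma fract_dl (γ : Hs s n) (x h : ℝ) : γ.dlf (Int.fract x, h) = γ.dlf (x, h) := by
  simp only [dlf]
  refine intervalIntegral.integral_congr fun θ _ => ?_
  have := γ.perd.sub_int_mul_eq (x := x + θ * cl h) ⌊x⌋
  simp only [Int.fract]
  rw [← this]; congr 1; ring
lemma IM_of_lb {γ : Hs s n} {c : ℝ} (hc : 0 < c) (h : ∀ x h, |h| ≤ 1/2 → c ≤ ‖γ.dlf (x, h)‖) : IM γ := by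
  refine ⟨c ^ 2, by positivity, fun p => ?_⟩
  rw [qd_apply, show p = (p.1, p.2) from rfl, dlf_cl]
  exact pow_le_pow_left₀ hc.le (h _ _ (cl_abs _)) 2
lemma IM_inj {γ : Hs s n} (hγ : IM γ) {x y : ℝ} (h1 : x < y) (h2 : y < x + 1) : γ.fn y ≠ γ.fn x := by
  intro he
  rcases le_or_gt (y - x) (1/2) with h | h
  · have := dlf_mul γ x (h := y - x) (by rw [abs_le]; constructor <;> linarith)
    rw [add_sub_cancel, he, sub_self, smul_eq_zero] at this
    rcases this with h | h
    · linarith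
    · have := hγ.dl0 (x, y - x); rw [h] at this; simp at this
  · have := dlf_mul γ y (h := x + 1 - y) (by rw [abs_le]; constructor <;> linarith)
    rw [add_sub_cancel, fper, he, sub_self, smul_eq_zero] at this
    rcases this with h | h
    · linarith
    · have := hγ.dl0 (y, x + 1 - y); rw [h] at this; simp at this
lemma InM_iff (γ : Hs s n) : InM s γ.fn ↔ IM γ := by
  constructor
  · rintro ⟨-, hi, hd⟩
    have pos : ∀ x h : ℝ, |h| ≤ 1/2 → γ.dlf (x, h) ≠ 0 := by
      intro x h hh h0
      rcases eq_or_ne h 0 with rfl | hne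
      · rw [dlf_zero] at h0; exact hd x h0
      have e := dlf_mul γ x hh
      rw [h0, smul_zero, eq_comm, sub_eq_zero, ← fract_fn, ← fract_fn γ x] at e
      have := hi ⟨Int.fract_nonneg _, Int.fract_lt_one _⟩ ⟨Int.fract_nonneg _, Int.fract_lt_one _⟩ e
      rw [Int.fract_eq_fract] at this
      obtain ⟨z, hz⟩ := this
      rw [add_sub_cancel_left] at hz
      rw [abs_le, hz] at hh
      have a1 : (z : ℝ) < 1 := by linarith
      have a2 : (-1 : ℝ) < z := by linarith
      have : z = 0 := by
        have : z < 1 := by exact_mod_cast a1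
        have : -1 < z := by exact_mod_cast a2
        omega
      rw [this] at hz; simp at hz; exact hne hz
    obtain ⟨p, pm, hp⟩ := (isCompact_Icc.prod isCompact_Icc : IsCompact (Icc (0:ℝ) 1 ×ˢ Icc (-(1/2):ℝ) (1/2))).exists_isMinOn
      ⟨(0, 0), by norm_num⟩ γ.dlf_cont.norm.continuousOn
    refine IM_of_lb (norm_pos_iff.2 (pos p.1 p.2 (abs_le.2 pm.2))) fun x h hh => ?_
    rw [← fract_dl γ x]
    exact hp (a := (Int.fract x, h)) ⟨⟨Int.fract_nonneg _, (Int.fract_lt_one _).le⟩, abs_le.1 hh⟩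
  · intro h
    refine ⟨γ.mem, fun x hx y hy he => ?_, fun x h0 => ?_⟩
    · rcases lt_trichotomy x y with h1 | h1 | h1
      · exact absurd he.symm (IM_inj h h1 (by linarith [hx.1, hy.2]))
      · exact h1
      · exact absurd he (IM_inj h h1 (by linarith [hy.1, hx.2]))
    · have := h.dv0 x
      rw [dv, h0, norm_zero] at this; exact lt_irrefl _ this
end Hs
end
lemma vec_est {E : Type*} [NormedAddCommGroup E] [InnerProductSpace ℝ E] {a b Δ p q d : E} {ω : ℝ}
    (ha : ‖a‖ = 1) (hb : ‖b‖ = 1) (hab : 1/2 ≤ ⟪a, b⟫) (hω : 0 ≤ ω) (hΔ : ω / 2 ≤ |⟪b, Δ⟫|) :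
    ‖q - p‖ ^ 2 * ω ^ 2 ≤ 32 * ((‖d - ⟪a, Δ⟫ • p‖ ^ 2 + ‖-d - ⟪b, -Δ⟫ • q‖ ^ 2) +
      ‖p‖ ^ 2 * (‖Δ - ⟪a, Δ⟫ • a‖ ^ 2 + ‖-Δ - ⟪b, -Δ⟫ • b‖ ^ 2)) := by
  set n1 := ‖d - ⟪a, Δ⟫ • p‖
  set n2 := ‖-d - ⟪b, -Δ⟫ • q‖
  set m1 := ‖Δ - ⟪a, Δ⟫ • a‖
  set m2 := ‖-Δ - ⟪b, -Δ⟫ • b‖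
  have i1 : ⟪b - a, Δ⟫ * (1 + ⟪a, b⟫) = ⟪a + b, (Δ - ⟪a, Δ⟫ • a) + (-Δ - ⟪b, -Δ⟫ • b)⟫ := by
    have e1 : ⟪a, a⟫ = 1 := by rw [real_inner_self_eq_norm_sq, ha]; norm_num
    have e2 : ⟪b, b⟫ = 1 := by rw [real_inner_self_eq_norm_sq, hb]; norm_num
    simp only [inner_add_left, inner_add_right, inner_sub_left, inner_sub_right, inner_smul_right, inner_neg_right, e1, e2]
    rw [real_inner_comm b a]; ring
  have i2 : |⟪b - a, Δ⟫| * (3/2) ≤ 2 * (m1 + m2) := by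
    have h1 : |⟪b - a, Δ⟫| * (1 + ⟪a, b⟫) ≤ 2 * (m1 + m2) := by
      rw [← abs_of_pos (show 0 < 1 + ⟪a, b⟫ by linarith), ← abs_mul, i1]
      refine (abs_real_inner_le_norm _ _).trans ?_
      refine mul_le_mul ?_ (norm_add_le _ _) (norm_nonneg _) (by norm_num)
      exact (norm_add_le _ _).trans (by rw [ha, hb]; norm_num)
    have := abs_nonneg ⟪b - a, Δ⟫
    nlinarith
  have i3 : ⟪b, Δ⟫ • (q - p) = (d - ⟪a, Δ⟫ • p) + (-d - ⟪b, -Δ⟫ • q) - ⟪b - a, Δ⟫ • p := by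
    simp only [inner_sub_left, inner_neg_right]; module
  have i4 : |⟪b, Δ⟫| * ‖q - p‖ ≤ n1 + n2 + |⟪b - a, Δ⟫| * ‖p‖ := by
    rw [← Real.norm_eq_abs, ← norm_smul, i3, ← Real.norm_eq_abs, ← norm_smul]
    exact (norm_sub_le _ _).trans (add_le_add_left (norm_add_le _ _) _)
  have i5 : ‖q - p‖ * ω ≤ 2 * (n1 + n2) + 8/3 * (‖p‖ * (m1 + m2)) := by
    have h1 : ω / 2 * ‖q - p‖ ≤ |⟪b, Δ⟫| * ‖q - p‖ := mul_le_mul_of_nonneg_right hΔ (norm_nonneg _)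
    have h2 : |⟪b - a, Δ⟫| * ‖p‖ ≤ (4/3 * (m1 + m2)) * ‖p‖ := mul_le_mul_of_nonneg_right (by linarith) (norm_nonneg _)
    nlinarith
  have i6 := pow_le_pow_left₀ (by positivity) i5 2
  rw [mul_pow] at i6
  refine i6.trans ?_
  nlinarith [sq_nonneg (n1 - n2), sq_nonneg (‖p‖ * (m1 - m2)), sq_nonneg (2 * (n1 + n2) - 8/3 * (‖p‖ * (m1 + m2))),
    sq_nonneg (‖p‖ * m1), sq_nonneg (‖p‖ * m2), sq_nonneg (‖p‖ * (m1 + m2))]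
section
variable {s : ℝ} {n : ℕ}
namespace Hs
def Du (γ u : Hs s n) (x : ℝ) : En n := ‖γ.dv x‖⁻¹ • u.dv x
abbrev ta (γ : Hs s n) (x : ℝ) : En n := Du γ γ x
def ww (γ : Hs s n) (x : ℝ) : ℝ := ‖γ.dv x‖
def num (γ u : Hs s n) (x y : ℝ) : En n := u.fn y - u.fn x - ⟪ta γ x, γ.fn y - γ.fn x⟫ • Du γ u x
def Ph (γ u : Hs s n) (x y : ℝ) : ℝ := ‖Rop s γ.fn u.fn x y‖ ^ 2 * muW γ.fn x y
def JJ (γ u : Hs s n) (x y : ℝ) : ℝ := Ph γ u x y + (‖Du γ u x‖ ^ 2 + ‖Du γ u y‖ ^ 2) * Ph γ γ x y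
def QQ (γ u : Hs s n) : ℝ := B1 s γ.fn u.fn u.fn + B3 s γ.fn u.fn u.fn
def om (γ : Hs s n) (x y : ℝ) : ℝ := ∫ t in x..y, ww γ t
variable [hs : Fact (s ∈ Ioo (3/2:ℝ) 2)]
lemma ww_cont (γ : Hs s n) : Continuous γ.ww := γ.contd.norm
lemma ww_per (γ : Hs s n) : Function.Periodic γ.ww 1 := fun x => by simp only [ww, γ.perd x]
lemma Du_per (γ u : Hs s n) : Function.Periodic (Du γ u) 1 := fun x => by simp only [Du, γ.perd x, u.perd x]
lemma Ph_nonneg (γ u : Hs s n) (x y : ℝ) : 0 ≤ Ph γ u x y := by unfold Ph muW; positivity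
lemma JJ_nonneg (γ u : Hs s n) (x y : ℝ) : 0 ≤ JJ γ u x y := by
  have := Ph_nonneg γ u x y; have := Ph_nonneg γ γ x y
  unfold JJ; positivity
lemma Ph_per (γ u : Hs s n) (x : ℝ) : Function.Periodic (Ph γ u x) 1 := fun y => by
  simp only [Ph, Rop, muW, fper, dper]
lemma Ph_per' (γ u : Hs s n) (y : ℝ) : Function.Periodic (fun x => Ph γ u x y) 1 := fun x => by
  simp only [Ph, Rop, muW, fper, dper, DDg]
lemma JJ_per (γ u : Hs s n) (x : ℝ) : Function.Periodic (JJ γ u x) 1 := fun y => by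
  simp only [JJ, Ph_per γ _ x y, Du_per γ u y]
lemma JJ_per' (γ u : Hs s n) (y : ℝ) : Function.Periodic (fun x => JJ γ u x y) 1 := fun x => by
  have h1 := Ph_per' γ u y x; have h2 := Ph_per' γ γ y x
  simp only [JJ, Du_per γ u x] at *
  rw [h1, h2]
variable {γ : Hs s n}
lemma Du_cont (h : IM γ) (u : Hs s n) : Continuous (Du γ u) := by
  have := u.contd; have := γ.contd
  exact (Continuous.inv₀ (by fun_prop) fun x => (h.dv0 x).ne').smul u.contd
lemma ta_norm (h : IM γ) (x : ℝ) : ‖ta γ x‖ = 1 := by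
  rw [ta, Du, norm_smul, norm_inv, norm_norm, inv_mul_cancel₀ (h.dv0 x).ne']
lemma ta_ww (h : IM γ) (x : ℝ) : γ.ww x • ta γ x = γ.dv x := by
  rw [ta, Du, ww, smul_smul, mul_inv_cancel₀ (h.dv0 x).ne', one_smul]
lemma Du_ww (h : IM γ) (u : Hs s n) (x : ℝ) : γ.ww x • Du γ u x = u.dv x := by
  rw [Du, ww, smul_smul, mul_inv_cancel₀ (h.dv0 x).ne', one_smul]
lemma ww_pos (h : IM γ) (x : ℝ) : 0 < γ.ww x := h.dv0 x
lemma ww_lb (h : IM γ) : ∃ c > 0, ∀ x, c ≤ γ.ww x := by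
  obtain ⟨c, hc, h⟩ := h.p0
  refine ⟨√c, Real.sqrt_pos.2 hc, fun x => ?_⟩
  have := h (x, 0)
  rw [q0_apply] at this
  exact Real.sqrt_le_iff.2 ⟨norm_nonneg _, this⟩
lemma DDg_eq (u : Hs s n) (x : ℝ) (v : En n) : DDg γ.fn u.fn x v = ⟪ta γ x, v⟫ • Du γ u x := by
  simp only [DDg, ta, Du, inner_smul_left, RCLike.conj_to_real, smul_smul]
  change ((‖γ.dv x‖ ^ 2)⁻¹ * ⟪γ.dv x, v⟫) • u.dv x = _
  congr 1
  rw [sq, mul_inv]; ring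
lemma Ph_eq (γ u : Hs s n) (x y : ℝ) (h0 : γ.fn y ≠ γ.fn x) :
    Ph γ u x y = ‖num γ u x y‖ ^ 2 * (‖γ.fn y - γ.fn x‖ ^ (2 * s + 1))⁻¹ * (γ.ww x * γ.ww y) := by
  have hp : 0 < ‖γ.fn y - γ.fn x‖ := norm_pos_iff.2 (sub_ne_zero.2 h0)
  rw [Ph, Rop, DDg_eq, muW, norm_smul, norm_inv, Real.norm_of_nonneg (by positivity), mul_pow]
  change _ * (γ.ww x * γ.ww y / _) = _
  rw [num, Real.rpow_add hp, Real.rpow_one, mul_comm 2 s, Real.rpow_mul hp.le, Real.rpow_two]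
  have := Real.rpow_pos_of_pos hp s
  field_simp
def Good (γ : Hs s n) (a b : ℝ) : Prop := b < a + 1 ∧ ∀ z ∈ Icc a b, ‖ta γ z - ta γ a‖ ≤ 1/2
lemma Good.inn (h : IM γ) {a b : ℝ} (hg : Good γ a b) {y z : ℝ} (hy : y ∈ Icc a b) (hz : z ∈ Icc a b) :
    1/2 ≤ ⟪ta γ y, ta γ z⟫ := by
  have h1 : ‖ta γ y - ta γ z‖ ≤ 1 := by
    have := norm_sub_le (ta γ y - ta γ a) (ta γ z - ta γ a)
    rw [sub_sub_sub_cancel_right] at this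
    linarith [hg.2 y hy, hg.2 z hz]
  have h2 := norm_sub_sq_real (ta γ y) (ta γ z)
  rw [ta_norm h, ta_norm h] at h2
  have := norm_nonneg (ta γ y - ta γ z)
  nlinarith
lemma fn_int (h : IM γ) (x y : ℝ) : γ.fn y - γ.fn x = ∫ z in x..y, γ.ww z • ta γ z := by
  simp only [ta_ww h]
  exact (intervalIntegral.integral_eq_sub_of_hasDerivAt (fun z _ => γ.hasd z) (γ.contd.intervalIntegrable _ _)).symm
lemma inner_int (h : IM γ) (v : En n) (x y : ℝ) : ⟪v, γ.fn y - γ.fn x⟫ = ∫ z in x..y, γ.ww z * ⟪v, ta γ z⟫ := by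
  rw [fn_int h]
  have c1 := γ.ww_cont; have c2 := Du_cont h γ
  have := ((innerSL ℝ v).intervalIntegral_comp_comm
        (Continuous.intervalIntegrable (μ := volume) (u := fun z => γ.ww z • ta γ z) (by fun_prop) x y))
  refine this.symm.trans (intervalIntegral.integral_congr fun z _ => ?_)
  exact real_inner_smul_right v (ta γ z) (γ.ww z)
lemma om_symm (γ : Hs s n) (x y : ℝ) : om γ y x = - om γ x y := intervalIntegral.integral_symm _ _
lemma om_add (γ : Hs s n) (x y z : ℝ) : om γ x y + om γ y z = om γ x z := by
  have i : ∀ a b, IntervalIntegrable γ.ww volume a b := fun a b => γ.ww_cont.intervalIntegrable a b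
  exact intervalIntegral.integral_add_adjacent_intervals (i _ _) (i _ _)
lemma om_pos (h : IM γ) {x y : ℝ} (hxy : x < y) : 0 < om γ x y := wint_pos γ.ww_cont (ww_pos h) hxy
lemma om_nonneg (h : IM γ) {x y : ℝ} (hxy : x ≤ y) : 0 ≤ om γ x y := by
  rcases hxy.eq_or_lt with rfl | h1
  · simp [om]
  · exact (om_pos h h1).le
lemma dist_le_om (h : IM γ) (x y : ℝ) : ‖γ.fn y - γ.fn x‖ ≤ |om γ x y| := by
  rw [fn_int h]
  refine (intervalIntegral.norm_integral_le_abs_integral_norm (μ := volume)).trans (le_of_eq ?_)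
  congr 1
  refine intervalIntegral.integral_congr fun z _ => ?_
  simp only [norm_smul, ta_norm h, mul_one, Real.norm_of_nonneg (ww_pos h z).le]
lemma Good.low (h : IM γ) {a b : ℝ} (hg : Good γ a b) {v y z : ℝ} (hv : v ∈ Icc a b) (hy : y ∈ Icc a b) (hz : z ∈ Icc a b) :
    |om γ y z| / 2 ≤ |⟪ta γ v, γ.fn z - γ.fn y⟫| := by
  have c1 := γ.ww_cont; have c2 := Du_cont h γ
  have key : ∀ {y z : ℝ}, y ∈ Icc a b → z ∈ Icc a b → y ≤ z → |om γ y z| / 2 ≤ |⟪ta γ v, γ.fn z - γ.fn y⟫| := by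
    intro y z hy hz hyz
    rw [abs_of_nonneg (om_nonneg h hyz)]
    refine le_trans ?_ (le_abs_self _)
    rw [inner_int h, om, ← intervalIntegral.integral_div]
    refine intervalIntegral.integral_mono_on hyz (Continuous.intervalIntegrable (by fun_prop) _ _)
      (Continuous.intervalIntegrable (by fun_prop) _ _) fun t ht => ?_
    have := hg.inn h hv (z := t) ⟨hy.1.trans ht.1, ht.2.trans hz.2⟩
    have := ww_pos h t
    nlinarith
  rcases le_total y z with h1 | h1
  · exact key hy hz h1
  · have := key hz hy h1
    rwa [om_symm, abs_neg, ← neg_sub, inner_neg_right, abs_neg] at this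
lemma Good.pt (h : IM γ) {a b : ℝ} (hg : Good γ a b) (u : Hs s n) {x y : ℝ} (hx : x ∈ Icc a b) (hy : y ∈ Icc a b) :
    γ.ww x * γ.ww y * ‖Du γ u y - Du γ u x‖ ^ 2 ≤
      |om γ x y| ^ (2 * (s - 3/2) + 2) * (32 * (JJ γ u x y + JJ γ u y x)) := by
  have w1 := ww_pos h x; have w2 := ww_pos h y
  have hs1 := hs.out.1
  have J0 := JJ_nonneg γ u x y; have J1 := JJ_nonneg γ u y x
  rcases eq_or_ne x y with rfl | hne
  · simp only [sub_self, norm_zero]; norm_num; positivity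
  have hom : 0 < |om γ x y| := by
    rw [abs_pos]
    rcases lt_or_gt_of_ne hne with h1 | h1
    · exact (om_pos h h1).ne'
    · rw [om_symm]; exact neg_ne_zero.2 (om_pos h h1).ne'
  have hlow := hg.low h hy hx hy
  have hΔ0 : γ.fn y ≠ γ.fn x := by
    intro h0; rw [h0, sub_self, inner_zero_right, abs_zero] at hlow; linarith
  have hv := vec_est (p := Du γ u x) (q := Du γ u y) (d := u.fn y - u.fn x) (ta_norm h x) (ta_norm h y) (hg.inn h hx hy) hom.le hlow
  simp only [neg_sub] at hv
  set ω := |om γ x y|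
  have hΔ : 0 < ‖γ.fn y - γ.fn x‖ := norm_pos_iff.2 (sub_ne_zero.2 hΔ0)
  have hle := dist_le_om h x y
  have e1 := Ph_eq γ u x y hΔ0
  have e2 := Ph_eq γ u y x hΔ0.symm
  have e3 := Ph_eq γ γ x y hΔ0
  have e4 := Ph_eq γ γ y x hΔ0.symm
  have p3 := Ph_nonneg γ γ x y; have p4 := Ph_nonneg γ γ y x
  rw [norm_sub_rev (γ.fn x), mul_comm (γ.ww y)] at e2 e4
  set D := ‖γ.fn y - γ.fn x‖
  have hD : D ^ (2 * s + 1) ≤ ω ^ (2 * s + 1) := Real.rpow_le_rpow hΔ.le hle (by linarith)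
  have hD0 := Real.rpow_pos_of_pos hΔ (2 * s + 1)
  set W := γ.ww x * γ.ww y
  have hW : 0 < W := by positivity
  have h1 : W * (‖Du γ u y - Du γ u x‖ ^ 2 * ω ^ 2) ≤ D ^ (2 * s + 1) * (32 * (JJ γ u x y + JJ γ u y x)) := by
    refine (mul_le_mul_of_nonneg_left hv hW.le).trans ?_
    change W * (32 * (‖num γ u x y‖ ^ 2 + ‖num γ u y x‖ ^ 2 + ‖Du γ u x‖ ^ 2 * (‖num γ γ x y‖ ^ 2 + ‖num γ γ y x‖ ^ 2))) ≤ _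
    have f1 : ∀ {N P : ℝ}, P = N * (D ^ (2 * s + 1))⁻¹ * W → D ^ (2 * s + 1) * P = W * N := fun {N P} hP => by
      rw [hP]; field_simp
    have g1 := f1 e1; have g2 := f1 e2; have g3 := f1 e3; have g4 := f1 e4
    have hJ : Ph γ u x y + Ph γ u y x + ‖Du γ u x‖ ^ 2 * (Ph γ γ x y + Ph γ γ y x) ≤ JJ γ u x y + JJ γ u y x := by
      unfold JJ
      have := mul_nonneg (sq_nonneg ‖Du γ u y‖) p3
      have := mul_nonneg (sq_nonneg ‖Du γ u y‖) p4
      nlinarith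
    refine le_trans (le_of_eq ?_) (mul_le_mul_of_nonneg_left (mul_le_mul_of_nonneg_left hJ (by norm_num : (0:ℝ) ≤ 32)) hD0.le)
    have : D ^ (2 * s + 1) * (32 * (Ph γ u x y + Ph γ u y x + ‖Du γ u x‖ ^ 2 * (Ph γ γ x y + Ph γ γ y x))) =
      32 * (D ^ (2 * s + 1) * Ph γ u x y + D ^ (2 * s + 1) * Ph γ u y x + ‖Du γ u x‖ ^ 2 * (D ^ (2 * s + 1) * Ph γ γ x y + D ^ (2 * s + 1) * Ph γ γ y x)) := by ring
    rw [this, g1, g2, g3, g4]; ring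
  have h2 := h1.trans (mul_le_mul_of_nonneg_right hD (by positivity))
  rw [show 2 * s + 1 = (2 * (s - 3/2) + 2) + 2 by ring, Real.rpow_add hom, Real.rpow_two, ← mul_assoc] at h2
  have : 0 < ω ^ 2 := by positivity
  nlinarith
end Hs
end
lemma dbl_le2 {F : ℝ → ℝ → ℝ≥0∞} (h1 : ∀ x, Function.Periodic (F x) 1)
    (h2 : ∀ y, Function.Periodic (fun x => F x y) 1) {a b c d : ℝ} (hab : b ≤ a + 1) (hcd : d ≤ c + 1) :
    ∫⁻ x in Ioc a b, ∫⁻ y in Ioc c d, F x y ≤ ∫⁻ x in I01, ∫⁻ y in I01, F x y := by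
  have key : ∀ {g : ℝ → ℝ≥0∞} {a b : ℝ}, b ≤ a + 1 → Function.Periodic g 1 → ∫⁻ y in Ioc a b, g y ≤ ∫⁻ y in I01, g y := by
    intro g a b hab hg
    refine (lintegral_mono_set (Ioc_subset_Ioc_right hab)).trans ?_
    rw [← ico_ae, lper_gen hg a 0, zero_add]; exact le_rfl
  refine (lintegral_mono fun x => key hcd (h1 x)).trans ?_
  exact key hab fun x => lintegral_congr fun y => h2 y x
lemma sym_aux (F : ℝ → ℝ → ℝ) (hm : Measurable (Function.uncurry F)) (h0 : ∀ x y, 0 ≤ F x y) :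
    ∫⁻ x in I01, ∫⁻ y in I01, ENNReal.ofReal (32 * (F x y + F y x)) = 64 * ∫⁻ x in I01, ∫⁻ y in I01, ENNReal.ofReal (F x y) := by
  have m := hm.ennreal_ofReal
  have m' : Measurable (Function.uncurry fun x y => ENNReal.ofReal (F y x)) := m.comp measurable_swap
  have e : ∀ x y, ENNReal.ofReal (32 * (F x y + F y x)) = 32 * (ENNReal.ofReal (F x y) + ENNReal.ofReal (F y x)) :=
    fun x y => by rw [ENNReal.ofReal_mul (by norm_num), ENNReal.ofReal_add (h0 _ _) (h0 _ _)]; norm_num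
  have m1 : ∀ x, Measurable fun y => ENNReal.ofReal (F x y) := fun x => m.comp measurable_prodMk_left
  have a1 : ∀ x, ∫⁻ y in I01, ENNReal.ofReal (32 * (F x y + F y x)) = 32 * ((∫⁻ y in I01, ENNReal.ofReal (F x y)) + ∫⁻ y in I01, ENNReal.ofReal (F y x)) := fun x => by
    simp only [e]
    rw [lintegral_const_mul' _ _ (by norm_num), lintegral_add_left (m1 x)]
  have a2 : Measurable fun x => ∫⁻ y in I01, ENNReal.ofReal (F x y) := m.lintegral_prod_right' (ν := volume.restrict I01)
  have a3 : ∫⁻ x in I01, ∫⁻ y in I01, ENNReal.ofReal (F y x) = ∫⁻ x in I01, ∫⁻ y in I01, ENNReal.ofReal (F x y) :=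
    lintegral_lintegral_swap (f := fun x y => ENNReal.ofReal (F y x)) m'.aemeasurable
  rw [lintegral_congr a1, lintegral_const_mul' _ _ (by norm_num), lintegral_add_left a2, a3, ← two_mul, ← mul_assoc]
  norm_num
section
variable {s : ℝ} {n : ℕ}
namespace Hs
variable [hs : Fact (s ∈ Ioo (3/2:ℝ) 2)]
variable {γ : Hs s n}
def EE (γ : Hs s n) : ℝ := B1 s γ.fn γ.fn γ.fn
lemma Ph_meas (γ u : Hs s n) : Measurable (Function.uncurry (Ph γ u)) := by
  have c1 := γ.cont.measurable; have c2 := u.cont.measurable; have c3 := γ.contd.measurable; have c4 := u.contd.measurable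
  change Measurable (fun p : ℝ × ℝ => Ph γ u p.1 p.2)
  simp only [Ph, Rop, muW, DDg]
  change Measurable (fun p : ℝ × ℝ => ‖(‖γ.fn p.2 - γ.fn p.1‖ ^ s)⁻¹ • (u.fn p.2 - u.fn p.1 - ((‖γ.dv p.1‖ ^ 2)⁻¹ * ⟪γ.dv p.1, γ.fn p.2 - γ.fn p.1⟫) • u.dv p.1)‖ ^ 2 *
    (‖γ.dv p.1‖ * ‖γ.dv p.2‖ / ‖γ.fn p.2 - γ.fn p.1‖))
  fun_prop
lemma Du_meas (h : IM γ) (u : Hs s n) : Measurable (Du γ u) := (Du_cont h u).measurable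
lemma JJ_meas (h : IM γ) (u : Hs s n) : Measurable (Function.uncurry (JJ γ u)) := by
  have d := Du_meas h u
  exact (Ph_meas γ u).add (((d.comp measurable_fst).norm.pow_const 2 |>.add ((d.comp measurable_snd).norm.pow_const 2)).mul (Ph_meas γ γ))
lemma nn_meas (h : IM γ) (u : Hs s n) : Measurable (nn γ u) := by
  have c1 := γ.Df_cont.measurable; have c2 := u.Df_cont.measurable; have c3 := γ.contd.measurable; have c4 := u.contd.measurable
  unfold nn; fun_prop
lemma JJ_lint (h : IM γ) (u : Hs s n) : ∫⁻ x in I01, ∫⁻ y in I01, ENNReal.ofReal (JJ γ u x y) = ENNReal.ofReal (QQ γ u) := by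
  obtain ⟨i1, E1⟩ := NN_int h (kk γ) u u
  obtain ⟨i2, E2⟩ := NN_int h (kk γ * (rp (-1) (q0 γ) * ip (e0 u) (e0 u) + rp (-1) (q1 γ) * ip (e1 u) (e1 u))) γ γ
  rw [QQ, B1_eq γ h, B3_eq γ h, E1, E2, ← integral_add' i1 i2, ofReal_integral_eq_lintegral_ofReal (i1.add i2)]
  · have m1 := (kk γ).continuous.measurable
    have m2 := (kk γ * (rp (-1) (q0 γ) * ip (e0 u) (e0 u) + rp (-1) (q1 γ) * ip (e1 u) (e1 u))).continuous.measurable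
    have m3 := nn_meas h u; have m4 := nn_meas h γ
    refine strip_lint (JJ γ u) (JJ_meas h u) (JJ_per γ u) _ (by fun_prop) (fun x t ht h0 => ?_)
    have r1 := Rop_strip2 γ h u x ht h0
    have r2 := Rop_strip2 γ h γ x ht h0
    simp only [JJ, Ph, r1, r2, Pi.add_apply, BoundedContinuousFunction.mul_apply, BoundedContinuousFunction.add_apply, rp_apply _ h.p0, rp_apply _ h.p1, ip_apply, e0_apply, e1_apply, q0_apply, q1_apply,
        real_inner_self_eq_norm_sq, Real.rpow_neg_one, Du, norm_smul, norm_inv, norm_norm, mul_pow, inv_pow]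
    ring
  · refine ae_of_all _ fun p => ?_
    have k := kk_pos h p
    have a1 : 0 < (‖γ.dv p.1‖ ^ 2)⁻¹ := by have := h.dv0 p.1; positivity
    have a2 : 0 < (‖γ.dv (p.1 + p.2)‖ ^ 2)⁻¹ := by have := h.dv0 (p.1+p.2); positivity
    simp only [BoundedContinuousFunction.mul_apply, BoundedContinuousFunction.add_apply, rp_apply _ h.p0, rp_apply _ h.p1, ip_apply, e0_apply, e1_apply, q0_apply, q1_apply,
        real_inner_self_eq_norm_sq, Real.rpow_neg_one, Pi.zero_apply, Pi.add_apply]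
    positivity
lemma JJ_sym (h : IM γ) (u : Hs s n) :
    ∫⁻ x in I01, ∫⁻ y in I01, ENNReal.ofReal (32 * (JJ γ u x y + JJ γ u y x)) = ENNReal.ofReal (64 * QQ γ u) := by
  rw [sym_aux (JJ γ u) (JJ_meas h u) (JJ_nonneg γ u), JJ_lint h u, ENNReal.ofReal_mul (by norm_num)]
  congr 1
  rw [ENNReal.ofReal_ofNat]
lemma muW_nonneg (γ : ℝ → En n) (x y : ℝ) : 0 ≤ muW γ x y := by unfold muW; positivity
lemma B1_nonneg (γ u : ℝ → En n) : 0 ≤ B1 s γ u u :=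
  integral_nonneg fun x => integral_nonneg fun y => mul_nonneg real_inner_self_nonneg (muW_nonneg _ _ _)
lemma B2_nonneg (γ u : ℝ → En n) : 0 ≤ B2 s γ u u :=
  integral_nonneg fun x => integral_nonneg fun y => mul_nonneg (mul_nonneg (sq_nonneg _) (div_nonneg real_inner_self_nonneg (sq_nonneg _))) (muW_nonneg _ _ _)
lemma B3_nonneg (γ u : ℝ → En n) : 0 ≤ B3 s γ u u :=
  integral_nonneg fun x => integral_nonneg fun y => mul_nonneg (mul_nonneg (sq_nonneg _) (add_nonneg real_inner_self_nonneg real_inner_self_nonneg)) (muW_nonneg _ _ _)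
lemma H1_nonneg (γ u : ℝ → En n) : 0 ≤ innerH1g γ u u :=
  integral_nonneg fun x => mul_nonneg real_inner_self_nonneg (norm_nonneg _)
lemma L2_nonneg (γ u : ℝ → En n) : 0 ≤ innerL2g γ u u :=
  integral_nonneg fun x => mul_nonneg real_inner_self_nonneg (norm_nonneg _)
lemma EE_nonneg (γ : Hs s n) : 0 ≤ EE γ := B1_nonneg _ _
lemma QQ_nonneg (γ u : Hs s n) : 0 ≤ QQ γ u := add_nonneg (B1_nonneg _ _) (B3_nonneg _ _)
lemma GG_parts (h : IM γ) (u : Hs s n) : QQ γ u ≤ GG s n γ u u ∧ innerH1g γ.fn u.fn u.fn ≤ GG s n γ u u ∧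
    innerL2g γ.fn u.fn u.fn ≤ GG s n γ u u ∧ 0 ≤ GG s n γ u u := by
  have hs1 := hs.out.1
  have a1 := B1_nonneg (s := s) γ.fn u.fn
  have a2 := mul_nonneg (show 0 ≤ 2 * s + 1 by linarith) (B2_nonneg (s := s) γ.fn u.fn)
  have a3 := B3_nonneg (s := s) γ.fn u.fn
  have a4 := H1_nonneg γ.fn u.fn
  have a5 := L2_nonneg γ.fn u.fn
  rw [← GG_met h, Gmet, QQ]
  refine ⟨?_, ?_, ?_, ?_⟩ <;> linarith
lemma QQ_self (h : IM γ) : QQ γ γ = 3 * EE γ := by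
  have e : B3 s γ.fn γ.fn γ.fn = 2 * EE γ := by
    simp only [B3, EE, B1, ← integral_const_mul]
    refine integral_congr_ae (ae_of_all _ fun x => integral_congr_ae (ae_of_all _ fun y => ?_))
    have t : ∀ z, ⟪Dg γ.fn γ.fn z, Dg γ.fn γ.fn z⟫ = (1:ℝ) := fun z => by
      have := ta_norm h z
      rw [real_inner_self_eq_norm_sq, show Dg γ.fn γ.fn z = ta γ z from rfl, this]; norm_num
    simp only [t, real_inner_self_eq_norm_sq]; ring
  rw [QQ, e, EE]; ring
lemma Good.mor (h : IM γ) {a b : ℝ} (hab : a < b) (hg : Good γ a b) (u : Hs s n) :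
    ‖avg γ.ww (Du γ u) a b - Du γ u a‖ ≤ CM s * √(64 * QQ γ u) * om γ a b ^ (s - 3/2) ∧
    ‖avg γ.ww (Du γ u) a b - Du γ u b‖ ≤ CM s * √(64 * QQ γ u) * om γ a b ^ (s - 3/2) := by
  obtain ⟨c, hc, hw⟩ := ww_lb h
  have hs1 := hs.out.1
  refine morrey γ.ww_cont (Du_cont h u) hc hw (by linarith) hab (by have := QQ_nonneg γ u; positivity)
    (fun x hx y hy => hg.pt h u hx hy) (fun x y => by have := JJ_nonneg γ u x y; have := JJ_nonneg γ u y x; positivity) ?_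
  rw [← JJ_sym h u]
  refine dbl_le (F := fun x y => ENNReal.ofReal (32 * (JJ γ u x y + JJ γ u y x))) (fun x y => ?_) (fun y x => ?_) hg.1.le
  · have := JJ_per' γ u x y
    simp only [JJ_per γ u x y] at *; rw [this]
  · have := JJ_per' γ u y x
    simp only [JJ_per γ u y x] at *; rw [this]
lemma om_cont (γ : Hs s n) (x : ℝ) : Continuous (om γ x) :=
  intervalIntegral.continuous_primitive (fun a b => γ.ww_cont.intervalIntegrable a b) x
lemma exit (h : IM γ) (x : ℝ) : ∃ y, x < y ∧ Good γ x y ∧ ‖ta γ y - ta γ x‖ = 1/2 := by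
  have ct : Continuous fun z => ‖ta γ z - ta γ x‖ := ((Du_cont h γ).sub continuous_const).norm
  have h1 : ∃ z ∈ Icc x (x + 1), 1/2 ≤ ‖ta γ z - ta γ x‖ := by
    by_contra hc
    push Not at hc
    have e := inner_int h (ta γ x) x (x + 1)
    rw [fper, sub_self, inner_zero_right] at e
    have : 0 < ∫ z in x..(x+1), γ.ww z * ⟪ta γ x, ta γ z⟫ := by
      have c1 := γ.ww_cont; have c2 := Du_cont h γ
      refine intervalIntegral.intervalIntegral_pos_of_pos_on (Continuous.intervalIntegrable (by fun_prop) _ _) (fun z hz => ?_) (by linarith)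
      refine mul_pos (ww_pos h z) ?_
      have h2 := norm_sub_sq_real (ta γ z) (ta γ x)
      rw [ta_norm h, ta_norm h] at h2
      have := hc z ⟨hz.1.le, hz.2.le⟩
      have := norm_nonneg (ta γ z - ta γ x)
      rw [real_inner_comm]
      nlinarith
    linarith
  obtain ⟨z, hz, hz1⟩ := h1
  have iv : ∀ z ∈ Icc x (x + 1), 1/2 ≤ ‖ta γ z - ta γ x‖ → ∃ t ∈ Icc x z, ‖ta γ t - ta γ x‖ = 1/2 := fun z hz h1 => by
    have := intermediate_value_Icc hz.1 ct.continuousOn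
    exact this ⟨by simp, h1⟩
  have cS : IsCompact (Icc x (x + 1) ∩ {z | ‖ta γ z - ta γ x‖ = 1/2}) :=
    isCompact_Icc.inter_right (isClosed_eq ct continuous_const)
  obtain ⟨t, ht, ht1⟩ := iv z hz hz1
  obtain ⟨y, ⟨⟨hy1, hy2⟩, hy3⟩, hy4⟩ := cS.exists_isLeast ⟨t, ⟨ht.1, ht.2.trans hz.2⟩, ht1⟩
  have hxy : x ≠ y := by
    rintro rfl; simp at hy3
  have hxy1 : y ≠ x + 1 := by
    rintro rfl; simp [ta, Du_per γ γ x] at hy3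
  refine ⟨y, lt_of_le_of_ne hy1 hxy, ⟨lt_of_le_of_ne hy2 hxy1, fun z hz => ?_⟩, hy3⟩
  by_contra hc
  push Not at hc
  obtain ⟨t, ht, ht1⟩ := iv z ⟨hz.1, hz.2.trans hy2⟩ hc.le
  have h5 := hy4 ⟨⟨ht.1, ht.2.trans (hz.2.trans hy2)⟩, ht1⟩
  have : z = y := le_antisymm hz.2 (h5.trans ht.2)
  rw [this] at hc
  exact hc.ne' hy3
lemma Good.sub {a b c : ℝ} (hg : Good γ a b) (hc : c ≤ b) : Good γ a c :=
  ⟨hc.trans_lt hg.1, fun z hz => hg.2 z ⟨hz.1, hz.2.trans hc⟩⟩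
variable (s n) in
lemma ell (e : ℝ) : ∃ ℓ > 0, ∀ γ : Hs s n, IM γ → EE γ ≤ e → ∀ ρ, 0 < ρ → ρ ≤ ℓ → ∀ x, ∃ y, x < y ∧ Good γ x y ∧ om γ x y = ρ := by
  have hs1 := hs.out.1
  set A := 2 * CM s * √(192 * (|e| + 1)) with hA
  have A0 : 0 < A := by have := CM_pos (s := s); positivity
  have hl : 0 < (1 / (2 * A)) ^ (1 / (s - 3/2)) := by positivity
  refine ⟨_, hl, fun γ h hE ρ hρ hρl x => ?_⟩
  obtain ⟨y, hxy, hg, hy⟩ := exit h x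
  have hom := om_pos h hxy
  have hle : (1 / (2 * A)) ^ (1 / (s - 3/2)) ≤ om γ x y := by
    by_contra hc
    push Not at hc
    have h1 := Real.rpow_lt_rpow hom.le hc (show 0 < s - 3/2 by linarith)
    rw [← Real.rpow_mul (by positivity), one_div_mul_cancel (by linarith), Real.rpow_one] at h1
    obtain ⟨m1, m2⟩ := hg.mor h hxy γ
    have h2 : ‖ta γ y - ta γ x‖ ≤ A * om γ x y ^ (s - 3/2) := by
      have h3 := norm_sub_le (avg γ.ww (Du γ γ) x y - Du γ γ x) (avg γ.ww (Du γ γ) x y - Du γ γ y)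
      rw [sub_sub_sub_cancel_left] at h3
      have h4 : √(64 * QQ γ γ) ≤ √(192 * (|e| + 1)) := Real.sqrt_le_sqrt (by
        rw [QQ_self h]; have := le_abs_self e; linarith)
      have h5 : CM s * √(64 * QQ γ γ) * om γ x y ^ (s - 3/2) ≤ CM s * √(192 * (|e| + 1)) * om γ x y ^ (s - 3/2) := by
        have := CM_pos (s := s)
        gcongr
      rw [hA]
      linarith
    rw [hy] at h2
    have h3 : A * om γ x y ^ (s - 3/2) < A * (1 / (2 * A)) := mul_lt_mul_of_pos_left h1 A0
    rw [show A * (1 / (2 * A)) = 1/2 by field_simp] at h3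
    linarith
  obtain ⟨z, hz, hz1⟩ := intermediate_value_Icc hxy.le (om_cont γ x).continuousOn (show ρ ∈ Icc (om γ x x) (om γ x y) from
    ⟨by simp [om, hρ.le], hρl.trans hle⟩)
  refine ⟨z, lt_of_le_of_ne hz.1 ?_, hg.sub hz.2, hz1⟩
  rintro rfl
  simp [om] at hz1; linarith
variable (s n) in
lemma supD (e : ℝ) : ∃ C > 0, ∀ γ : Hs s n, IM γ → EE γ ≤ e → ∀ u x, ‖Du γ u x‖ ^ 2 ≤ C * GG s n γ u u := by
  obtain ⟨ℓ, hl, hℓ⟩ := ell s n e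
  have hC := CM_pos (s := s)
  refine ⟨2 * ℓ⁻¹ + 128 * (CM s * ℓ ^ (s - 3/2)) ^ 2, by positivity, fun γ h hE u x => ?_⟩
  obtain ⟨y, hxy, hg, hy⟩ := hℓ γ h hE ℓ hl le_rfl x
  obtain ⟨g1, g2, g3, g4⟩ := GG_parts h u
  have c1 := γ.ww_cont; have c2 := Du_cont h u
  have m1 := (hg.mor h hxy u).1
  rw [hy] at m1
  have m2 : ‖avg γ.ww (Du γ u) x y - Du γ u x‖ ^ 2 ≤ 64 * (CM s * ℓ ^ (s - 3/2)) ^ 2 * GG s n γ u u := by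
    refine (pow_le_pow_left₀ (norm_nonneg _) m1 2).trans ?_
    rw [mul_pow, mul_pow, Real.sq_sqrt (by have := QQ_nonneg γ u; positivity), mul_pow]
    have : CM s ^ 2 * (64 * QQ γ u) * (ℓ ^ (s - 3/2)) ^ 2 = 64 * (CM s ^ 2 * (ℓ ^ (s - 3/2)) ^ 2) * QQ γ u := by ring
    rw [this]
    exact mul_le_mul_of_nonneg_left g1 (by positivity)
  have m3 : ‖avg γ.ww (Du γ u) x y‖ ^ 2 ≤ ℓ⁻¹ * GG s n γ u u := by
    have h1 := avg_sq_le c1 c2 hxy.le (om_pos h hxy) (ww_pos h)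
    have h2 : ∫ t in x..y, γ.ww t * ‖Du γ u t‖ ^ 2 ≤ GG s n γ u u := by
      refine le_trans ?_ g2
      refine (per_int_le (by fun_prop) (fun t => mul_nonneg (ww_pos h t).le (sq_nonneg _)) (fun t => ?_) hxy.le hg.1.le).trans (le_of_eq ?_)
      · simp only [Du_per γ u t, γ.ww_per t]
      · refine integral_congr_ae (ae_of_all _ fun t => ?_)
        simp only [real_inner_self_eq_norm_sq]
        exact mul_comm _ _
    have h3 := h1.trans h2
    change om γ x y * _ ≤ _ at h3
    rw [hy] at h3
    rw [inv_mul_eq_div, le_div_iff₀ hl]; linarith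
  have m4 : ‖Du γ u x‖ ≤ ‖avg γ.ww (Du γ u) x y‖ + ‖avg γ.ww (Du γ u) x y - Du γ u x‖ := by
    have := norm_sub_le (avg γ.ww (Du γ u) x y) (avg γ.ww (Du γ u) x y - Du γ u x)
    rwa [sub_sub_cancel] at this
  have m5 := pow_le_pow_left₀ (norm_nonneg _) m4 2
  nlinarith [sq_nonneg (‖avg γ.ww (Du γ u) x y‖ - ‖avg γ.ww (Du γ u) x y - Du γ u x‖)]
end Hs
end
section
variable {s : ℝ} {n : ℕ}
namespace Hs
variable [hs : Fact (s ∈ Ioo (3/2:ℝ) 2)]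
variable {γ : Hs s n}
lemma om_le {C : ℝ} (hC : ∀ x, γ.ww x ≤ C) {x y : ℝ} (hxy : x ≤ y) : om γ x y ≤ C * (y - x) := by
  have := intervalIntegral.integral_mono_on hxy (γ.ww_cont.intervalIntegrable (μ := volume) x y) (continuous_const.intervalIntegrable (μ := volume) x y) (fun z _ => hC z)
  simpa [om, mul_comm] using this
lemma le_om {C : ℝ} (hC : ∀ x, C ≤ γ.ww x) {x y : ℝ} (hxy : x ≤ y) : C * (y - x) ≤ om γ x y := by
  have := intervalIntegral.integral_mono_on hxy (continuous_const.intervalIntegrable (μ := volume) x y) (γ.ww_cont.intervalIntegrable (μ := volume) x y) (fun z _ => hC z)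
  simpa [om, mul_comm] using this
lemma abs_om_le {C : ℝ} (h : IM γ) (hC : ∀ x, γ.ww x ≤ C) (x y : ℝ) : |om γ x y| ≤ C * |y - x| := by
  rcases le_total x y with h1 | h1
  · rw [abs_of_nonneg (om_nonneg h h1), abs_of_nonneg (sub_nonneg.2 h1)]; exact om_le hC h1
  · rw [om_symm γ y x, abs_neg, abs_of_nonneg (om_nonneg h h1), abs_sub_comm, abs_of_nonneg (sub_nonneg.2 h1)]; exact om_le hC h1
lemma le_abs_om {C : ℝ} (h : IM γ) (hC : ∀ x, C ≤ γ.ww x) (x y : ℝ) : C * |y - x| ≤ |om γ x y| := by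
  rcases le_total x y with h1 | h1
  · rw [abs_of_nonneg (om_nonneg h h1), abs_of_nonneg (sub_nonneg.2 h1)]; exact le_om hC h1
  · rw [om_symm γ y x, abs_neg, abs_of_nonneg (om_nonneg h h1), abs_sub_comm, abs_of_nonneg (sub_nonneg.2 h1)]; exact le_om hC h1
variable (s n) in
lemma near (e : ℝ) {C1 : ℝ} (hC1 : 0 < C1) : ∃ h0, 0 < h0 ∧ h0 ≤ 1/2 ∧ ∀ γ : Hs s n, IM γ → EE γ ≤ e → (∀ x, γ.ww x ≤ C1) →
    ∀ x h, |h| ≤ h0 → ∃ a b, Good γ a b ∧ x ∈ Icc a b ∧ x + h ∈ Icc a b := by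
  obtain ⟨ℓ, hl, hℓ⟩ := ell s n e
  refine ⟨min (ℓ / C1) (1/2), by positivity, min_le_right _ _, fun γ h hE hw => ?_⟩
  have key : ∀ x h, 0 ≤ h → h ≤ ℓ / C1 → ∃ b, Good γ x b ∧ x + h ∈ Icc x b := fun x t h0 ht => by
    obtain ⟨y, hxy, hg, hy⟩ := hℓ γ h hE ℓ hl le_rfl x
    refine ⟨y, hg, by linarith, ?_⟩
    by_contra hc
    push Not at hc
    have h1 := om_le hw hxy.le
    rw [hy] at h1
    rw [le_div_iff₀ hC1] at ht
    nlinarith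
  intro x t ht
  have ht1 := ht.trans (min_le_left _ _)
  rcases le_total 0 t with h0 | h0
  · rw [abs_of_nonneg h0] at ht1
    obtain ⟨b, hg, hb⟩ := key x t h0 ht1
    exact ⟨x, b, hg, ⟨le_rfl, hb.1.trans hb.2⟩, hb⟩
  · rw [abs_of_nonpos h0] at ht1
    obtain ⟨b, hg, hb⟩ := key (x + t) (-t) (by linarith) ht1
    rw [add_neg_cancel_right] at hb
    exact ⟨x + t, b, hg, hb, ⟨le_rfl, hb.1.trans hb.2⟩⟩
lemma dif_split (h : IM γ) {C1 M : ℝ} (hC1 : ∀ x, γ.ww x ≤ C1) (u : Hs s n) (hM : ∀ x, ‖Du γ u x‖ ^ 2 ≤ M) (p : ℝ × ℝ) :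
    ‖dif u.fn p‖ ^ 2 ≤ 2 * C1 ^ 2 * ‖Du γ u (p.1 + p.2) - Du γ u p.1‖ ^ 2 + 2 * M * ‖dif γ.fn p‖ ^ 2 := by
  have e : dif u.fn p = γ.ww (p.1 + p.2) • (Du γ u (p.1 + p.2) - Du γ u p.1) + (γ.ww (p.1 + p.2) - γ.ww p.1) • Du γ u p.1 := by
    rw [dif_eq, smul_sub, sub_smul, Du_ww h, Du_ww h]; abel
  have w0 := ww_pos h (p.1 + p.2)
  have h1 : ‖γ.ww (p.1 + p.2) • (Du γ u (p.1 + p.2) - Du γ u p.1)‖ ^ 2 ≤ C1 ^ 2 * ‖Du γ u (p.1 + p.2) - Du γ u p.1‖ ^ 2 := by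
    rw [norm_smul, mul_pow, Real.norm_of_nonneg w0.le]
    have := hC1 (p.1 + p.2)
    gcongr
  have h2 : ‖(γ.ww (p.1 + p.2) - γ.ww p.1) • Du γ u p.1‖ ^ 2 ≤ M * ‖dif γ.fn p‖ ^ 2 := by
    rw [norm_smul, mul_pow, mul_comm]
    refine mul_le_mul (hM _) (pow_le_pow_left₀ (norm_nonneg _) ?_ 2) (by positivity) ((sq_nonneg _).trans (hM 0))
    rw [dif_eq, ww, ww, Real.norm_eq_abs]
    exact abs_norm_sub_norm_le _ _
  have h3 := norm_add_le (γ.ww (p.1 + p.2) • (Du γ u (p.1 + p.2) - Du γ u p.1)) ((γ.ww (p.1 + p.2) - γ.ww p.1) • Du γ u p.1)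
  rw [← e] at h3
  have h4 := pow_le_pow_left₀ (norm_nonneg _) h3 2
  nlinarith [sq_nonneg (‖γ.ww (p.1 + p.2) • (Du γ u (p.1 + p.2) - Du γ u p.1)‖ - ‖(γ.ww (p.1 + p.2) - γ.ww p.1) • Du γ u p.1‖)]
lemma Du_dif (h : IM γ) {c1 C1 M h0 : ℝ} (hc1 : 0 < c1) (hh0 : 0 < h0) (hw : ∀ x, c1 ≤ γ.ww x) (hC1 : ∀ x, γ.ww x ≤ C1) (u : Hs s n) (hM : ∀ x, ‖Du γ u x‖ ^ 2 ≤ M)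
    (hn : ∀ x h, |h| ≤ h0 → ∃ a b, Good γ a b ∧ x ∈ Icc a b ∧ x + h ∈ Icc a b) (x t : ℝ) (ht : t ≠ 0) :
    |t| ^ (1 - 2 * s) * ‖Du γ u (x + t) - Du γ u x‖ ^ 2 ≤ C1 ^ (2 * s - 1) * (c1 ^ 2)⁻¹ * (32 * (JJ γ u x (x + t) + JJ γ u (x + t) x)) + 4 * h0 ^ (1 - 2 * s) * M := by
  have hs1 := hs.out.1
  have j1 := JJ_nonneg γ u x (x + t); have j2 := JJ_nonneg γ u (x + t) x
  have C0 : 0 < C1 := hc1.trans_le ((hw 0).trans (hC1 0))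
  have M0 : 0 ≤ M := (sq_nonneg _).trans (hM 0)
  have t0 : 0 < |t| := abs_pos.2 ht
  rcases le_total |t| h0 with h1 | h1
  · obtain ⟨a, b, hg, hx, hy⟩ := hn x t h1
    have h2 := hg.pt h u hx hy
    have h3 : |om γ x (x + t)| ^ (2 * (s - 3/2) + 2) ≤ C1 ^ (2 * s - 1) * |t| ^ (2 * s - 1) := by
      rw [← Real.mul_rpow C0.le t0.le, show 2 * (s - 3/2) + 2 = 2 * s - 1 by ring]
      refine Real.rpow_le_rpow (abs_nonneg _) ?_ (by linarith)
      have := abs_om_le h hC1 x (x + t)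
      rwa [add_sub_cancel_left] at this
    have h4 : c1 ^ 2 * ‖Du γ u (x + t) - Du γ u x‖ ^ 2 ≤ γ.ww x * γ.ww (x + t) * ‖Du γ u (x + t) - Du γ u x‖ ^ 2 := by
      refine mul_le_mul_of_nonneg_right ?_ (by positivity)
      rw [sq]; exact mul_le_mul (hw x) (hw _) hc1.le (ww_pos h x).le
    have h5 := mul_le_mul_of_nonneg_right h3 (show 0 ≤ 32 * (JJ γ u x (x + t) + JJ γ u (x + t) x) by positivity)
    have h6 : |t| ^ (1 - 2 * s) * |t| ^ (2 * s - 1) = 1 := by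
      rw [← Real.rpow_add t0, show 1 - 2 * s + (2 * s - 1) = 0 by ring, Real.rpow_zero]
    have h7 := mul_le_mul_of_nonneg_left (h4.trans (h2.trans h5)) (show 0 ≤ |t| ^ (1 - 2 * s) * (c1 ^ 2)⁻¹ by positivity)
    have h8 : 0 ≤ 4 * h0 ^ (1 - 2 * s) * M := by positivity
    calc _ = |t| ^ (1 - 2 * s) * (c1 ^ 2)⁻¹ * (c1 ^ 2 * ‖Du γ u (x + t) - Du γ u x‖ ^ 2) := by field_simp
      _ ≤ _ := h7
      _ = (|t| ^ (1 - 2 * s) * |t| ^ (2 * s - 1)) * (C1 ^ (2 * s - 1) * (c1 ^ 2)⁻¹ * (32 * (JJ γ u x (x + t) + JJ γ u (x + t) x))) := by ring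
      _ ≤ _ := by rw [h6, one_mul]; linarith
  · have h2 : |t| ^ (1 - 2 * s) ≤ h0 ^ (1 - 2 * s) := Real.rpow_le_rpow_of_nonpos hh0 h1 (by linarith)
    have h3 : ‖Du γ u (x + t) - Du γ u x‖ ^ 2 ≤ 4 * M := by
      have := pow_le_pow_left₀ (norm_nonneg _) (norm_sub_le (Du γ u (x + t)) (Du γ u x)) 2
      nlinarith [hM x, hM (x + t), sq_nonneg (‖Du γ u (x + t)‖ - ‖Du γ u x‖)]
    have h4 := mul_le_mul h2 h3 (by positivity) (by positivity)
    have h5 : 0 ≤ C1 ^ (2 * s - 1) * (c1 ^ 2)⁻¹ * (32 * (JJ γ u x (x + t) + JJ γ u (x + t) x)) := by positivity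
    linarith
lemma mu0_univ : mu0 univ = 1 := by
  rw [mu0, ← univ_prod_univ, Measure.prod_prod, Measure.restrict_apply_univ, Measure.restrict_apply_univ, I01, IH, Real.volume_Ico, Real.volume_Ico,
    ← ENNReal.ofReal_mul (by norm_num)]
  norm_num
lemma lint3 (f g : ℝ × ℝ → ℝ≥0∞) (hf : Measurable f) {A B C : ℝ} :
    ∫⁻ p, (ENNReal.ofReal A * f p + ENNReal.ofReal B) + ENNReal.ofReal C * g p ∂mu0 =
      (ENNReal.ofReal A * ∫⁻ p, f p ∂mu0) + ENNReal.ofReal B + ENNReal.ofReal C * ∫⁻ p, g p ∂mu0 := by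
  rw [lintegral_add_left (show Measurable fun p => ENNReal.ofReal A * f p + ENNReal.ofReal B from (hf.const_mul _).add measurable_const), lintegral_add_left (hf.const_mul _), lintegral_const_mul _ hf,
    lintegral_const_mul' _ _ ENNReal.ofReal_ne_top, lintegral_const, mu0_univ, mul_one]
lemma mJ_aux (F : ℝ → ℝ → ℝ) (hm : Measurable (Function.uncurry F)) : Measurable (Function.uncurry fun x y => ENNReal.ofReal (32 * (F x y + F y x))) :=
  ((hm.add (hm.comp measurable_swap)).const_mul 32).ennreal_ofReal
lemma mJ_aux' (F : ℝ → ℝ → ℝ) (hm : Measurable (Function.uncurry F)) : Measurable fun p : ℝ × ℝ => ENNReal.ofReal (32 * (F p.1 (p.1 + p.2) + F (p.1 + p.2) p.1)) :=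
  (mJ_aux F hm).comp (measurable_fst.prodMk (measurable_fst.add measurable_snd))
lemma dif_int_le (h : IM γ) {C1 M K1 K2 : ℝ} (hC1 : ∀ x, γ.ww x ≤ C1) (hK1 : 0 ≤ K1) (hK2 : 0 ≤ K2) (u : Hs s n) (hM : ∀ x, ‖Du γ u x‖ ^ 2 ≤ M)
    (hb : ∀ x t : ℝ, t ≠ 0 → |t| ^ (1 - 2 * s) * ‖Du γ u (x + t) - Du γ u x‖ ^ 2 ≤ K1 * (32 * (JJ γ u x (x + t) + JJ γ u (x + t) x)) + K2) :
    ∫ p, ‖dif u.fn p‖ ^ 2 ∂(muS s) ≤ 2 * C1 ^ 2 * (K1 * (64 * QQ γ u) + K2) + 2 * M * ‖γ‖ ^ 2 := by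
  have M0 : 0 ≤ M := (sq_nonneg _).trans (hM 0)
  have Q0 := QQ_nonneg γ u
  have cu := u.contd; have cg := γ.contd
  have md : ∀ v : Hs s n, Measurable fun p => ENNReal.ofReal (‖dif v.fn p‖ ^ 2) := fun v => by
    have cv := v.contd
    simp only [dif_eq]; exact (Continuous.measurable (by fun_prop)).ennreal_ofReal
  have mJ : Measurable (Function.uncurry fun x y => ENNReal.ofReal (32 * (JJ γ u x y + JJ γ u y x))) := mJ_aux _ (JJ_meas h u)
  have mJ' : Measurable fun p : ℝ × ℝ => ENNReal.ofReal (32 * (JJ γ u p.1 (p.1 + p.2) + JJ γ u (p.1 + p.2) p.1)) := mJ_aux' _ (JJ_meas h u)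
  rw [← ENNReal.ofReal_le_ofReal_iff (by positivity), ofReal_integral_eq_lintegral_ofReal u.intd2 (ae_of_all _ fun _ => by positivity),
    lint_muS _ (md u)]
  have hp : ∀ᵐ p ∂mu0, ENNReal.ofReal (|p.2| ^ (1 - 2 * s)) * ENNReal.ofReal (‖dif u.fn p‖ ^ 2) ≤
      (ENNReal.ofReal (2 * C1 ^ 2 * K1) * ENNReal.ofReal (32 * (JJ γ u p.1 (p.1 + p.2) + JJ γ u (p.1 + p.2) p.1)) + ENNReal.ofReal (2 * C1 ^ 2 * K2)) +
        ENNReal.ofReal (2 * M) * (ENNReal.ofReal (|p.2| ^ (1 - 2 * s)) * ENNReal.ofReal (‖dif γ.fn p‖ ^ 2)) := by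
    filter_upwards [ae_ne_zero_mu0] with p hp
    have h1 := dif_split h hC1 u hM p
    have h2 := hb p.1 p.2 hp.2
    have j1 := JJ_nonneg γ u p.1 (p.1 + p.2); have j2 := JJ_nonneg γ u (p.1 + p.2) p.1
    rw [← ENNReal.ofReal_mul (by positivity), ← ENNReal.ofReal_mul (by positivity), ← ENNReal.ofReal_mul (by positivity), ← ENNReal.ofReal_mul (by positivity),
      ← ENNReal.ofReal_add (by positivity) (by positivity), ← ENNReal.ofReal_add (by positivity) (by positivity)]
    refine ENNReal.ofReal_le_ofReal ?_
    have h3 := mul_le_mul_of_nonneg_left h1 (show 0 ≤ |p.2| ^ (1 - 2 * s) by positivity)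
    have h4 := mul_le_mul_of_nonneg_left h2 (show 0 ≤ 2 * C1 ^ 2 by positivity)
    linarith
  have eJ : ∫⁻ p, ENNReal.ofReal (32 * (JJ γ u p.1 (p.1 + p.2) + JJ γ u (p.1 + p.2) p.1)) ∂mu0 = ENNReal.ofReal (64 * QQ γ u) := by
    rw [← JJ_sym h u]
    refine (strip_lint0 (fun x y => ENNReal.ofReal (32 * (JJ γ u x y + JJ γ u y x))) mJ (fun x y => ?_)).symm
    have := JJ_per' γ u x y
    simp only [JJ_per γ u x y] at *; rw [this]
  have eG : ∫⁻ p, ENNReal.ofReal (|p.2| ^ (1 - 2 * s)) * ENNReal.ofReal (‖dif γ.fn p‖ ^ 2) ∂mu0 = ENNReal.ofReal (∫ p, ‖dif γ.fn p‖ ^ 2 ∂(muS s)) := by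
    rw [← lint_muS _ (md γ), ← ofReal_integral_eq_lintegral_ofReal γ.intd2 (ae_of_all _ fun _ => by positivity)]
  refine (lintegral_mono_ae hp).trans ?_
  rw [lint3 _ _ mJ', eJ, eG, ← ENNReal.ofReal_mul (by positivity), ← ENNReal.ofReal_mul (by positivity),
    ← ENNReal.ofReal_add (by positivity) (by positivity), ← ENNReal.ofReal_add (by positivity) (mul_nonneg (by positivity) (integral_nonneg fun _ => by positivity))]
  refine ENNReal.ofReal_le_ofReal ?_
  have := mul_le_mul_of_nonneg_left γ.dif_le (show 0 ≤ 2 * M by positivity)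
  linarith
variable (s n) in
lemma coer (e : ℝ) {c1 : ℝ} (C1 : ℝ) (hc1 : 0 < c1) : ∃ C > 0, ∀ γ : Hs s n, IM γ → EE γ ≤ e → (∀ x, c1 ≤ γ.ww x) → (∀ x, γ.ww x ≤ C1) →
    ∀ u, ‖u‖ ^ 2 ≤ C * (1 + ‖γ‖ ^ 2) * GG s n γ u u := by
  rcases le_or_gt C1 0 with hC | C0
  · exact ⟨1, one_pos, fun γ h hE hw hC1 => absurd ((hw 0).trans (hC1 0)) (by linarith)⟩
  obtain ⟨D, hD, hD1⟩ := supD s n e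
  obtain ⟨h0, hh0, -, hn⟩ := near s n e C0
  set K1 := C1 ^ (2 * s - 1) * (c1 ^ 2)⁻¹
  refine ⟨c1⁻¹ + C1 ^ 2 * D + 2 * C1 ^ 2 * (K1 * 64 + 4 * h0 ^ (1 - 2 * s) * D) + 2 * D, by positivity, fun γ h hE hw hC1 u => ?_⟩
  obtain ⟨g1, g2, g3, g4⟩ := GG_parts h u
  have k1 : ∫ x in I01, ‖u.fn x‖ ^ 2 ≤ c1⁻¹ * GG s n γ u u := by
    have : c1 * ∫ x in I01, ‖u.fn x‖ ^ 2 ≤ innerL2g γ.fn u.fn u.fn := by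
      rw [← integral_const_mul]
      have cu := u.cont; have cg := γ.contd
      refine integral_mono (intg (by fun_prop)) (intg (show Continuous fun x => ⟪u.fn x, u.fn x⟫ * ‖γ.dv x‖ by fun_prop)) fun x => ?_
      simp only [real_inner_self_eq_norm_sq]
      rw [mul_comm]
      exact mul_le_mul_of_nonneg_left (hw x) (by positivity)
    rw [inv_mul_eq_div, le_div_iff₀ hc1]; linarith
  have hM := hD1 γ h hE u
  have k2 : ∫ x in I01, ‖u.dv x‖ ^ 2 ≤ C1 ^ 2 * D * GG s n γ u u := by
    have cu := u.contd
    have : ∫ x in I01, ‖u.dv x‖ ^ 2 ≤ ∫ x in I01, C1 ^ 2 * D * GG s n γ u u := by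
      refine integral_mono (intg (by fun_prop)) (intg (by fun_prop)) fun x => ?_
      rw [← Du_ww h, norm_smul, mul_pow, Real.norm_of_nonneg (ww_pos h x).le, mul_assoc]
      exact mul_le_mul (pow_le_pow_left₀ (ww_pos h x).le (hC1 x) 2) (hM x) (by positivity) (by positivity)
    simpa [I01] using this
  have k3 := dif_int_le h (K1 := K1) (K2 := 4 * h0 ^ (1 - 2 * s) * (D * GG s n γ u u)) hC1 (by positivity) (by positivity) u hM
    (Du_dif h hc1 hh0 hw hC1 u hM (hn γ h hE hC1))
  have k4 := mul_le_mul_of_nonneg_left g1 (show 0 ≤ 2 * C1 ^ 2 * (K1 * 64) by positivity)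
  have k5 : 0 ≤ (c1⁻¹ + C1 ^ 2 * D + 2 * C1 ^ 2 * (K1 * 64 + 4 * h0 ^ (1 - 2 * s) * D)) * ‖γ‖ ^ 2 * GG s n γ u u := by positivity
  have k6 : 0 ≤ 2 * D * GG s n γ u u := by positivity
  rw [nsq]
  linarith
end Hs
end
lemma box_lint {w : ℝ → ℝ} (hw : Continuous w) (h0 : ∀ x, 0 ≤ w x) {K a b c d : ℝ} (hK : 0 ≤ K) (hab : a ≤ b) (hcd : c ≤ d) :
    ∫⁻ y in Ioc a b, ∫⁻ x in Ioc c d, ENNReal.ofReal (K * (w y * w x)) = ENNReal.ofReal (K * ((∫ t in a..b, w t) * ∫ t in c..d, w t)) := by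
  have k : ∀ {a b : ℝ}, a ≤ b → ∫⁻ x in Ioc a b, ENNReal.ofReal (w x) = ENNReal.ofReal (∫ t in a..b, w t) := fun {a b} hab => by
    rw [intervalIntegral.integral_of_le hab, ofReal_integral_eq_lintegral_ofReal ((hw.integrableOn_Icc).mono_set Ioc_subset_Icc_self) (ae_of_all _ h0)]
  have e : ∀ x y, ENNReal.ofReal (K * (w y * w x)) = (ENNReal.ofReal K * ENNReal.ofReal (w y)) * ENNReal.ofReal (w x) := fun x y => by
    rw [← mul_assoc, ENNReal.ofReal_mul (mul_nonneg hK (h0 y)), ENNReal.ofReal_mul hK]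
  have e2 : ∀ y, ∫⁻ x in Ioc c d, ENNReal.ofReal (K * (w y * w x)) = (ENNReal.ofReal K * ENNReal.ofReal (∫ t in c..d, w t)) * ENNReal.ofReal (w y) := fun y => by
    simp only [e]
    rw [lintegral_const_mul' _ _ (ENNReal.mul_ne_top ENNReal.ofReal_ne_top ENNReal.ofReal_ne_top), k hcd, mul_right_comm]
  rw [lintegral_congr e2, lintegral_const_mul' _ _ (ENNReal.mul_ne_top ENNReal.ofReal_ne_top ENNReal.ofReal_ne_top), k hab,
    ENNReal.ofReal_mul hK, ENNReal.ofReal_mul (intervalIntegral.integral_nonneg hab fun t _ => h0 t)]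
  ring
section
variable {s : ℝ} {n : ℕ}
namespace Hs
variable [hs : Fact (s ∈ Ioo (3/2:ℝ) 2)]
variable {γ : Hs s n}
lemma Ph_lint (h : IM γ) : ∫⁻ x in I01, ∫⁻ y in I01, ENNReal.ofReal (Ph γ γ x y) ≤ ENNReal.ofReal (3 * EE γ) := by
  rw [← QQ_self h, ← JJ_lint h γ]
  refine lintegral_mono fun x => lintegral_mono fun y => ENNReal.ofReal_le_ofReal ?_
  have := Ph_nonneg γ γ x y
  exact le_add_of_nonneg_right (by positivity)
lemma om_mono (h : IM γ) {a b c : ℝ} (h1 : a ≤ b) (h2 : b ≤ c) : om γ a b ≤ om γ a c := by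
  have := om_add γ a b c; have := om_nonneg h h2; linarith
lemma vec_far {E : Type*} [NormedAddCommGroup E] [InnerProductSpace ℝ E] {t t' Δ Δ' : E} {r : ℝ} (ht' : ‖t'‖ = 1)
    (htt : ‖t' - t‖ ≤ 1/2) (h0 : ⟪t, Δ⟫ = 0) (hr : ‖Δ‖ = r) (hd : ‖Δ' - Δ‖ ≤ r / 8) : r / 4 ≤ ‖Δ' - ⟪t', Δ'⟫ • t'‖ ∧ ‖Δ'‖ ≤ 2 * r ∧ 7 / 8 * r ≤ ‖Δ'‖ := by
  have r0 : 0 ≤ r := hr ▸ norm_nonneg _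
  have a1 : ‖Δ'‖ ≤ ‖Δ‖ + ‖Δ' - Δ‖ := norm_le_insert' _ _
  have a2 : ‖Δ‖ ≤ ‖Δ'‖ + ‖Δ' - Δ‖ := by rw [norm_sub_rev]; exact norm_le_insert' _ _
  have e : ⟪t', Δ'⟫ = ⟪t' - t, Δ⟫ + ⟪t', Δ' - Δ⟫ := by
    rw [inner_sub_left, inner_sub_right, h0]; ring
  have b1 := abs_real_inner_le_norm (t' - t) Δ
  have b2 := abs_real_inner_le_norm t' (Δ' - Δ)
  have b3 : |⟪t', Δ'⟫| ≤ 5 / 8 * r := by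
    rw [e]
    refine (abs_add_le _ _).trans ?_
    rw [hr] at b1; rw [ht'] at b2
    nlinarith
  have b4 := norm_sub_norm_le Δ' (⟪t', Δ'⟫ • t')
  rw [norm_smul, ht', mul_one, Real.norm_eq_abs] at b4
  refine ⟨by linarith, by linarith, by linarith⟩
variable (s n) in
lemma far (e : ℝ) : ∃ m > 0, ∀ γ : Hs s n, IM γ → EE γ ≤ e → ∀ x y, γ.fn x ≠ γ.fn y → ⟪ta γ y, γ.fn x - γ.fn y⟫ = 0 → m ≤ ‖γ.fn x - γ.fn y‖ := by
  obtain ⟨ℓ, hl, hℓ⟩ := ell s n e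
  have hs1 := hs.out.1; have hs2 := hs.out.2
  set A := 4096 * 2 ^ (2 * s + 1) * (3 * |e| + 1) with hA
  have A0 : 0 < A := by positivity
  refine ⟨min (16 * ℓ) ((1 / A) ^ (1 / (2 * s - 3))), by positivity, fun γ h hE x y hxy hin => ?_⟩
  set r := ‖γ.fn x - γ.fn y‖ with hr
  have r0 : 0 < r := norm_pos_iff.2 (sub_ne_zero.2 hxy)
  rcases le_total (16 * ℓ) r with h1 | h1
  · exact (min_le_left _ _).trans h1
  refine (min_le_right _ _).trans ?_
  obtain ⟨y1, hy1, gy, oy⟩ := hℓ γ h hE (r / 16) (by positivity) (by linarith) y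
  obtain ⟨x1, hx1, gx, ox⟩ := hℓ γ h hE (r / 16) (by positivity) (by linarith) x
  have pt : ∀ y' ∈ Ioc y y1, ∀ x' ∈ Ioc x x1, r ^ 2 / 16 * ((2 * r) ^ (2 * s + 1))⁻¹ * (γ.ww y' * γ.ww x') ≤ Ph γ γ y' x' := by
    intro y' hy' x' hx'
    have d : ‖(γ.fn x' - γ.fn y') - (γ.fn x - γ.fn y)‖ ≤ r / 8 := by
      have d1 := dist_le_om h x x'
      have d2 := dist_le_om h y y'
      rw [abs_of_nonneg (om_nonneg h hx'.1.le)] at d1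
      rw [abs_of_nonneg (om_nonneg h hy'.1.le)] at d2
      have d3 := om_mono h hx'.1.le hx'.2
      have d4 := om_mono h hy'.1.le hy'.2
      rw [show (γ.fn x' - γ.fn y') - (γ.fn x - γ.fn y) = (γ.fn x' - γ.fn x) - (γ.fn y' - γ.fn y) by abel]
      have := norm_sub_le (γ.fn x' - γ.fn x) (γ.fn y' - γ.fn y)
      linarith
    obtain ⟨v1, v2, v3⟩ := vec_far (ta_norm h y') (gy.2 y' ⟨hy'.1.le, hy'.2⟩) hin rfl d
    rw [← hr] at v1 v2 v3
    have n0 : 0 < ‖γ.fn x' - γ.fn y'‖ := by linarith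
    rw [Ph_eq γ γ y' x' (sub_ne_zero.1 (norm_pos_iff.1 n0))]
    have w1 := ww_pos h y'; have w2 := ww_pos h x'
    refine mul_le_mul_of_nonneg_right (mul_le_mul ?_ ?_ (by positivity) (by positivity)) (by positivity)
    · have := pow_le_pow_left₀ (by positivity) v1 2
      rw [num]; linarith
    · exact inv_anti₀ (by positivity) (Real.rpow_le_rpow n0.le v2 (by linarith))
  have I1 : ENNReal.ofReal (r ^ 2 / 16 * ((2 * r) ^ (2 * s + 1))⁻¹ * (om γ y y1 * om γ x x1)) ≤ ENNReal.ofReal (3 * EE γ) := by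
    rw [om, om, ← box_lint γ.ww_cont (fun x => (ww_pos h x).le) (by positivity) hy1.le hx1.le]
    refine le_trans ?_ ((dbl_le2 (F := fun x y => ENNReal.ofReal (Ph γ γ x y)) (fun x y => ?_) (fun y x => ?_) gy.1.le gx.1.le).trans (Ph_lint h))
    · refine setLIntegral_mono' measurableSet_Ioc fun y' hy' => setLIntegral_mono' measurableSet_Ioc fun x' hx' => ENNReal.ofReal_le_ofReal (pt y' hy' x' hx')
    · simp only [Ph_per γ γ x y]
    · have := Ph_per' γ γ y x
      simp only at *; rw [this]
  rw [ENNReal.ofReal_le_ofReal_iff (by have := EE_nonneg γ; positivity), oy, ox, Real.mul_rpow (by norm_num) r0.le] at I1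
  have e1 : r ^ (2 * s + 1) = r ^ (2 * s - 3) * r ^ 4 := by
    rw [← Real.rpow_natCast, ← Real.rpow_add r0]; congr 1; push_cast; ring
  rw [e1] at I1
  have p1 : 0 < r ^ (2 * s - 3) := by positivity
  have p2 : (0:ℝ) < 2 ^ (2 * s + 1) := by positivity
  have e2 : r ^ 2 / 16 * (2 ^ (2 * s + 1) * (r ^ (2 * s - 3) * r ^ 4))⁻¹ * (r / 16 * (r / 16)) = (4096 * 2 ^ (2 * s + 1) * r ^ (2 * s - 3))⁻¹ := by
    field_simp; norm_num
  rw [e2] at I1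
  have I2 : (4096 * 2 ^ (2 * s + 1) * r ^ (2 * s - 3))⁻¹ ≤ 3 * |e| + 1 := by have := le_abs_self e; linarith
  rw [inv_le_iff_one_le_mul₀ (by positivity)] at I2
  have I3 : 1 / A ≤ r ^ (2 * s - 3) := by
    rw [div_le_iff₀ A0, hA]; linarith
  have := Real.rpow_le_rpow (by positivity) I3 (show 0 ≤ 1 / (2 * s - 3) by apply one_div_nonneg.2; linarith)
  rwa [← Real.rpow_mul r0.le, mul_one_div_cancel (by linarith), Real.rpow_one] at this
variable (s n) in
lemma sep (e : ℝ) {c1 : ℝ} (C1 : ℝ) (hc1 : 0 < c1) : ∃ c > 0, ∀ γ : Hs s n, IM γ → EE γ ≤ e → (∀ x, c1 ≤ γ.ww x) → (∀ x, γ.ww x ≤ C1) →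
    ∀ x h, |h| ≤ 1/2 → c ≤ ‖γ.dlf (x, h)‖ := by
  rcases le_or_gt C1 0 with hC | C0
  · exact ⟨1, one_pos, fun γ h hE hw hC1 => absurd ((hw 0).trans (hC1 0)) (by linarith)⟩
  obtain ⟨m, hm, hm1⟩ := far s n e
  obtain ⟨h0, hh0, hh1, hn⟩ := near s n e C0
  refine ⟨min (c1 / 2) (min (c1 * h0 / 2) m), by positivity, fun γ h hE hw hC1 => ?_⟩
  have nr : ∀ x t, |t| ≤ h0 → c1 * |t| / 2 ≤ ‖γ.fn (x + t) - γ.fn x‖ := fun x t ht => by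
    obtain ⟨a, b, hg, hx, hy⟩ := hn γ h hE hC1 x t ht
    have h1 := hg.low h hx hx hy
    have h2 := le_abs_om h hw x (x + t)
    have h3 := abs_real_inner_le_norm (ta γ x) (γ.fn (x + t) - γ.fn x)
    rw [ta_norm h, one_mul] at h3
    rw [add_sub_cancel_left] at h2
    linarith
  have fr : ∀ x, ∀ t ∈ Icc h0 (1 - h0), min (c1 * h0 / 2) m ≤ ‖γ.fn (x + t) - γ.fn x‖ := by
    intro x
    have cf : Continuous fun t => ‖γ.fn (x + t) - γ.fn x‖ ^ 2 := by have := γ.cont; fun_prop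
    obtain ⟨t, ht, hmin⟩ := isCompact_Icc.exists_isMinOn (nonempty_Icc.2 (by linarith : h0 ≤ 1 - h0)) cf.continuousOn
    suffices H : min (c1 * h0 / 2) m ≤ ‖γ.fn (x + t) - γ.fn x‖ from fun t' ht' =>
      H.trans (le_of_sq_le_sq (hmin ht') (norm_nonneg _))
    rcases ht.1.eq_or_lt with e1 | e1
    · have := nr x t (by rw [abs_of_pos (by linarith)]; exact e1.symm.le)
      rw [← e1, abs_of_pos hh0] at this
      rw [← e1]
      exact (min_le_left _ _).trans this
    rcases ht.2.eq_or_lt with e2 | e2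
    · have := nr x (-h0) (by rw [abs_neg, abs_of_pos hh0])
      rw [abs_neg, abs_of_pos hh0, ← fper γ (x + -h0)] at this
      rw [e2, show x + (1 - h0) = x + -h0 + 1 by ring]
      exact (min_le_left _ _).trans this
    · have lm : IsLocalMin (fun t => ‖γ.fn (x + t) - γ.fn x‖ ^ 2) t := hmin.isLocalMin (Icc_mem_nhds e1 e2)
      have hd : HasDerivAt (fun t => ‖γ.fn (x + t) - γ.fn x‖ ^ 2) (2 * ⟪γ.fn (x + t) - γ.fn x, γ.dv (x + t)⟫) t := by
        have h1 : HasDerivAt (fun t => γ.fn (x + t) - γ.fn x) (γ.dv (x + t)) t := ((γ.hasd (x + t)).comp_const_add x t).sub_const _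
        exact h1.norm_sq
      have h0' := lm.hasDerivAt_eq_zero hd
      have hne : γ.fn (x + t) ≠ γ.fn x := IM_inj h (by linarith) (by linarith)
      have := hm1 γ h hE x (x + t) hne.symm (by
        rw [ta, Du, inner_smul_left, real_inner_comm, ← neg_sub, inner_neg_left]
        have : ⟪γ.fn (x + t) - γ.fn x, γ.dv (x + t)⟫ = 0 := by linarith
        rw [this]; simp)
      rw [norm_sub_rev] at this
      exact (min_le_right _ _).trans this
  intro x t ht
  rcases eq_or_ne t 0 with rfl | t0
  · rw [dlf_zero]
    exact (min_le_left _ _).trans ((by linarith : c1 / 2 ≤ c1).trans (hw x))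
  have tp : 0 < |t| := abs_pos.2 t0
  have e1 : ‖γ.fn (x + t) - γ.fn x‖ = |t| * ‖γ.dlf (x, t)‖ := by rw [← dlf_mul γ x ht, norm_smul, Real.norm_eq_abs]
  rcases le_total |t| h0 with h1 | h1
  · have := nr x t h1
    rw [e1] at this
    refine (min_le_left _ _).trans (le_of_mul_le_mul_left ?_ tp)
    linarith
  · refine (min_le_right _ _).trans ?_
    have h2 : min (c1 * h0 / 2) m ≤ ‖γ.fn (x + t) - γ.fn x‖ := by
      rcases le_total 0 t with h3 | h3
      · rw [abs_of_nonneg h3] at *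
        exact fr x t ⟨h1, by linarith⟩
      · rw [abs_of_nonpos h3] at *
        have := fr x (t + 1) ⟨by linarith, by linarith⟩
        rwa [← add_assoc, fper] at this
    rw [e1] at h2
    have := norm_nonneg (γ.dlf (x, t))
    nlinarith
end Hs
end
section
variable {E : Type*} [NormedAddCommGroup E] [InnerProductSpace ℝ E]
lemma proj_le (D v : E) (c : ℝ) : ‖D - ((‖v‖ ^ 2)⁻¹ * ⟪v, D⟫) • v‖ ^ 2 ≤ ‖D - c • v‖ ^ 2 := by
  rcases eq_or_ne v 0 with rfl | hv
  · simp
  have hp : 0 < ‖v‖ ^ 2 := by have := norm_pos_iff.2 hv; positivity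
  have k : ∀ c : ℝ, ‖D - c • v‖ ^ 2 = ‖D‖ ^ 2 - 2 * c * ⟪v, D⟫ + c ^ 2 * ‖v‖ ^ 2 := fun c => by
    rw [norm_sub_sq_real, inner_smul_right, norm_smul, mul_pow, Real.norm_eq_abs, sq_abs, real_inner_comm]; ring
  rw [k, k]
  set a := ‖v‖ ^ 2
  set b := ⟪v, D⟫
  have e : ‖D‖ ^ 2 - 2 * c * b + c ^ 2 * a - (‖D‖ ^ 2 - 2 * (a⁻¹ * b) * b + (a⁻¹ * b) ^ 2 * a) = a * (c - a⁻¹ * b) ^ 2 := by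
    field_simp; ring
  have : 0 ≤ a * (c - a⁻¹ * b) ^ 2 := by positivity
  linarith
lemma pw_d {a : E} (b : E) (ha : 0 < ‖a‖) (r : ℝ) :
    HasDerivAt (fun t : ℝ => (‖a + t • b‖ ^ 2) ^ r) ((‖a‖ ^ 2) ^ r * (2 * r * (⟪a, b⟫ / ‖a‖ ^ 2))) 0 := by
  have h1 : HasDerivAt (fun t : ℝ => a + t • b) b 0 := by
    simpa using ((hasDerivAt_id (0:ℝ)).smul_const b).const_add a
  have h2 := h1.norm_sq.rpow_const (p := r) (Or.inl (by rw [zero_smul, add_zero]; positivity))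
  convert h2 using 1
  simp only [zero_smul, add_zero]
  rw [Real.rpow_sub_one (by positivity)]; ring
lemma pw_b (a b : E) (ha : 0 < ‖a‖) : |2 * (⟪a, b⟫ / ‖a‖ ^ 2)| ≤ 1 + (‖a‖ ^ 2)⁻¹ * ‖b‖ ^ 2 := by
  rw [abs_mul, abs_div, abs_of_pos (by positivity : 0 < ‖a‖ ^ 2), abs_two]
  have h1 := abs_real_inner_le_norm a b
  have e : 1 + (‖a‖ ^ 2)⁻¹ * ‖b‖ ^ 2 = (‖a‖ ^ 2 + ‖b‖ ^ 2) / ‖a‖ ^ 2 := by field_simp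
  rw [e, ← mul_div_assoc]
  refine div_le_div_of_nonneg_right ?_ (by positivity)
  nlinarith [sq_nonneg (‖a‖ - ‖b‖)]
lemma pw3 {a0 a1 a2 b0 b1 b2 : E} (h0 : 0 < ‖a0‖) (h1 : 0 < ‖a1‖) (h2 : 0 < ‖a2‖) {s d : ℝ} (hs : 0 ≤ s + 1/2)
    (hd : HasDerivAt (fun t : ℝ => (‖a0 + t • b0‖ ^ 2) ^ (-s - 1/2) * ((‖a1 + t • b1‖ ^ 2) ^ (1/2:ℝ) * (‖a2 + t • b2‖ ^ 2) ^ (1/2:ℝ))) d 0) :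
    |d| ≤ (s + 3/2) * ((‖a0‖ ^ 2) ^ (-s - 1/2) * ((‖a1‖ ^ 2) ^ (1/2:ℝ) * (‖a2‖ ^ 2) ^ (1/2:ℝ))) +
      1/2 * ((‖a0‖ ^ 2) ^ (-s - 1/2) * ((‖a1‖ ^ 2) ^ (1/2:ℝ) * (‖a2‖ ^ 2) ^ (1/2:ℝ)) * ((2 * s + 1) * ((‖a0‖ ^ 2)⁻¹ * ‖b0‖ ^ 2) + ((‖a1‖ ^ 2)⁻¹ * ‖b1‖ ^ 2 + (‖a2‖ ^ 2)⁻¹ * ‖b2‖ ^ 2))) := by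
  have H := (pw_d b0 h0 (-s - 1/2)).mul ((pw_d b1 h1 (1/2)).mul (pw_d b2 h2 (1/2)))
  have e := hd.unique H
  simp only [zero_smul, add_zero, Pi.mul_apply] at e
  have c0 := pw_b a0 b0 h0; have c1 := pw_b a1 b1 h1; have c2 := pw_b a2 b2 h2
  set K0 := (‖a0‖ ^ 2) ^ (-s - 1/2)
  set K1 := (‖a1‖ ^ 2) ^ (1/2:ℝ)
  set K2 := (‖a2‖ ^ 2) ^ (1/2:ℝ)
  have k0 : 0 < K0 * (K1 * K2) := by positivity
  have e2 : d = K0 * (K1 * K2) * (-((s + 1/2) * (2 * (⟪a0, b0⟫ / ‖a0‖ ^ 2))) + 1/2 * (2 * (⟪a1, b1⟫ / ‖a1‖ ^ 2)) + 1/2 * (2 * (⟪a2, b2⟫ / ‖a2‖ ^ 2))) := by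
    rw [e]; ring
  have e3 : ∀ x y z : ℝ, |-((s + 1/2) * x) + 1/2 * y + 1/2 * z| ≤ (s + 1/2) * |x| + 1/2 * |y| + 1/2 * |z| := fun x y z => by
    refine (abs_add_le _ _).trans (add_le_add ((abs_add_le _ _).trans (add_le_add ?_ ?_)) ?_)
    · rw [abs_neg, abs_mul, abs_of_nonneg hs]
    · rw [abs_mul, abs_of_pos (by norm_num : (0:ℝ) < 1/2)]
    · rw [abs_mul, abs_of_pos (by norm_num : (0:ℝ) < 1/2)]
  rw [e2, abs_mul, abs_of_pos k0]
  refine (mul_le_mul_of_nonneg_left ((e3 _ _ _).trans (add_le_add (add_le_add (mul_le_mul_of_nonneg_left c0 hs) (mul_le_mul_of_nonneg_left c1 (by norm_num)))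
    (mul_le_mul_of_nonneg_left c2 (by norm_num)))) k0.le).trans (le_of_eq ?_)
  ring
lemma qf_d {B : Type*} [NormedAddCommGroup B] [NormedSpace ℝ B] (L : B →L[ℝ] E →L[ℝ] E) {k : ℝ → B} {k' : B} (hk : HasDerivAt k k' 0) (x y : E) :
    HasDerivAt (fun t : ℝ => ⟪L (k t) (x + t • y), x + t • y⟫) (⟪L k' x, x⟫ + ⟪L (k 0) y, x⟫ + ⟪L (k 0) x, y⟫) 0 := by
  have h1 : HasDerivAt (fun t : ℝ => x + t • y) y 0 := by
    simpa using ((hasDerivAt_id (0:ℝ)).smul_const y).const_add x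
  have h2 : HasDerivAt (fun t => L (k t)) (L k') 0 := L.hasFDerivAt.comp_hasDerivAt 0 hk
  have h3 := (h2.clm_apply h1).inner ℝ h1
  refine h3.congr_deriv ?_
  simp only [zero_smul, add_zero, inner_add_left]
  ring
end
section
variable {s : ℝ} {n : ℕ}
namespace Hs
variable [hs : Fact (s ∈ Ioo (3/2:ℝ) 2)]
variable {γ : Hs s n}
def Eh (γ : Hs s n) : ℝ := ⟪sc (kk γ) (NN γ γ), NN γ γ⟫
lemma EE_Eh (h : IM γ) : EE γ = Eh γ := B1_eq γ h γ γ
lemma Eh_cd (h : IM γ) : DifferentiableAt ℝ (Eh : Hs s n → ℝ) γ :=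
  (cda_in (m := 0) (cda_kk contDiffAt_id h) (cda_NN contDiffAt_id contDiffAt_id h) (cda_NN contDiffAt_id contDiffAt_id h)).differentiableAt (by norm_num)
lemma sc_mono (h : IM γ) {f g : BX ℝ} (hfg : ∀ p, f p ≤ g p) (u : Hs s n) : ⟪sc f (NN γ u), NN γ u⟫ ≤ ⟪sc g (NN γ u), NN γ u⟫ := by
  obtain ⟨i1, E1⟩ := NN_int h f u u
  obtain ⟨i2, E2⟩ := NN_int h g u u
  rw [E1, E2]
  exact integral_mono i1 i2 fun p => mul_le_mul_of_nonneg_right (hfg p) real_inner_self_nonneg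
lemma env (h : IM γ) {δ : Hs s n} (hδ : IM δ) : Eh δ ≤ ⟪sc (kk δ) (NN γ δ), NN γ δ⟫ := by
  obtain ⟨i1, E1⟩ := NN_int hδ (kk δ) δ δ
  obtain ⟨i2, E2⟩ := NN_int h (kk δ) δ δ
  rw [Eh, E1, E2]
  refine integral_mono i1 i2 fun p => mul_le_mul_of_nonneg_left ?_ (kk_pos hδ p).le
  rw [real_inner_self_eq_norm_sq, real_inner_self_eq_norm_sq]
  exact proj_le _ _ _
lemma line_d (γ u : Hs s n) : HasDerivAt (fun t : ℝ => γ + t • u) u 0 := by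
  simpa using ((hasDerivAt_id (0:ℝ)).smul_const u).const_add γ
lemma line_IM (h : IM γ) (u : Hs s n) : ∀ᶠ t in 𝓝 (0:ℝ), IM (γ + t • u) := by
  have c : Continuous fun t : ℝ => γ + t • u := by fun_prop
  exact c.continuousAt.preimage_mem_nhds (IM_open.mem_nhds (by simpa using h))
lemma kk_d (h : IM γ) (u : Hs s n) : ∃ k' : BX ℝ, HasDerivAt (fun t : ℝ => kk (γ + t • u)) k' 0 ∧
    ∀ p, |k' p| ≤ ((s + 3/2) • kk γ + (1/2 : ℝ) • WW γ u u) p := by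
  have hd : DifferentiableAt ℝ (kk : Hs s n → BX ℝ) γ := (cda_kk (m := 0) contDiffAt_id h).differentiableAt (by norm_num)
  have hd' : HasFDerivAt (kk : Hs s n → BX ℝ) (fderiv ℝ kk γ) (γ + (0:ℝ) • u) := by
    rw [zero_smul, add_zero]; exact hd.hasFDerivAt
  have hk := hd'.comp_hasDerivAt (0:ℝ) (line_d γ u)
  refine ⟨_, hk, fun p => ?_⟩
  have h1 : HasDerivAt (fun t : ℝ => kk (γ + t • u) p) (fderiv ℝ kk γ u p) 0 :=
    (BoundedContinuousFunction.evalCLM ℝ p : BX ℝ →L[ℝ] ℝ).hasFDerivAt.comp_hasDerivAt (0:ℝ) hk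
  have h2 : HasDerivAt (fun t : ℝ => (‖γ.dlf p + t • u.dlf p‖ ^ 2) ^ (-s - 1/2) * ((‖γ.dv p.1 + t • u.dv p.1‖ ^ 2) ^ (1/2:ℝ) * (‖γ.dv (p.1 + p.2) + t • u.dv (p.1 + p.2)‖ ^ 2) ^ (1/2:ℝ))) (fderiv ℝ kk γ u p) 0 := by
    refine h1.congr_of_eventuallyEq ?_
    filter_upwards [line_IM h u] with t ht
    rw [kk, BoundedContinuousFunction.mul_apply, BoundedContinuousFunction.mul_apply, rp_apply _ ht, rp_apply _ ht.p0, rp_apply _ ht.p1, qd_apply, q0_apply, q1_apply]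
    simp only [dlf_add, dlf_smul, dv_add, dv_smul, Pi.add_apply, Pi.smul_apply]
  have hs1 := hs.out.1
  have h3 := pw3 (h.dl0 p) (h.dv0 p.1) (h.dv0 (p.1 + p.2)) (by linarith) h2
  refine h3.trans (le_of_eq ?_)
  simp only [WW, kk, BoundedContinuousFunction.mul_apply, BoundedContinuousFunction.add_apply, BoundedContinuousFunction.smul_apply, smul_eq_mul,
    rp_apply _ h, rp_apply _ h.p0, rp_apply _ h.p1, qd_apply, q0_apply, q1_apply, ip_self, dl_apply, e0_apply, e1_apply, Real.rpow_neg_one]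
lemma Eh_bd (h : IM γ) (u : Hs s n) : |fderiv ℝ Eh γ u| ≤ 5 * (EE γ + GG s n γ u u) := by
  obtain ⟨k', hk, hb⟩ := kk_d h u
  have hs1 := hs.out.1; have hs2 := hs.out.2
  have d1 : HasDerivAt (fun t : ℝ => Eh (γ + t • u)) (fderiv ℝ Eh γ u) 0 := by
    have hd' : HasFDerivAt (Eh : Hs s n → ℝ) (fderiv ℝ Eh γ) (γ + (0:ℝ) • u) := by
      rw [zero_smul, add_zero]; exact (Eh_cd h).hasFDerivAt
    exact hd'.comp_hasDerivAt (0:ℝ) (line_d γ u)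
  have d2 := qf_d sc hk (NN γ γ) (NN γ u)
  have mn : IsLocalMin (fun t : ℝ => ⟪sc (kk (γ + t • u)) (NN γ γ + t • NN γ u), NN γ γ + t • NN γ u⟫ - Eh (γ + t • u)) 0 := by
    filter_upwards [line_IM h u] with t ht
    have := env h ht
    rw [NN_add, NN_smul] at this
    simp only [zero_smul, add_zero]
    rw [show ⟪sc (kk γ) (NN γ γ), NN γ γ⟫ = Eh γ from rfl]
    linarith
  have e := mn.hasDerivAt_eq_zero (d2.sub d1)
  rw [zero_smul, add_zero] at e
  have E0 := EE_Eh h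
  have b1 : |⟪sc k' (NN γ γ), NN γ γ⟫| ≤ (s + 3/2) * EE γ + 1/2 * ((2 * s + 1) * B2 s γ.fn u.fn u.fn + B3 s γ.fn u.fn u.fn) := by
    have e1 : ⟪sc ((s + 3/2) • kk γ + (1/2 : ℝ) • WW γ u u) (NN γ γ), NN γ γ⟫ = (s + 3/2) * EE γ + 1/2 * ((2 * s + 1) * B2 s γ.fn u.fn u.fn + B3 s γ.fn u.fn u.fn) := by
      rw [inner_WW γ h, map_add, add_apply, inner_add_left, map_smul, map_smul, smul_apply, smul_apply, real_inner_smul_left, real_inner_smul_left, E0, Eh]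
    rw [← e1]
    refine abs_le.2 ⟨?_, sc_mono h (fun p => (le_abs_self _).trans (hb p)) γ⟩
    have := sc_mono h (f := -k') (fun p => (neg_le_abs _).trans (hb p)) γ
    rw [map_neg, neg_apply, inner_neg_left] at this
    linarith
  have c1 : ⟪sc (kk γ) (NN γ γ), NN γ u⟫ = ⟪sc (kk γ) (NN γ u), NN γ γ⟫ := by
    rw [(NN_int h _ _ _).2, (NN_int h _ _ _).2]; simp only [real_inner_comm]
  have p1 : 0 ≤ B1 s γ.fn u.fn u.fn + EE γ + 2 * ⟪sc (kk γ) (NN γ u), NN γ γ⟫ := by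
    have := B1_nonneg (s := s) γ.fn (γ + u).fn
    rw [B1_eq γ h, NN_add, map_add, inner_add_left, inner_add_right, inner_add_right, ← B1_eq γ h u u, c1] at this
    rw [E0, Eh]; linarith
  have p2 : 0 ≤ B1 s γ.fn u.fn u.fn + EE γ - 2 * ⟪sc (kk γ) (NN γ u), NN γ γ⟫ := by
    have := B1_nonneg (s := s) γ.fn (γ + (-1:ℝ) • u).fn
    rw [B1_eq γ h, NN_add, NN_smul, map_add, map_smul, inner_add_left, inner_add_right, inner_add_right, real_inner_smul_left, real_inner_smul_left, real_inner_smul_right,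
      real_inner_smul_right, ← B1_eq γ h u u, c1] at this
    rw [E0, Eh]; linarith
  have g : 2 * B1 s γ.fn u.fn u.fn + ((2 * s + 1) * B2 s γ.fn u.fn u.fn + B3 s γ.fn u.fn u.fn) ≤ GG s n γ u u := by
    rw [← GG_met h, Gmet]
    have a4 := H1_nonneg γ.fn u.fn
    have a5 := L2_nonneg γ.fn u.fn
    linarith
  have g0 := (GG_parts h u).2.2.2
  have ee := EE_nonneg γ
  have e' : fderiv ℝ Eh γ u = ⟪sc k' (NN γ γ), NN γ γ⟫ + 2 * ⟪sc (kk γ) (NN γ u), NN γ γ⟫ := by linarith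
  rw [e']
  have sE : s * EE γ ≤ 2 * EE γ := mul_le_mul_of_nonneg_right hs2.le ee
  obtain ⟨x1, x2⟩ := abs_le.1 b1
  refine abs_le.2 ⟨?_, ?_⟩ <;> linarith
end Hs
end
section
variable {E : Type*} [NormedAddCommGroup E] [NormedSpace ℝ E]
structure Sol (U : Set E) (F : E → E) (z : ℝ → E) (T : ℝ) : Prop where
  c : ContinuousOn z (Ico 0 T)
  u : ∀ t ∈ Ico 0 T, z t ∈ U
  d : ∀ t ∈ Ico 0 T, HasDerivWithinAt z (F (z t)) (Ici t) t
variable {U : Set E} {F : E → E}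
lemma Sol.mono {z : ℝ → E} {T T' : ℝ} (h : Sol U F z T) (hT : T' ≤ T) : Sol U F z T' :=
  ⟨h.c.mono (Ico_subset_Ico_right hT), fun t ht => h.u t (Ico_subset_Ico_right hT ht), fun t ht => h.d t (Ico_subset_Ico_right hT ht)⟩
lemma Sol.uniq (hF : ∀ x ∈ U, ContDiffAt ℝ 1 F x) {z y : ℝ → E} {T : ℝ} (hz : Sol U F z T) (hy : Sol U F y T) (h0 : z 0 = y 0) :
    ∀ t ∈ Ico 0 T, z t = y t := by
  intro t1 ht1
  have sub : Icc 0 t1 ⊆ Ico 0 T := fun t ht => ⟨ht.1, ht.2.trans_lt ht1.2⟩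
  have key : Icc 0 t1 ⊆ {t | z t = y t} := by
    refine IsClosed.Icc_subset_of_forall_exists_gt ?_ h0 ?_
    · have : IsClosed {t | t ∈ Icc 0 t1 ∧ z t = y t} := isClosed_Icc.isClosed_eq (hz.c.mono sub) (hy.c.mono sub)
      rw [inter_comm]; exact this
    · rintro x ⟨hx, hx0, hx1⟩ b hb
      have hxT : x ∈ Ico 0 T := ⟨hx0, hx1.trans ht1.2⟩
      obtain ⟨K, N, hN, hL⟩ := (hF _ (hz.u x hxT)).exists_lipschitzOnWith
      have nz : ∀ᶠ t in 𝓝[Ico 0 T] x, z t ∈ N := (hz.c x hxT) hN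
      have ny : ∀ᶠ t in 𝓝[Ico 0 T] x, y t ∈ N := (hy.c x hxT) (by rw [← hx.out]; exact hN)
      have nn := (nz.and ny)
      rw [eventually_nhdsWithin_iff, Metric.eventually_nhds_iff] at nn
      obtain ⟨δ, hδ, H⟩ := nn
      set m := min (min (x + δ / 2) b) t1
      have hm : x < m := lt_min (lt_min (by linarith) hb) hx1
      have m1 : m ≤ x + δ / 2 := (min_le_left _ _).trans (min_le_left _ _)
      have m2 : m ≤ b := (min_le_left _ _).trans (min_le_right _ _)
      have m3 : m ≤ t1 := min_le_right _ _
      have sb : Icc x m ⊆ Ico 0 T := fun t ht => ⟨hx0.trans ht.1, (ht.2.trans m3).trans_lt ht1.2⟩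
      have HH : ∀ t ∈ Icc x m, z t ∈ N ∧ y t ∈ N := fun t ht => H (by rw [Real.dist_eq, abs_of_nonneg (by linarith [ht.1])]; linarith [ht.2]) (sb ht)
      have := ODE_solution_unique_of_mem_Icc_right (v := fun _ => F) (s := fun _ => N) (K := K) (fun t _ => hL) (hz.c.mono sb)
        (fun t ht => hz.d t (sb (Ico_subset_Icc_self ht))) (fun t ht => (HH t (Ico_subset_Icc_self ht)).1)
        (hy.c.mono sb) (fun t ht => hy.d t (sb (Ico_subset_Icc_self ht))) (fun t ht => (HH t (Ico_subset_Icc_self ht)).2) hx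
      exact ⟨m, this (right_mem_Icc.2 hm.le), hm, m2⟩
  exact key (right_mem_Icc.2 ht1.1)
lemma Sol.congr {z y : ℝ → E} {T : ℝ} (hz : Sol U F z T) (h : ∀ t ∈ Ico 0 T, y t = z t) : Sol U F y T := by
  refine ⟨hz.c.congr h, fun t ht => by rw [h t ht]; exact hz.u t ht, fun t ht => ?_⟩
  rw [h t ht]
  refine (hz.d t ht).congr_of_eventuallyEq ?_ (h t ht)
  filter_upwards [Ico_mem_nhdsGE ht.2] with τ hτ
  exact h τ ⟨ht.1.trans hτ.1, hτ.2⟩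
lemma Sol.glue {z y : ℝ → E} {T T' : ℝ} (hT : 0 < T) (hz : Sol U F z T) (hl : Tendsto z (𝓝[<] T) (𝓝 (y T)))
    (hc : ContinuousOn y (Ico T T')) (hu : ∀ t ∈ Ico T T', y t ∈ U) (hd : ∀ t ∈ Ico T T', HasDerivWithinAt y (F (y t)) (Ici t) t) :
    Sol U F (fun t => if t < T then z t else y t) T' := by
  have ge : ∀ t, T ≤ t → (fun t => if t < T then z t else y t) t = y t := fun t ht => if_neg (not_lt.2 ht)
  have lt : ∀ t, t < T → (fun t => if t < T then z t else y t) t = z t := fun t ht => if_pos ht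
  set w := (fun t => if t < T then z t else y t)
  have d : ∀ t ∈ Ico 0 T', HasDerivWithinAt w (F (w t)) (Ici t) t := by
    intro t ht
    rcases lt_or_ge t T with h | h
    · rw [lt t h]
      refine (hz.d t ⟨ht.1, h⟩).congr_of_eventuallyEq ?_ (lt t h)
      filter_upwards [Ico_mem_nhdsGE h] with τ hτ
      exact lt τ hτ.2
    · rw [ge t h]
      exact (hd t ⟨h, ht.2⟩).congr (fun τ hτ => ge τ (h.trans hτ)) (ge t h)
  refine ⟨fun t ht => ?_, fun t ht => ?_, d⟩
  · rcases lt_trichotomy t T with h | h | h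
    · have c1 := hz.c t ⟨ht.1, h⟩
      have c2 : ContinuousWithinAt w (Ico 0 T) t := c1.congr (fun τ hτ => lt τ hτ.2) (lt t h)
      refine c2.mono_of_mem_nhdsWithin ?_
      have : Iio T ∈ 𝓝[Ico 0 T'] t := mem_nhdsWithin_of_mem_nhds (Iio_mem_nhds h)
      filter_upwards [this, self_mem_nhdsWithin] with τ h1 h2 using ⟨h2.1, h1⟩
    · subst h
      have c1 : ContinuousWithinAt w (Ici t) t := (d t ht).continuousWithinAt
      have c2 : ContinuousWithinAt w (Iio t) t := by
        rw [ContinuousWithinAt, ge t le_rfl]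
        refine hl.congr' ?_
        filter_upwards [self_mem_nhdsWithin] with τ hτ using (lt τ hτ).symm
      exact (c2.union c1).mono fun τ _ => lt_or_ge τ t
    · have c1 := hc t ⟨h.le, ht.2⟩
      have c2 : ContinuousWithinAt w (Ico T T') t := c1.congr (fun τ hτ => ge τ hτ.1) (ge t h.le)
      refine c2.mono_of_mem_nhdsWithin ?_
      have : Ioi T ∈ 𝓝[Ico 0 T'] t := mem_nhdsWithin_of_mem_nhds (Ioi_mem_nhds h)
      filter_upwards [this, self_mem_nhdsWithin] with τ h1 h2 using ⟨le_of_lt h1, h2.2⟩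
  · rcases lt_or_ge t T with h | h
    · rw [lt t h]; exact hz.u t ⟨ht.1, h⟩
    · rw [ge t h]; exact hu t ⟨h, ht.2⟩
lemma sol_loc [CompleteSpace E] (hU : IsOpen U) (hF : ∀ x ∈ U, ContDiffAt ℝ 1 F x) {x : E} (hx : x ∈ U) (T : ℝ) :
    ∃ y : ℝ → E, y T = x ∧ ∃ T' > T, ContinuousOn y (Ico T T') ∧ (∀ t ∈ Ico T T', y t ∈ U) ∧ ∀ t ∈ Ico T T', HasDerivWithinAt y (F (y t)) (Ici t) t := by
  obtain ⟨y, hy, ε, hε, H⟩ := (hF x hx).exists_forall_mem_closedBall_exists_eq_forall_mem_Ioo_hasDerivAt₀ T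
  have cT : ContinuousAt y T := (H T ⟨by linarith, by linarith⟩).continuousAt
  have ev : ∀ᶠ t in 𝓝 T, y t ∈ U := cT (hU.mem_nhds (by rw [hy]; exact hx))
  obtain ⟨δ, hδ, h2⟩ := Metric.eventually_nhds_iff.1 ev
  have A : ∀ t ∈ Ico T (T + min ε δ), t ∈ Ioo (T - ε) (T + ε) := fun t ht => ⟨by linarith [ht.1], by linarith [ht.2, min_le_left ε δ]⟩
  refine ⟨y, hy, T + min ε δ, by linarith [lt_min hε hδ], fun t ht => (H t (A t ht)).continuousAt.continuousWithinAt, fun t ht => h2 ?_,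
    fun t ht => (H t (A t ht)).hasDerivWithinAt⟩
  rw [Real.dist_eq, abs_of_nonneg (by linarith [ht.1])]
  linarith [ht.2, min_le_right ε δ]
lemma sol_glob [CompleteSpace E] (hU : IsOpen U) (hF : ∀ x ∈ U, ContDiffAt ℝ 1 F x) {x : E} (hx : x ∈ U)
    (H : ∀ T > 0, ∀ z, Sol U F z T → ∃ L ∈ U, Tendsto z (𝓝[<] T) (𝓝 L)) :
    ∃ z : ℝ → E, z 0 = x ∧ ∀ T, Sol U F z T := by
  let P : ℝ → Prop := fun T => ∃ z : ℝ → E, z 0 = x ∧ Sol U F z T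
  have ch : ∀ S : Set ℝ, (∀ t ∈ S, 0 ≤ t → ∃ T > t, P T) → ∃ z : ℝ → E, ∀ t ∈ S, 0 ≤ t → ∃ T > t, ∃ y, y 0 = x ∧ Sol U F y T ∧ z t = y t := by
    intro S hS
    choose! T hT y hy hs using hS
    exact ⟨fun t => y t t, fun t ht h0 => ⟨T t, hT t ht h0, y t, hy t ht h0, hs t ht h0, rfl⟩⟩
  have un : ∀ {T T' : ℝ} {y y' : ℝ → E}, y 0 = x → y' 0 = x → Sol U F y T → Sol U F y' T' → ∀ t, 0 ≤ t → t < T → t < T' → y t = y' t := by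
    intro T T' y y' h h' hs hs' t h0 h1 h2
    exact (hs.mono (min_le_left T T')).uniq hF (hs'.mono (min_le_right _ _)) (h.trans h'.symm) t ⟨h0, lt_min h1 h2⟩
  have cons : ∀ T, 0 < T → (∀ t < T, 0 ≤ t → ∃ T > t, P T) → P T := by
    intro T hT hP
    obtain ⟨z, hz⟩ := ch (Iio T) (fun t ht h0 => hP t ht h0)
    have loc : ∀ t < T, 0 ≤ t → ∃ T₁ > t, Sol U F z T₁ := by
      intro t ht h0
      obtain ⟨T₁, h1, y, hy0, hy, e⟩ := hz t ht h0
      refine ⟨min T₁ T, lt_min h1 ht, (hy.mono (min_le_left _ _)).congr fun τ hτ => ?_⟩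
      obtain ⟨T₂, h1', y', hy0', hy', e'⟩ := hz τ (hτ.2.trans_le (min_le_right _ _)) hτ.1
      rw [e']
      exact un hy0' hy0 hy' hy τ hτ.1 h1' (hτ.2.trans_le (min_le_left _ _))
    refine ⟨z, ?_, fun t ht => ?_, fun t ht => ?_, fun t ht => ?_⟩
    · obtain ⟨T₁, h1, y, hy0, hy, e⟩ := hz 0 hT le_rfl
      rw [e, hy0]
    all_goals obtain ⟨T₁, h1, hs⟩ := loc t ht.2 ht.1
    · refine (hs.c t ⟨ht.1, h1⟩).mono_of_mem_nhdsWithin ?_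
      have : Iio T₁ ∈ 𝓝[Ico 0 T] t := mem_nhdsWithin_of_mem_nhds (Iio_mem_nhds h1)
      filter_upwards [this, self_mem_nhdsWithin] with τ h1 h2 using ⟨h2.1, h1⟩
    · exact hs.u t ⟨ht.1, h1⟩
    · exact hs.d t ⟨ht.1, h1⟩
  have ext : ∀ T, 0 < T → P T → ∃ T' > T, P T' := by
    rintro T hT ⟨z, hz0, hz⟩
    obtain ⟨L, hL, hl⟩ := H T hT z hz
    obtain ⟨y, hy, T', hT', a, b, c⟩ := sol_loc hU hF hL T
    exact ⟨T', hT', _, by simp [hT, hz0], hz.glue hT (by rw [hy]; exact hl) a b c⟩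
  have P0 : ∃ T > 0, P T := by
    obtain ⟨y, hy, T', hT', a, b, c⟩ := sol_loc hU hF hx 0
    exact ⟨T', hT', y, hy, a, b, c⟩
  have all : ∀ t, 0 ≤ t → ∃ T > t, P T := by
    by_contra! hcon
    obtain ⟨t, h0, ht⟩ := hcon
    obtain ⟨T0, hT0, hP0⟩ := P0
    set S := {T | P T}
    have bdd : BddAbove S := ⟨t, fun T hT => not_lt.1 fun h => ht T h hT⟩
    have pos : 0 < sSup S := hT0.trans_le (le_csSup bdd hP0)
    have := cons (sSup S) pos fun τ hτ _ => by
      obtain ⟨T, hT, h⟩ := exists_lt_of_lt_csSup ⟨T0, hP0⟩ hτ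
      exact ⟨T, h, hT⟩
    obtain ⟨T', h1, h2⟩ := ext _ pos this
    exact absurd (le_csSup bdd h2) (not_le.2 h1)
  have PP : ∀ T, 0 < T → P T := fun T hT => cons T hT fun t _ h0 => all t h0
  obtain ⟨z, hz⟩ := ch univ (fun t _ h0 => all t h0)
  refine ⟨z, ?_, fun T => ?_⟩
  · obtain ⟨T₁, h1, y, hy0, hy, e⟩ := hz 0 trivial le_rfl
    rw [e, hy0]
  · rcases le_or_gt T 0 with h | h
    · have : Ico 0 T = ∅ := Ico_eq_empty (not_lt.2 h)
      refine ⟨by rw [this]; exact continuousOn_empty _, fun t ht => ?_, fun t ht => ?_⟩ <;> (rw [this] at ht; exact absurd ht (notMem_empty t))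
    · obtain ⟨y, hy0, hy⟩ := PP T h
      refine hy.congr fun t ht => ?_
      obtain ⟨T₁, h1, y', hy0', hy', e⟩ := hz t trivial ht.1
      rw [e]; exact un hy0' hy0 hy' hy t ht.1 h1 ht.2
lemma lim_of_bd [CompleteSpace E] {f f' : ℝ → E} {a T C : ℝ} (ha : a < T) (hc : ContinuousOn f (Ico a T)) (hd : ∀ t ∈ Ico a T, HasDerivWithinAt f (f' t) (Ici t) t)
    (hb : ∀ t ∈ Ico a T, ‖f' t‖ ≤ C) : ∃ L, Tendsto f (𝓝[<] T) (𝓝 L) := by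
  have C0 : 0 ≤ C := (norm_nonneg _).trans (hb a ⟨le_rfl, ha⟩)
  have lip : ∀ x ∈ Ico a T, ∀ y ∈ Ico a T, x ≤ y → ‖f y - f x‖ ≤ C * (y - x) := fun x hx y hy hxy => by
    have sb : Icc x y ⊆ Ico a T := fun t ht => ⟨hx.1.trans ht.1, ht.2.trans_lt hy.2⟩
    exact norm_image_sub_le_of_norm_deriv_right_le_segment (hc.mono sb) (fun t ht => hd t (sb (Ico_subset_Icc_self ht)))
      (fun t ht => hb t (sb (Ico_subset_Icc_self ht))) y (right_mem_Icc.2 hxy)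
  have hL : LipschitzOnWith ⟨C, C0⟩ f (Ico a T) := by
    refine LipschitzOnWith.of_dist_le_mul fun x hx y hy => ?_
    rw [dist_eq_norm, Real.dist_eq]
    rcases le_total x y with h | h
    · rw [norm_sub_rev, abs_sub_comm, abs_of_nonneg (sub_nonneg.2 h)]; exact lip x hx y hy h
    · rw [abs_of_nonneg (sub_nonneg.2 h)]; exact lip y hy x hx h
  have hu := hL.uniformContinuousOn
  have hle : 𝓝[<] T ≤ 𝓟 (Ico a T) := le_principal_iff.2 (Ico_mem_nhdsLT ha)
  have cau : Cauchy (𝓝[<] T) := cauchy_nhds.mono nhdsWithin_le_nhds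
  have := (cau.map_of_le hu hle)
  exact CompleteSpace.complete this
lemma gron {f f' : ℝ → E} {T K ε δ : ℝ} (hK : 0 ≤ K) (hε : 0 ≤ ε) (hδ : 0 ≤ δ) (hc : ContinuousOn f (Ico 0 T)) (hd : ∀ t ∈ Ico 0 T, HasDerivWithinAt f (f' t) (Ici t) t)
    (h0 : ‖f 0‖ ≤ δ) (hb : ∀ t ∈ Ico 0 T, ‖f' t‖ ≤ K * ‖f t‖ + ε) : ∀ t ∈ Ico 0 T, ‖f t‖ ≤ gronwallBound δ K ε T := by
  intro t ht
  have sb : Icc 0 t ⊆ Ico 0 T := fun τ hτ => ⟨hτ.1, hτ.2.trans_lt ht.2⟩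
  have h1 := norm_le_gronwallBound_of_norm_deriv_right_le (hc.mono sb) (fun τ hτ => hd τ (sb (Ico_subset_Icc_self hτ))) h0
    (fun τ hτ => hb τ (sb (Ico_subset_Icc_self hτ))) t (right_mem_Icc.2 ht.1)
  refine h1.trans (gronwallBound_mono hδ hε hK ?_)
  rw [sub_zero]; exact ht.2.le
lemma two_sided {f f' : ℝ → E} (hc : ContinuousOn f (Ici 0)) (hd : ∀ t ∈ Ici (0:ℝ), HasDerivWithinAt f (f' t) (Ici t) t) (hc' : ContinuousOn f' (Ici 0)) :
    ∀ t ∈ Ici (0:ℝ), HasDerivWithinAt f (f' t) (Ici 0) t := by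
  intro t ht
  rw [hasDerivWithinAt_iff_isLittleO, Asymptotics.isLittleO_iff]
  intro ε hε
  have ev := (hc' t ht) (Metric.closedBall_mem_nhds _ hε)
  rw [mem_map, Metric.mem_nhdsWithin_iff] at ev
  obtain ⟨δ, hδ, H⟩ := ev
  have lip : ∀ x ∈ Ici (0:ℝ), ∀ y, x ≤ y → x ∈ Metric.ball t δ → y ∈ Metric.ball t δ → ‖(f y - y • f' t) - (f x - x • f' t)‖ ≤ ε * (y - x) := by
    intro x hx y hxy h1 h2
    have sb : Icc x y ⊆ Metric.ball t δ ∩ Ici 0 := fun τ hτ => ⟨by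
      rw [Real.ball_eq_Ioo] at *
      exact ⟨h1.1.trans_le hτ.1, hτ.2.trans_lt h2.2⟩, le_trans hx.out hτ.1⟩
    refine norm_image_sub_le_of_norm_deriv_right_le_segment (f := fun y => f y - y • f' t) (f' := fun τ => f' τ - f' t) ?_ (fun τ hτ => ?_) (fun τ hτ => ?_) y (right_mem_Icc.2 hxy)
    · exact (hc.mono fun τ hτ => (sb hτ).2).sub (by fun_prop)
    · have := (hd τ (sb (Ico_subset_Icc_self hτ)).2).sub ((hasDerivWithinAt_id τ (Ici τ)).smul_const (f' t))
      rw [one_smul] at this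
      exact this
    · have := H (sb (Ico_subset_Icc_self hτ))
      rwa [mem_preimage, Metric.mem_closedBall, dist_eq_norm] at this
  filter_upwards [self_mem_nhdsWithin, mem_nhdsWithin_of_mem_nhds (Metric.ball_mem_nhds t hδ)] with x hx hxb
  rw [Real.norm_eq_abs]
  rcases le_total x t with h | h
  · rw [abs_sub_comm, abs_of_nonneg (sub_nonneg.2 h)]
    refine le_trans (le_of_eq ?_) (lip x hx t h hxb (Metric.mem_ball_self hδ))
    rw [← norm_neg]; congr 1; module
  · rw [abs_of_nonneg (sub_nonneg.2 h)]
    refine le_trans (le_of_eq ?_) (lip t ht x h (Metric.mem_ball_self hδ) hxb)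
    congr 1; module
end
section
variable {X : Type*} [NormedAddCommGroup X] [InnerProductSpace ℝ X] [CompleteSpace X]
lemma coer_inv {B : X →L[ℝ] X →L[ℝ] ℝ} (hB : IsCoercive B) : B.IsInvertible := by
  have inj : Function.Injective B := by
    rw [injective_iff_map_eq_zero]
    intro x hx
    obtain ⟨C, hC, h⟩ := hB
    have := h x
    rw [hx, zero_apply] at this
    have h2 := mul_nonneg (mul_nonneg hC.le (norm_nonneg x)) (norm_nonneg x)
    have h3 : C * ‖x‖ * ‖x‖ = 0 := le_antisymm this h2
    simpa [hC.ne'] using h3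
  have surj : Function.Surjective B := by
    intro l
    refine ⟨hB.continuousLinearEquivOfBilin.symm ((InnerProductSpace.toDual ℝ X).symm l), ?_⟩
    ext w
    rw [← hB.continuousLinearEquivOfBilin_apply, ContinuousLinearEquiv.apply_symm_apply, InnerProductSpace.toDual_symm_apply]
  exact ⟨ContinuousLinearEquiv.ofBijective B (LinearMap.ker_eq_bot.2 inj) (LinearMap.range_eq_top.2 surj), by ext x; rfl⟩
def rh (D : X →L[ℝ] X →L[ℝ] X →L[ℝ] ℝ) (v : X) : X →L[ℝ] ℝ := (1/2 : ℝ) • ((ContinuousLinearMap.flip (ContinuousLinearMap.flip D v)) v) - D v v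
lemma rh_apply (D : X →L[ℝ] X →L[ℝ] X →L[ℝ] ℝ) (v w : X) : rh D v w = 1/2 * D w v v - D v v w := by
  simp [rh]
lemma rh_le (D : X →L[ℝ] X →L[ℝ] X →L[ℝ] ℝ) (v : X) : ‖rh D v‖ ≤ 2 * ‖D‖ * ‖v‖ ^ 2 := by
  refine ContinuousLinearMap.opNorm_le_bound _ (by positivity) fun w => ?_
  have k : ∀ a b c, ‖D a b c‖ ≤ ‖D‖ * ‖a‖ * ‖b‖ * ‖c‖ := fun a b c =>
    ((D a b).le_opNorm c).trans (mul_le_mul_of_nonneg_right (((D a).le_opNorm b).trans (mul_le_mul_of_nonneg_right (D.le_opNorm a) (norm_nonneg _))) (norm_nonneg _))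
  have h1 := k w v v; have h2 := k v v w
  rw [rh_apply]
  refine (norm_sub_le _ _).trans ?_
  rw [norm_mul, Real.norm_of_nonneg (by norm_num : (0:ℝ) ≤ 1/2)]
  have : 0 ≤ ‖D‖ * ‖w‖ * ‖v‖ * ‖v‖ := by positivity
  nlinarith
lemma rh_cd {D : X × X → X →L[ℝ] X →L[ℝ] X →L[ℝ] ℝ} {v : X × X → X} {z : X × X} (hD : ContDiffAt ℝ 1 D z) (hv : ContDiffAt ℝ 1 v z) :
    ContDiffAt ℝ 1 (fun z => rh (D z) (v z)) z := by
  unfold rh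
  have f1 : ContDiffAt ℝ 1 (fun z => ContinuousLinearMap.flip (D z)) z :=
    ((ContinuousLinearMap.flipₗᵢ ℝ X X (X →L[ℝ] ℝ)).contDiff.contDiffAt).comp z hD
  have f2 := f1.clm_apply hv
  have f3 : ContDiffAt ℝ 1 (fun z => ContinuousLinearMap.flip (ContinuousLinearMap.flip (D z) (v z))) z :=
    ((ContinuousLinearMap.flipₗᵢ ℝ X X ℝ).contDiff.contDiffAt).comp z f2
  exact ((f3.clm_apply hv).const_smul _).sub ((hD.clm_apply hv).clm_apply hv)
def acc (G : X → X →L[ℝ] X →L[ℝ] ℝ) (z : X × X) : X := ContinuousLinearMap.inverse (G z.1) (rh (fderiv ℝ G z.1) z.2)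
variable {G : X → X →L[ℝ] X →L[ℝ] ℝ} {M : Set X}
lemma acc_eq {z : X × X} (hc : IsCoercive (G z.1)) : G z.1 (acc G z) = rh (fderiv ℝ G z.1) z.2 :=
  (coer_inv hc).self_apply_inverse _
lemma acc_uniq {z : X × X} (hc : IsCoercive (G z.1)) {a : X} (h : G z.1 a = rh (fderiv ℝ G z.1) z.2) : a = acc G z := by
  rw [acc, ← h]
  exact ((coer_inv hc).inverse_apply_self a).symm
lemma acc_cd {z : X × X} (hG : ContDiffAt ℝ (2:ℕ) G z.1) (hc : IsCoercive (G z.1)) : ContDiffAt ℝ 1 (acc G) z := by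
  have h1 : ContDiffAt ℝ 1 (fun z : X × X => G z.1) z := (hG.of_le (by norm_num)).comp z contDiffAt_fst
  have h2 : ContDiffAt ℝ 1 (fun z : X × X => ContinuousLinearMap.inverse (G z.1)) z :=
    ContDiffAt.comp (g := ContinuousLinearMap.inverse) z (coer_inv hc).contDiffAt_map_inverse h1
  have h3 : ContDiffAt ℝ 1 (fun z : X × X => fderiv ℝ G z.1) z :=
    (hG.fderiv_right (m := 1) (by norm_num)).comp z contDiffAt_fst
  exact h2.clm_apply (rh_cd h3 contDiffAt_snd)
lemma acc_bd {γ : X} (hG : ContDiffAt ℝ (2:ℕ) G γ) (hc : IsCoercive (G γ)) : ∃ C, ∀ᶠ δ in 𝓝 γ, ∀ v, ‖acc G (δ, v)‖ ≤ C * ‖v‖ ^ 2 := by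
  have c1 : ContinuousAt (fun δ => ContinuousLinearMap.inverse (G δ)) γ :=
    ContinuousAt.comp (g := ContinuousLinearMap.inverse) ((coer_inv hc).contDiffAt_map_inverse (n := 0)).continuousAt hG.continuousAt
  have c2 : ContinuousAt (fderiv ℝ G) γ := (hG.fderiv_right (m := 1) (by norm_num)).continuousAt
  refine ⟨(‖ContinuousLinearMap.inverse (G γ)‖ + 1) * (2 * (‖fderiv ℝ G γ‖ + 1)), ?_⟩
  filter_upwards [c1.norm.eventually_lt_const (lt_add_one _), c2.norm.eventually_lt_const (lt_add_one _)] with δ h1 h2 v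
  have := (ContinuousLinearMap.le_opNorm (ContinuousLinearMap.inverse (G δ)) (rh (fderiv ℝ G δ) v)).trans (mul_le_mul h1.le (rh_le _ _) (norm_nonneg _) (by positivity))
  refine this.trans ?_
  have : 2 * ‖fderiv ℝ G δ‖ * ‖v‖ ^ 2 ≤ 2 * (‖fderiv ℝ G γ‖ + 1) * ‖v‖ ^ 2 := by gcongr
  refine (mul_le_mul_of_nonneg_left this (by positivity)).trans (le_of_eq (by ring))
lemma energy {z : ℝ → X × X} {T : ℝ} (hG : ∀ γ ∈ M, ContDiffAt ℝ (2:ℕ) G γ) (hc : ∀ γ ∈ M, IsCoercive (G γ)) (sy : ∀ γ ∈ M, ∀ u v, G γ u v = G γ v u)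
    (h : Sol {z : X × X | z.1 ∈ M} (fun z => (z.2, acc G z)) z T) : ∀ t ∈ Ico 0 T, G (z t).1 (z t).2 (z t).2 = G (z 0).1 (z 0).2 (z 0).2 := by
  intro t ht
  have sb : Icc 0 t ⊆ Ico 0 T := fun τ hτ => ⟨hτ.1, hτ.2.trans_lt ht.2⟩
  have c := h.c.mono sb
  refine constant_of_has_deriv_right_zero (f := fun t => G (z t).1 (z t).2 (z t).2) ?_ (fun τ hτ => ?_) t (right_mem_Icc.2 ht.1)
  · intro τ hτ
    have cG : ContinuousWithinAt (fun t => G (z t).1) (Icc 0 t) τ := (hG _ (h.u τ (sb hτ))).continuousAt.comp_continuousWithinAt (f := fun t => (z t).1) (c τ hτ).fst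
    exact (cG.clm_apply (c τ hτ).snd).clm_apply (c τ hτ).snd
  · have hτ' := sb (Ico_subset_Icc_self hτ)
    have hM := h.u τ hτ'
    have d := h.d τ hτ'
    have d1 : HasDerivWithinAt (fun t => (z t).1) (z τ).2 (Ici τ) τ := (hasFDerivAt_fst (p := z τ)).comp_hasDerivWithinAt τ d
    have d2 : HasDerivWithinAt (fun t => (z t).2) (acc G (z τ)) (Ici τ) τ := (hasFDerivAt_snd (p := z τ)).comp_hasDerivWithinAt τ d
    have dG : HasDerivWithinAt (fun t => G (z t).1) (fderiv ℝ G (z τ).1 (z τ).2) (Ici τ) τ :=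
      ((hG _ hM).differentiableAt (by norm_num)).hasFDerivAt.comp_hasDerivWithinAt τ d1
    have D := (dG.clm_apply d2).clm_apply d2
    refine D.congr_deriv ?_
    rw [add_apply, sy _ hM _ (acc G (z τ)), acc_eq (hc _ hM), rh_apply]
    ring
end
section
variable {s : ℝ} {n : ℕ}
namespace Hs
variable [hs : Fact (s ∈ Ioo (3/2:ℝ) 2)]
lemma GG_coer {γ : Hs s n} (h : IM γ) : IsCoercive (GG s n γ) := by
  obtain ⟨c1, hc1, hw⟩ := ww_lb h
  obtain ⟨C, hC, H⟩ := coer (s := s) (n := n) (EE γ) ((CM s + 2) * ‖γ‖) hc1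
  refine ⟨(C * (1 + ‖γ‖ ^ 2))⁻¹, by positivity, fun u => ?_⟩
  have := H γ h le_rfl hw (fun x => γ.dv_le x) u
  rw [mul_assoc, ← sq, inv_mul_le_iff₀ (by positivity)]
  exact this
variable (s n) in
abbrev MM : Set (Hs s n) := {γ | IM γ}
variable (s n) in
abbrev UU : Set (Hs s n × Hs s n) := {z | z.1 ∈ MM s n}
variable (s n) in
abbrev VF : Hs s n × Hs s n → Hs s n × Hs s n := fun z => (z.2, acc (GG s n) z)
lemma VF_cd : ∀ z ∈ UU s n, ContDiffAt ℝ 1 (VF s n) z := fun z hz => contDiffAt_snd.prodMk (acc_cd (GG_cd hz) (GG_coer hz))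
lemma UU_open : IsOpen (UU s n) := IM_open.preimage continuous_fst
lemma dv_cl (x : ℝ) : ∃ L : Hs s n →L[ℝ] En n, ∀ u, L u = u.dv x :=
  ⟨(BoundedContinuousFunction.evalCLM ℝ ((x, 0) : ℝ × ℝ) : BX (En n) →L[ℝ] En n).comp e0, fun u => e0_apply u (x, 0)⟩
lemma dl_cl (p : ℝ × ℝ) : ∃ L : Hs s n →L[ℝ] En n, ∀ u, L u = u.dlf p :=
  ⟨(BoundedContinuousFunction.evalCLM ℝ p : BX (En n) →L[ℝ] En n).comp dl, fun u => dl_apply u p⟩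
lemma inv_sq_d {E : Type*} [NormedAddCommGroup E] [InnerProductSpace ℝ E] {f : ℝ → E} {f' : E} {t K : ℝ} {S : Set ℝ} (hf : HasDerivWithinAt f f' S t) (h0 : f t ≠ 0)
    (hK : ‖f'‖ ≤ K * ‖f t‖) : ∃ d, HasDerivWithinAt (fun t => (‖f t‖ ^ 2)⁻¹) d S t ∧ ‖d‖ ≤ 2 * K * ‖(‖f t‖ ^ 2)⁻¹‖ := by
  have p : 0 < ‖f t‖ := norm_pos_iff.2 h0
  refine ⟨_, hf.norm_sq.inv (by positivity), ?_⟩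
  have h1 := abs_real_inner_le_norm (f t) f'
  rw [norm_div, norm_neg, norm_mul, Real.norm_eq_abs, abs_two, Real.norm_eq_abs, Real.norm_of_nonneg (by positivity), Real.norm_of_nonneg (by positivity), div_le_iff₀ (by positivity)]
  have e : 2 * K * (‖f t‖ ^ 2)⁻¹ * (‖f t‖ ^ 2) ^ 2 = 2 * (‖f t‖ * (K * ‖f t‖)) := by field_simp
  rw [e]
  have := mul_le_mul_of_nonneg_left hK p.le
  linarith
lemma blow {T : ℝ} (hT : 0 < T) {z : ℝ → Hs s n × Hs s n} (h : Sol (UU s n) (VF s n) z T) : ∃ L ∈ UU s n, Tendsto z (𝓝[<] T) (𝓝 L) := by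
  have IMt : ∀ t ∈ Ico 0 T, IM (z t).1 := h.u
  have d1 : ∀ t ∈ Ico 0 T, HasDerivWithinAt (fun t => (z t).1) (z t).2 (Ici t) t := fun t ht => (hasFDerivAt_fst (p := z t)).comp_hasDerivWithinAt t (h.d t ht)
  have d2 : ∀ t ∈ Ico 0 T, HasDerivWithinAt (fun t => (z t).2) (acc (GG s n) (z t)) (Ici t) t := fun t ht => (hasFDerivAt_snd (p := z t)).comp_hasDerivWithinAt t (h.d t ht)
  have cz1 : ContinuousOn (fun t => (z t).1) (Ico 0 T) := continuous_fst.comp_continuousOn h.c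
  have cz2 : ContinuousOn (fun t => (z t).2) (Ico 0 T) := continuous_snd.comp_continuousOn h.c
  have m0 : (0:ℝ) ∈ Ico 0 T := ⟨le_rfl, hT⟩
  have en := energy (M := MM s n) (fun γ hγ => GG_cd hγ) (fun γ hγ => GG_coer hγ) (fun γ hγ => GG_comm hγ) h
  set E0 := GG s n (z 0).1 (z 0).2 (z 0).2
  have E0n : 0 ≤ E0 := (GG_parts (IMt 0 m0) _).2.2.2
  have hE : ∃ e, ∀ t ∈ Ico 0 T, EE (z t).1 ≤ e := by
    have g := gron (f := fun t => Eh (z t).1) (f' := fun t => fderiv ℝ Eh (z t).1 (z t).2) (T := T) (K := 5) (ε := 5 * E0) (δ := ‖Eh (z 0).1‖) (by norm_num) (by positivity) (norm_nonneg _)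
      (fun t ht => (Eh_cd (IMt t ht)).continuousAt.comp_continuousWithinAt (f := fun t => (z t).1) (cz1 t ht))
      (fun t ht => HasFDerivAt.comp_hasDerivWithinAt (l := (Eh : Hs s n → ℝ)) t (Eh_cd (IMt t ht)).hasFDerivAt (d1 t ht)) le_rfl (fun t ht => by
        have := Eh_bd (IMt t ht) (z t).2
        rw [en t ht] at this
        rw [Real.norm_eq_abs, ← EE_Eh (IMt t ht), Real.norm_of_nonneg (EE_nonneg _)]
        linarith)
    exact ⟨_, fun t ht => by rw [EE_Eh (IMt t ht)]; exact (le_abs_self _).trans (g t ht)⟩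
  obtain ⟨e, he⟩ := hE
  obtain ⟨C, hC, HD⟩ := supD s n e
  set K := √(C * E0)
  have K0 : 0 ≤ K := Real.sqrt_nonneg _
  have vb : ∀ t ∈ Ico 0 T, ∀ x, ‖(z t).2.dv x‖ ≤ K * ‖(z t).1.dv x‖ := by
    intro t ht x
    have := HD _ (IMt t ht) (he t ht) (z t).2 x
    rw [en t ht] at this
    rw [← Du_ww (IMt t ht) (z t).2 x, norm_smul, Real.norm_of_nonneg (ww_pos (IMt t ht) x).le, mul_comm]
    exact mul_le_mul_of_nonneg_right (Real.le_sqrt_of_sq_le this) (norm_nonneg _)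
  have dx : ∀ x, ∀ t ∈ Ico 0 T, HasDerivWithinAt (fun t => (z t).1.dv x) ((z t).2.dv x) (Ici t) t := by
    intro x t ht
    obtain ⟨L, hL⟩ := dv_cl (s := s) (n := n) x
    have := L.hasFDerivAt.comp_hasDerivWithinAt t (d1 t ht)
    simpa only [Function.comp_def, hL] using this
  have cx : ∀ x, ContinuousOn (fun t => (z t).1.dv x) (Ico 0 T) := by
    intro x
    obtain ⟨L, hL⟩ := dv_cl (s := s) (n := n) x
    have := L.continuous.comp_continuousOn cz1
    simpa only [Function.comp_def, hL] using this
  have hC1 : ∃ C1, ∀ t ∈ Ico 0 T, ∀ x, (z t).1.ww x ≤ C1 := by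
    have := CM_pos s
    refine ⟨_, fun t ht x => gron (f := fun t => (z t).1.dv x) (K := K) (ε := 0) (δ := (CM s + 2) * ‖(z 0).1‖) K0 le_rfl (by positivity) (cx x) (dx x) ((z 0).1.dv_le x) (fun t ht => by
      rw [add_zero]; exact vb t ht x) t ht⟩
  obtain ⟨C1, hC1⟩ := hC1
  have hc1 : ∃ c1 > 0, ∀ t ∈ Ico 0 T, ∀ x, c1 ≤ (z t).1.ww x := by
    obtain ⟨c, hc, hw⟩ := ww_lb (IMt 0 m0)
    set B := gronwallBound (c ^ 2)⁻¹ (2 * K) 0 T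
    have B0 : 0 < B := by
      have : B = (c ^ 2)⁻¹ * Real.exp (2 * K * T) := gronwallBound_ε0 _ _ _
      rw [this]; positivity
    have g : ∀ t ∈ Ico 0 T, ∀ x, ((z t).1.ww x ^ 2)⁻¹ ≤ B := by
      intro t ht x
      have ex : ∀ t, ∃ d, t ∈ Ico 0 T → HasDerivWithinAt (fun t => (‖(z t).1.dv x‖ ^ 2)⁻¹) d (Ici t) t ∧ ‖d‖ ≤ 2 * K * ‖(‖(z t).1.dv x‖ ^ 2)⁻¹‖ := by
        intro t
        by_cases ht : t ∈ Ico 0 T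
        · obtain ⟨d, hd⟩ := inv_sq_d (dx x t ht) (norm_pos_iff.1 ((IMt t ht).dv0 x)) (vb t ht x)
          exact ⟨d, fun _ => hd⟩
        · exact ⟨0, fun h => absurd h ht⟩
      choose d hd using ex
      have := gron (f := fun t => (‖(z t).1.dv x‖ ^ 2)⁻¹) (f' := d) (K := 2 * K) (ε := 0) (δ := (c ^ 2)⁻¹) (T := T) (by positivity) le_rfl (by positivity)
        (ContinuousOn.inv₀ ((cx x).norm.pow 2) fun t ht => by have := (IMt t ht).dv0 x; positivity) (fun t ht => (hd t ht).1)
        (by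
          rw [Real.norm_of_nonneg (by positivity)]
          exact inv_anti₀ (by positivity) (pow_le_pow_left₀ hc.le (hw x) 2)) (fun t ht => by rw [add_zero]; exact (hd t ht).2) t ht
      exact (le_abs_self _).trans this
    refine ⟨√B⁻¹, by positivity, fun t ht x => ?_⟩
    have p := ww_pos (IMt t ht) x
    refine Real.sqrt_le_iff.2 ⟨p.le, ?_⟩
    exact (inv_le_comm₀ (by positivity) B0).1 (g t ht x)
  obtain ⟨c1, c1p, hc1⟩ := hc1
  obtain ⟨C2, hC2, Hco⟩ := coer (s := s) (n := n) e C1 c1p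
  have co : ∀ t ∈ Ico 0 T, ‖(z t).2‖ ≤ √(C2 * E0) * ‖(z t).1‖ + √(C2 * E0) := by
    intro t ht
    have := Hco _ (IMt t ht) (he t ht) (hc1 t ht) (hC1 t ht) (z t).2
    rw [en t ht] at this
    refine abs_le_of_sq_le_sq' ?_ (by positivity) |>.2
    have e : √(C2 * E0) ^ 2 = C2 * E0 := Real.sq_sqrt (by positivity)
    have e2 : (√(C2 * E0) * ‖(z t).1‖ + √(C2 * E0)) ^ 2 = C2 * E0 * (1 + ‖(z t).1‖) ^ 2 := by linear_combination (1 + ‖(z t).1‖) ^ 2 * e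
    rw [e2]
    refine this.trans ?_
    have : 0 ≤ C2 * E0 * (2 * ‖(z t).1‖) := by positivity
    linarith
  obtain ⟨R, hR⟩ : ∃ R, ∀ t ∈ Ico 0 T, ‖(z t).1‖ ≤ R := ⟨_, gron (f := fun t => (z t).1) (K := √(C2 * E0)) (ε := √(C2 * E0)) (by positivity) (by positivity) (norm_nonneg _) cz1 d1 le_rfl co⟩
  have vR : ∀ t ∈ Ico 0 T, ‖(z t).2‖ ≤ √(C2 * E0) * R + √(C2 * E0) := fun t ht => (co t ht).trans (by have := hR t ht; gcongr)
  obtain ⟨L1, hL1⟩ := lim_of_bd hT cz1 d1 vR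
  obtain ⟨c, hc, Hs⟩ := sep (s := s) (n := n) e C1 c1p
  have IL : IM L1 := by
    refine IM_of_lb hc fun x k hk => ?_
    obtain ⟨L, hL⟩ := dl_cl (s := s) (n := n) (x, k)
    have t1 : Tendsto (fun t => ‖L (z t).1‖) (𝓝[<] T) (𝓝 ‖L L1‖) := ((L.continuous.tendsto L1).comp hL1).norm
    rw [← hL]
    refine ge_of_tendsto t1 ?_
    filter_upwards [Ico_mem_nhdsLT hT] with t ht
    rw [hL]
    exact Hs _ (IMt t ht) (he t ht) (hc1 t ht) (hC1 t ht) x k hk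
  obtain ⟨Ca, hCa⟩ := acc_bd (GG_cd IL) (GG_coer IL)
  have ev := hL1.eventually hCa
  obtain ⟨a, ha, Ha⟩ := (mem_nhdsLT_iff_exists_Ico_subset (a := T)).1 ev
  set b := max a 0
  have bT : b < T := max_lt ha hT
  have sb : Ico b T ⊆ Ico 0 T := Ico_subset_Ico_left (le_max_right _ _)
  obtain ⟨L2, hL2⟩ := lim_of_bd (C := |Ca| * (√(C2 * E0) * R + √(C2 * E0)) ^ 2) bT (cz2.mono sb) (fun t ht => d2 t (sb ht)) (fun t ht => by
    have h1 : ‖acc (GG s n) (z t)‖ ≤ Ca * ‖(z t).2‖ ^ 2 := Ha (Ico_subset_Ico_left (le_max_left _ _) ht) (z t).2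
    have h2 := vR t (sb ht)
    refine h1.trans (mul_le_mul (le_abs_self _) (pow_le_pow_left₀ (norm_nonneg _) h2 2) (by positivity) (abs_nonneg _)))
  exact ⟨(L1, L2), IL, hL1.prodMk_nhds hL2⟩
lemma glob (γ v : Hs s n) (h : IM γ) : ∃ z : ℝ → Hs s n × Hs s n, z 0 = (γ, v) ∧ ∀ T, Sol (UU s n) (VF s n) z T :=
  sol_glob UU_open VF_cd (x := (γ, v)) h fun T hT z hz => blow hT hz
end Hs
end
section
variable {s : ℝ} {n : ℕ}
namespace Hs
variable [hs : Fact (s ∈ Ioo (3/2:ℝ) 2)]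
lemma der_iff (F F' : ℝ → Hs s n) : IsHsDerivOn s (fun t => (F t).fn) (fun t => (F' t).fn) (Ici 0) ↔ ∀ t ∈ Ici (0:ℝ), HasDerivWithinAt F (F' t) (Ici 0) t := by
  refine forall₂_congr fun t ht => ?_
  have e : ∀ h : ℝ, (HsNorm s fun x => h⁻¹ • ((F (t + h)).fn x - (F t).fn x) - (F' t).fn x) = ‖h⁻¹ • (F (t + h) - F t) - F' t‖ := fun h => by
    rw [norm_eq]; rfl
  simp only [e]
  rw [hasDerivWithinAt_iff_tendsto_slope, tendsto_iff_norm_sub_tendsto_zero (f := slope F t)]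
  have m : map (fun h : ℝ => t + h) (𝓝[{h : ℝ | t + h ∈ Ici (0:ℝ) ∧ h ≠ 0}] 0) = 𝓝[Ici 0 \ {t}] t := by
    have := (Homeomorph.addLeft t).isEmbedding.map_nhdsWithin_eq {h : ℝ | t + h ∈ Ici (0:ℝ) ∧ h ≠ 0} 0
    have e1 : (Homeomorph.addLeft t) '' {h : ℝ | t + h ∈ Ici (0:ℝ) ∧ h ≠ 0} = Ici 0 \ {t} := by
      ext y
      constructor
      · rintro ⟨h, ⟨h1, h2⟩, rfl⟩
        exact ⟨h1, by simpa using h2⟩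
      · rintro ⟨h1, h2⟩
        exact ⟨y - t, ⟨by simpa using h1, sub_ne_zero.2 h2⟩, by simp⟩
    rw [e1] at this
    simpa using this
  rw [← m, tendsto_map'_iff]
  refine tendsto_congr fun h => ?_
  simp only [Function.comp_def, slope_def_module, add_sub_cancel_left]
lemma cont_iff (F : ℝ → Hs s n) : HsContOn s (fun t => (F t).fn) (Ici 0) ↔ ContinuousOn F (Ici 0) := by
  refine forall₂_congr fun t ht => ?_
  have e : ∀ τ : ℝ, (HsNorm s fun x => (F τ).fn x - (F t).fn x) = ‖F τ - F t‖ := fun h => by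
    rw [norm_eq]; rfl
  simp only [e]
  rw [ContinuousWithinAt, tendsto_iff_norm_sub_tendsto_zero (f := F)]
lemma eqn_iff {γ : Hs s n} (h : IM γ) (v a : Hs s n) : (∀ w : ℝ → En n, InHs s w →
    Gmet s γ.fn a.fn w + DGdir s γ.fn v.fn v.fn w - (1 / 2) * DGdir s γ.fn w v.fn v.fn = 0) ↔ a = acc (GG s n) (γ, v) := by
  have k : ∀ w : Hs s n, (Gmet s γ.fn a.fn w.fn + DGdir s γ.fn v.fn v.fn w.fn - (1 / 2) * DGdir s γ.fn w.fn v.fn v.fn = 0) ↔ GG s n γ a w = rh (fderiv ℝ (GG s n) γ) v w := fun w => by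
    rw [GG_met h, DGdir_eq h, DGdir_eq h, rh_apply]
    constructor <;> intro h <;> linarith
  constructor
  · intro H
    refine acc_uniq (z := (γ, v)) (GG_coer h) ?_
    ext w
    exact (k w).1 (H w.fn w.mem)
  · rintro rfl w hw
    refine (k (mk w hw)).2 ?_
    rw [acc_eq (z := (γ, v)) (GG_coer h)]
lemma final (γ v : Hs s n) (h : IM γ) : ∃ Γ V W : ℝ → ℝ → En n, GeodesicSol s γ.fn v.fn Γ V W ∧
      ∀ Γ' V' W' : ℝ → ℝ → En n, GeodesicSol s γ.fn v.fn Γ' V' W' → ∀ t ∈ Set.Ici (0 : ℝ), Γ' t = Γ t := by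
  obtain ⟨z, z0, hz⟩ := glob γ v h
  have I : ∀ t ∈ Ici (0:ℝ), t ∈ Ico 0 (t + 1) := fun t ht => ⟨ht, by linarith⟩
  have zc : ContinuousOn z (Ici 0) := fun t ht => by
    refine ((hz (t + 1)).c t (I t ht)).mono_of_mem_nhdsWithin ?_
    filter_upwards [self_mem_nhdsWithin, mem_nhdsWithin_of_mem_nhds (Iio_mem_nhds (lt_add_one t))] with τ h1 h2 using ⟨h1, h2⟩
  have zu : ∀ t ∈ Ici (0:ℝ), IM (z t).1 := fun t ht => (hz (t + 1)).u t (I t ht)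
  have c2 : ContinuousOn (fun t => (VF s n) (z t)) (Ici 0) := fun t ht =>
    (VF_cd (z t) (zu t ht)).continuousAt.comp_continuousWithinAt (f := z) (zc t ht)
  have zd := two_sided zc (fun t ht => (hz (t + 1)).d t (I t ht)) c2
  refine ⟨fun t => (z t).1.fn, fun t => (z t).2.fn, fun t => (acc (GG s n) (z t)).fn, ⟨fun t ht => ⟨(InM_iff _).2 (zu t ht), mem _, mem _⟩, ?_, ?_, ?_, ?_, ?_, ?_, ?_⟩, ?_⟩
  · change (z 0).1.fn = _; rw [z0]
  · change (z 0).2.fn = _; rw [z0]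
  · exact (der_iff (fun t => (z t).1) (fun t => (z t).2)).2 fun t ht => (hasFDerivAt_fst (p := z t)).comp_hasDerivWithinAt t (zd t ht)
  · exact (der_iff (fun t => (z t).2) (fun t => acc (GG s n) (z t))).2 fun t ht => (hasFDerivAt_snd (p := z t)).comp_hasDerivWithinAt t (zd t ht)
  · exact (cont_iff (fun t => (z t).2)).2 (continuous_snd.comp_continuousOn zc)
  · exact (cont_iff (fun t => acc (GG s n) (z t))).2 (continuous_snd.comp_continuousOn c2)
  · intro t ht
    exact (eqn_iff (zu t ht) _ _).2 rfl
  · intro Γ' V' W' H t ht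
    obtain ⟨hM, h0, hv0, dΓ, dV, -, -, eq⟩ := H
    have lift : ∀ F : ℝ → ℝ → En n, (∀ t ∈ Ici (0:ℝ), InHs s (F t)) → ∃ f : ℝ → Hs s n, ∀ t ∈ Ici (0:ℝ), (f t).fn = F t := by
      intro F hF
      choose! f hf using fun t (ht : t ∈ Ici (0:ℝ)) => (⟨mk (F t) (hF t ht), rfl⟩ : ∃ g : Hs s n, g.fn = F t)
      exact ⟨f, hf⟩
    obtain ⟨g, hg⟩ := lift Γ' fun t ht => (hM t ht).1.1
    obtain ⟨u, hu⟩ := lift V' fun t ht => (hM t ht).2.1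
    obtain ⟨a, ha⟩ := lift W' fun t ht => (hM t ht).2.2
    have cg : ∀ {F F' : ℝ → ℝ → En n} {f f' : ℝ → Hs s n}, (∀ t ∈ Ici (0:ℝ), (f t).fn = F t) → (∀ t ∈ Ici (0:ℝ), (f' t).fn = F' t) → IsHsDerivOn s F F' (Ici 0) →
        ∀ t ∈ Ici (0:ℝ), HasDerivWithinAt f (f' t) (Ici 0) t := by
      intro F F' f f' h1 h2 hd
      refine (der_iff f f').1 fun t ht => (hd t ht).congr' ?_
      filter_upwards [self_mem_nhdsWithin] with k hk
      rw [h1 t ht, h1 _ hk.1, h2 t ht]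
    have D1 := cg hg hu dΓ
    have D2 := cg hu ha dV
    have gI : ∀ t ∈ Ici (0:ℝ), IM (g t) := fun t ht => (InM_iff _).1 (by rw [hg t ht]; exact (hM t ht).1)
    have aE : ∀ t ∈ Ici (0:ℝ), a t = acc (GG s n) (g t, u t) := fun t ht =>
      (eqn_iff (gI t ht) _ _).1 fun w hw => by rw [hg t ht, hu t ht, ha t ht]; exact eq t ht w hw
    have S : Sol (UU s n) (VF s n) (fun t => (g t, u t)) (t + 1) := by
      refine ⟨fun τ hτ => ?_, fun τ hτ => gI τ hτ.1, fun τ hτ => ?_⟩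
      · exact ((D1 τ hτ.1).continuousWithinAt.prodMk (D2 τ hτ.1).continuousWithinAt).mono Ico_subset_Ici_self
      · have := (D1 τ hτ.1).prodMk (D2 τ hτ.1)
        rw [aE τ hτ.1] at this
        exact this.mono (Ici_subset_Ici.2 hτ.1)
    have e := S.uniq VF_cd (hz (t + 1)) (by
      have m0 : (0:ℝ) ∈ Ici (0:ℝ) := self_mem_Ici
      rw [z0]
      exact Prod.ext (ext' (by rw [hg 0 m0, h0])) (ext' (by rw [hu 0 m0, hv0]))) t (I t ht)
    change _ = (z t).1.fn
    rw [← hg t ht, ← e]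
end Hs
end
end

/-- geodesic completeness: for every `γ₀ ∈ 𝓜` and every initial
velocity `v₀ ∈ H^s(𝕋,ℝⁿ)` there is a unique `C²` curve `Γ : [0,∞) → 𝓜` (with velocity
`V` and acceleration `W`, derivatives taken in the `H^s` norm) with `Γ(0) = γ₀`,
`Γ̇(0) = v₀`, solving the geodesic equation `Γ̈ + A_Γ(Γ̇)Γ̇ = 0` for all `t ≥ 0`,
where the Christoffel operator `A` is given by the Koszul formula for `G`. -/
theorem statement18 (s : ℝ) (hs : s ∈ Set.Ioo (3 / 2 : ℝ) 2) (n : ℕ) (hn : 2 ≤ n)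
    (γ₀ v₀ : ℝ → En n) (hγ₀ : InM s γ₀) (hv₀ : InHs s v₀) :
    ∃ Γ V W : ℝ → ℝ → En n, GeodesicSol s γ₀ v₀ Γ V W ∧
      ∀ Γ' V' W' : ℝ → ℝ → En n, GeodesicSol s γ₀ v₀ Γ' V' W' →
        ∀ t ∈ Set.Ici (0 : ℝ), Γ' t = Γ t := by
  have : Fact (s ∈ Ioo (3/2:ℝ) 2) := ⟨hs⟩
  exact Hs.final (Hs.mk γ₀ hγ₀.1) (Hs.mk v₀ hv₀) ((Hs.InM_iff _).1 hγ₀)
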